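/- arXiv:1304.8127 — 3 statements merged into one kernel-verified Lean document; each statement's English description precedes it below -/
import Mathlib

section
/- Let π be a permutation of {1,2,3,4} in the Rauzy class of (4321), let k be a natural number, and let U be a nonempty open subset of the simplex Δ_3. Then there exists a nonempty open subset V ⊆ U such that for every L ∈ V with all entries positive, if the interval exchange transformation T_{L,π} satisfies the Keane condition then T_{L,π} is k-alphabet mixing. -/
open Finset MeasureTheory

namespace IETPaper

/-- The first index `0` of `Fin d` (corresponding to `1` in `{1,…,d}`). -/
def firstIdx (d : ℕ) [NeZero d] : Fin d := ⟨0, Nat.pos_of_ne_zero (NeZero.ne d)⟩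

/-- The last index `d-1` of `Fin d` (corresponding to `d` in `{1,…,d}`). -/
def lastIdx (d : ℕ) [NeZero d] : Fin d :=
  ⟨d - 1, Nat.sub_lt (Nat.pos_of_ne_zero (NeZero.ne d)) one_pos⟩

/-- Left endpoint `l₁ + ⋯ + l_{j-1}` of the `j`-th interval `I_j`. -/
noncomputable def leftEnd {d : ℕ} (L : Fin d → ℝ) (j : Fin d) : ℝ :=
  ∑ k ∈ Finset.univ.filter (fun k => k < j), L k

/-- The interval exchange transformation `T_{L,π}`: on the interval
`I_j = [leftEnd L j, leftEnd L j + L j)` it is the translation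
`x ↦ x - ∑_{k < j} l_k + ∑_{π k' < π j} l_{k'}`; elsewhere it is the identity. -/
noncomputable def ietMap {d : ℕ} (π : Equiv.Perm (Fin d)) (L : Fin d → ℝ) (x : ℝ) : ℝ :=
  if h : ∃ j : Fin d, x ∈ Set.Ico (leftEnd L j) (leftEnd L j + L j) then
    x - leftEnd L h.choose + ∑ k ∈ Finset.univ.filter (fun k => π k < π h.choose), L k
  else x

/-- Topological mixing of `T` on the subspace `X ⊆ ℝ` (with its subspace topology:
open sets of `X` are exactly the sets `U ∩ X` with `U` open in `ℝ`). -/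
def TopMixingOn (T : ℝ → ℝ) (X : Set ℝ) : Prop :=
  ∀ U V : Set ℝ, IsOpen U → IsOpen V → (U ∩ X).Nonempty → (V ∩ X).Nonempty →
    ∃ N : ℕ, ∀ n : ℕ, N ≤ n → ((T^[n] '' (U ∩ X)) ∩ (V ∩ X)).Nonempty

/-- Irreducibility of a permutation: `π {1,…,k} ≠ {1,…,k}` for all `k < d`
(0-indexed: `π` does not preserve `{j | j < k}` for `0 < k < d`). -/
def IsIrreducible {d : ℕ} (π : Equiv.Perm (Fin d)) : Prop :=
  ∀ k : ℕ, 0 < k → k < d →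
    (⇑π '' {j : Fin d | (j : ℕ) < k}) ≠ {j : Fin d | (j : ℕ) < k}

/-- A permutation of `{1,…,d}` (written 0-indexed on `Fin d`) is degenerate if for some
`1 ≤ j < d` (0-indexed: `j + 1 < d`) one of the four listed conditions holds. -/
def IsDegenerate {d : ℕ} (π : Equiv.Perm (Fin d)) : Prop :=
  ∃ j : ℕ, ∃ hj : j + 1 < d,
    ((π ⟨j + 1, hj⟩ : ℕ) = (π ⟨j, by omega⟩ : ℕ) + 1) ∨
    ((π ⟨j, by omega⟩ : ℕ) = d - 1 ∧ (π ⟨j + 1, hj⟩ : ℕ) = 0 ∧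
      (π ⟨0, by omega⟩ : ℕ) = (π ⟨d - 1, by omega⟩ : ℕ) + 1) ∨
    ((π ⟨j + 1, hj⟩ : ℕ) = 0 ∧ (π ⟨0, by omega⟩ : ℕ) = (π ⟨j, by omega⟩ : ℕ) + 1) ∨
    ((π ⟨j + 1, hj⟩ : ℕ) = (π ⟨d - 1, by omega⟩ : ℕ) + 1 ∧ (π ⟨j, by omega⟩ : ℕ) = d - 1)

/-- The Keane condition (idoc): the forward orbits of the interior discontinuities
`δ_i = leftEnd L i` (`i ≠ 0`) are pairwise disjoint infinite sets. -/
def KeaneCondition {d : ℕ} (π : Equiv.Perm (Fin d)) (L : Fin d → ℝ) : Prop :=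
  ∀ i j : Fin d, (i : ℕ) ≠ 0 → (j : ℕ) ≠ 0 → ∀ m n : ℕ,
    (ietMap π L)^[m] (leftEnd L i) = (ietMap π L)^[n] (leftEnd L j) → i = j ∧ m = n

/-- `w` is an allowed block for `T_{L,π}`: some point `x` satisfies
`T^{i+1} x ∈ I_{w i}` for all positions `i` of `w` (i.e. `x ∈ ⋂ T^{-i} I_{a_i}`). -/
def IsAllowedBlock {d : ℕ} (π : Equiv.Perm (Fin d)) (L : Fin d → ℝ)
    (w : List (Fin d)) : Prop :=
  ∃ x : ℝ, ∀ (i : ℕ) (hi : i < w.length),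
    (ietMap π L)^[i + 1] x ∈
      Set.Ico (leftEnd L (w.get ⟨i, hi⟩)) (leftEnd L (w.get ⟨i, hi⟩) + L (w.get ⟨i, hi⟩))

/-- `k`-alphabet mixing: there is `N` such that for any two allowed `k`-blocks `u, v`
and any `n > N` there is an allowed `n`-block beginning with `u` and ending with `v`. -/
def AlphabetMixing {d : ℕ} (π : Equiv.Perm (Fin d)) (L : Fin d → ℝ) (k : ℕ) : Prop :=
  ∃ N : ℕ, ∀ u v : List (Fin d), u.length = k → v.length = k →
    IsAllowedBlock π L u → IsAllowedBlock π L v →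
    ∀ n : ℕ, N < n → ∃ w : List (Fin d),
      w.length = n ∧ IsAllowedBlock π L w ∧ u <+: w ∧ v <:+ w

/-- `π'` is obtained from `π` by the Rauzy move of type `a`. -/
def RauzyMoveA {d : ℕ} [NeZero d] (π π' : Equiv.Perm (Fin d)) : Prop :=
  ∀ j : Fin d,
    ((j : ℕ) ≤ (π.symm (lastIdx d) : ℕ) → π' j = π j) ∧
    ((j : ℕ) = (π.symm (lastIdx d) : ℕ) + 1 → π' j = π (lastIdx d)) ∧
    ((π.symm (lastIdx d) : ℕ) + 1 < (j : ℕ) →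
      π' j = π ⟨(j : ℕ) - 1, lt_of_le_of_lt (Nat.sub_le _ _) j.isLt⟩)

/-- `π'` is obtained from `π` by the Rauzy move of type `b`. -/
def RauzyMoveB {d : ℕ} [NeZero d] (π π' : Equiv.Perm (Fin d)) : Prop :=
  ∀ j : Fin d,
    ((π j : ℕ) ≤ (π (lastIdx d) : ℕ) → π' j = π j) ∧
    ((π (lastIdx d) : ℕ) < (π j : ℕ) → (π j : ℕ) < d - 1 →
      (π' j : ℕ) = (π j : ℕ) + 1) ∧
    ((π j : ℕ) = d - 1 → (π' j : ℕ) = (π (lastIdx d) : ℕ) + 1)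

/-- `π` is in the Rauzy class of `π₀`: reachable by finitely many moves `a`, `b`. -/
def InRauzyClass {d : ℕ} [NeZero d] (π₀ π : Equiv.Perm (Fin d)) : Prop :=
  Relation.ReflTransGen (fun p q => RauzyMoveA p q ∨ RauzyMoveB p q) π₀ π

/-- The permutation `(4321)` on `{1,2,3,4}` (0-indexed: `j ↦ 3 - j`). -/
def perm4321 : Equiv.Perm (Fin 4) := ⟨![3, 2, 1, 0], ![3, 2, 1, 0], by decide, by decide⟩

/-- The permutation `(4213)` on `{1,2,3,4}`: `1↦4, 2↦2, 3↦1, 4↦3`. -/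
def perm4213 : Equiv.Perm (Fin 4) := ⟨![3, 1, 0, 2], ![2, 1, 3, 0], by decide, by decide⟩

/-- The combinatorial data of an interval exchange transformation:
a permutation together with a length vector. -/
structure IET (d : ℕ) where
  perm : Equiv.Perm (Fin d)
  len : Fin d → ℝ

/-- The first step of Rauzy induction on `T` is of type `a`, i.e.
`δ_max = δ_+` (equivalently `l_d < l_{π⁻¹ d}`). -/
def stepA {d : ℕ} [NeZero d] (T : IET d) : Prop :=
  T.len (lastIdx d) < T.len (T.perm.symm (lastIdx d))

/-- The first step of Rauzy induction on `T` is of type `b`, i.e.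
`δ_max = δ_-` (equivalently `l_{π⁻¹ d} < l_d`). -/
def stepB {d : ℕ} [NeZero d] (T : IET d) : Prop :=
  T.len (T.perm.symm (lastIdx d)) < T.len (lastIdx d)

/-- The length vector of `R(T)` after a type `a` step (the first return map of `T`
to `[0, δ_+)`, with intervals in their natural order). -/
noncomputable def lenAfterA {d : ℕ} [NeZero d] (π : Equiv.Perm (Fin d))
    (L : Fin d → ℝ) : Fin d → ℝ := fun j =>
  if (j : ℕ) < (π.symm (lastIdx d) : ℕ) then L j
  else if (j : ℕ) = (π.symm (lastIdx d) : ℕ) then L j - L (lastIdx d)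
  else if (j : ℕ) = (π.symm (lastIdx d) : ℕ) + 1 then L (lastIdx d)
  else L ⟨(j : ℕ) - 1, lt_of_le_of_lt (Nat.sub_le _ _) j.isLt⟩

/-- The length vector of `R(T)` after a type `b` step (the first return map of `T`
to `[0, δ_-)`). -/
noncomputable def lenAfterB {d : ℕ} [NeZero d] (π : Equiv.Perm (Fin d))
    (L : Fin d → ℝ) : Fin d → ℝ := fun j =>
  if j = lastIdx d then L j - L (π.symm (lastIdx d)) else L j

/-- `T'` is the result of one step of Rauzy induction applied to `T`
(`T' = R(T)`, un-rescaled). -/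
def IsRauzyStep {d : ℕ} [NeZero d] (T T' : IET d) : Prop :=
  (stepA T ∧ RauzyMoveA T.perm T'.perm ∧ T'.len = lenAfterA T.perm T.len) ∨
  (stepB T ∧ RauzyMoveB T.perm T'.perm ∧ T'.len = lenAfterB T.perm T.len)

/-- The matrix `M(T,1)` of a type `a` step. -/
def matA {d : ℕ} [NeZero d] (π : Equiv.Perm (Fin d)) : Matrix (Fin d) (Fin d) ℤ :=
  Matrix.of fun i j =>
    if (j : ℕ) ≤ (π.symm (lastIdx d) : ℕ) then (if i = j then 1 else 0)
    else if i = lastIdx d then (if (j : ℕ) = (π.symm (lastIdx d) : ℕ) + 1 then 1 else 0)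
    else if (i : ℕ) = (j : ℕ) - 1 then 1 else 0

/-- The matrix `M(T,1)` of a type `b` step. -/
def matB {d : ℕ} [NeZero d] (π : Equiv.Perm (Fin d)) : Matrix (Fin d) (Fin d) ℤ :=
  Matrix.of fun i j =>
    if i = lastIdx d ∧ j = π.symm (lastIdx d) then 1 else if i = j then 1 else 0

open Classical in
/-- The matrix `M(T,1)` of the first step of Rauzy induction on `T`. -/
noncomputable def stepMat {d : ℕ} [NeZero d] (T : IET d) : Matrix (Fin d) (Fin d) ℤ :=
  if stepA T then matA T.perm else matB T.perm

/-- A run of `n` steps of Rauzy induction: `seq 0 = T`, `seq (i+1) = R(seq i)`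
for `i < n`.  `T` admits `n` steps of Rauzy induction iff such a chain starting
at `T` exists. -/
structure RauzyChain (d : ℕ) [NeZero d] (n : ℕ) where
  seq : ℕ → IET d
  step : ∀ i, i < n → IsRauzyStep (seq i) (seq (i + 1))

/-- The matrix `M(R^a(T), m)` of the steps `a, a+1, …, a+m-1` of a chain. -/
noncomputable def chainMatrixFrom {d n : ℕ} [NeZero d] (c : RauzyChain d n)
    (a m : ℕ) : Matrix (Fin d) (Fin d) ℤ :=
  ((List.range m).map fun i => stepMat (c.seq (a + i))).prod

/-- The matrix `M(T, m)` of the first `m` steps of a chain starting at `T`. -/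
noncomputable def chainMatrix {d n : ℕ} [NeZero d] (c : RauzyChain d n)
    (m : ℕ) : Matrix (Fin d) (Fin d) ℤ :=
  chainMatrixFrom c 0 m

/-- `|C_j(M)|`, the sum of the entries of the `j`-th column of `M`. -/
def colSum {d : ℕ} (M : Matrix (Fin d) (Fin d) ℤ) (j : Fin d) : ℤ := ∑ i, M i j

/-- `M_Δ = M ℝ₊^d ∩ Δ̊_{d-1}`: positive vectors of the cone of `M` lying in the
interior of the standard simplex. -/
def matSimplex {d : ℕ} (M : Matrix (Fin d) (Fin d) ℤ) : Set (Fin d → ℝ) :=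
  {L | (∃ v : Fin d → ℝ, (∀ i, 0 ≤ v i) ∧ L = (M.map (Int.cast : ℤ → ℝ)).mulVec v) ∧
       (∀ i, 0 < L i) ∧ ∑ i, L i = 1}

/-- `u^n`, the `n`-fold concatenation of the word `u` with itself. -/
def wpow {α : Type*} (u : List α) (n : ℕ) : List α := (List.replicate n u).flatten

/-! ### The labelled Rauzy diagram of `(4321)` -/

/-- Position of each letter on the top line, for the seven labelled states. -/
def topPos : Fin 7 → Fin 4 → Fin 4 :=
  ![![0, 1, 2, 3], ![0, 1, 2, 3], ![0, 1, 2, 3], ![0, 2, 3, 1], ![0, 3, 1, 2], ![0, 1, 3, 2],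
    ![0, 2, 3, 1]]

/-- Position of each letter on the bottom line. -/
def botPos : Fin 7 → Fin 4 → Fin 4 :=
  ![![3, 2, 1, 0], ![1, 3, 2, 0], ![2, 1, 3, 0], ![3, 2, 1, 0], ![3, 2, 1, 0], ![1, 3, 2, 0],
    ![2, 3, 1, 0]]

/-- Last letter on the top line. -/
def topLast : Fin 7 → Fin 4 := ![3, 3, 3, 2, 1, 2, 2]

/-- Last letter on the bottom line. -/
def botLast : Fin 7 → Fin 4 := ![0, 1, 2, 0, 0, 1, 1]

/-- The state after a Rauzy move; `true` means that the top letter wins. -/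
def nextState (s : Fin 7) (b : Bool) : Fin 7 :=
  if b then ![1, 2, 0, 6, 4, 5, 3] s else ![3, 5, 2, 4, 0, 1, 6] s

/-- The winning letter of a move. -/
def winner (s : Fin 7) (b : Bool) : Fin 4 := if b then topLast s else botLast s

/-- The losing letter of a move. -/
def loser (s : Fin 7) (b : Bool) : Fin 4 := if b then botLast s else topLast s

/-- The lengths before a move in terms of the lengths after it. -/
def stepLen {R : Type*} [Add R] (s : Fin 7) (b : Bool) (v : Fin 4 → R) : Fin 4 → R :=
  fun c => if c = winner s b then v c + v (loser s b) else v c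

/-- The return words after a move in terms of the return words before it. -/
def stepWord (s : Fin 7) (b : Bool) (W : Fin 4 → List (Fin 4)) : Fin 4 → List (Fin 4) :=
  fun c => if c = loser s b then W (botLast s) ++ W (topLast s) else W c

/-- Final state of a path in the diagram. -/
def endState : Fin 7 → List Bool → Fin 7
  | s, [] => s
  | s, b :: p => endState (nextState s b) p

/-- Initial lengths in terms of the final lengths along a path. -/
def pathLen {R : Type*} [Add R] : Fin 7 → List Bool → (Fin 4 → R) → (Fin 4 → R)
  | _, [], v => v
  | s, b :: p, v => stepLen s b (pathLen (nextState s b) p v)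

/-- Final return words in terms of the initial ones along a path. -/
def pathWord : Fin 7 → List Bool → (Fin 4 → List (Fin 4)) → (Fin 4 → List (Fin 4))
  | _, [], W => W
  | s, b :: p, W => pathWord (nextState s b) p (stepWord s b W)

theorem endState_append (s : Fin 7) (p q : List Bool) :
    endState s (p ++ q) = endState (endState s p) q := by
  induction p generalizing s with
  | nil => rfl
  | cons b p ih => exact ih _

theorem pathLen_append {R : Type*} [Add R] (s : Fin 7) (p q : List Bool) (v : Fin 4 → R) :
    pathLen s (p ++ q) v = pathLen s p (pathLen (endState s p) q v) := by
  induction p generalizing s with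
  | nil => rfl
  | cons b p ih => simp only [List.cons_append, pathLen, endState, ih]

theorem pathWord_append (s : Fin 7) (p q : List Bool) (W : Fin 4 → List (Fin 4)) :
    pathWord s (p ++ q) W = pathWord (endState s p) q (pathWord s p W) := by
  induction p generalizing s W with
  | nil => rfl
  | cons b p ih => simp only [List.cons_append, pathWord, endState, ih]

theorem stepLen_nonneg (s : Fin 7) (b : Bool) {v : Fin 4 → ℝ} (hv : ∀ c, 0 ≤ v c) (c : Fin 4) :
    0 ≤ stepLen s b v c := by
  unfold stepLen
  split_ifs
  · exact add_nonneg (hv _) (hv _)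
  · exact hv _

theorem stepLen_pos (s : Fin 7) (b : Bool) {v : Fin 4 → ℝ} (hv : ∀ c, 0 < v c) (c : Fin 4) :
    0 < stepLen s b v c := by
  unfold stepLen
  split_ifs
  · exact add_pos (hv _) (hv _)
  · exact hv _

theorem pathLen_pos (s : Fin 7) (p : List Bool) {v : Fin 4 → ℝ} (hv : ∀ c, 0 < v c) :
    ∀ c, 0 < pathLen s p v c := by
  induction p generalizing s with
  | nil => exact hv
  | cons b p ih => exact stepLen_pos _ _ (ih _)

theorem stepLen_add (s : Fin 7) (b : Bool) (v w : Fin 4 → ℝ) :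
    stepLen s b (v + w) = stepLen s b v + stepLen s b w := by
  ext c
  simp only [stepLen, Pi.add_apply]
  split_ifs <;> ring

theorem stepLen_smul (s : Fin 7) (b : Bool) (t : ℝ) (v : Fin 4 → ℝ) :
    stepLen s b (t • v) = t • stepLen s b v := by
  ext c
  simp only [stepLen, Pi.smul_apply, smul_eq_mul]
  split_ifs <;> ring

theorem pathLen_add (s : Fin 7) (p : List Bool) (v w : Fin 4 → ℝ) :
    pathLen s p (v + w) = pathLen s p v + pathLen s p w := by
  induction p generalizing s with
  | nil => rfl
  | cons b p ih => simp only [pathLen, ih, stepLen_add]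

theorem pathLen_smul (s : Fin 7) (p : List Bool) (t : ℝ) (v : Fin 4 → ℝ) :
    pathLen s p (t • v) = t • pathLen s p v := by
  induction p generalizing s with
  | nil => rfl
  | cons b p ih => simp only [pathLen, ih, stepLen_smul]

theorem winner_ne_loser (s : Fin 7) (b : Bool) : winner s b ≠ loser s b := by
  revert s b; decide

/-- Inverse of `stepLen`. -/
def stepLenInv (s : Fin 7) (b : Bool) (v : Fin 4 → ℝ) : Fin 4 → ℝ :=
  fun c => if c = winner s b then v c - v (loser s b) else v c

theorem stepLen_stepLenInv (s : Fin 7) (b : Bool) (v : Fin 4 → ℝ) :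
    stepLen s b (stepLenInv s b v) = v := by
  ext c
  simp only [stepLen, stepLenInv, (winner_ne_loser s b).symm, if_false]
  split_ifs <;> ring

theorem stepLenInv_stepLen (s : Fin 7) (b : Bool) (v : Fin 4 → ℝ) :
    stepLenInv s b (stepLen s b v) = v := by
  ext c
  simp only [stepLen, stepLenInv, (winner_ne_loser s b).symm, if_false]
  split_ifs <;> ring

theorem continuous_stepLen (s : Fin 7) (b : Bool) :
    Continuous (stepLen s b : (Fin 4 → ℝ) → Fin 4 → ℝ) := by
  refine continuous_pi fun c => ?_
  unfold stepLen
  split_ifs <;> fun_prop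

theorem continuous_stepLenInv (s : Fin 7) (b : Bool) : Continuous (stepLenInv s b) := by
  refine continuous_pi fun c => ?_
  unfold stepLenInv
  split_ifs <;> fun_prop

theorem exists_pathLen_inverse (s : Fin 7) (p : List Bool) :
    ∃ g : (Fin 4 → ℝ) → (Fin 4 → ℝ), Continuous g ∧ (∀ v, pathLen s p (g v) = v) ∧
      ∀ v, g (pathLen s p v) = v := by
  induction p generalizing s with
  | nil => exact ⟨id, continuous_id, fun _ => rfl, fun _ => rfl⟩
  | cons b p ih =>
    obtain ⟨g, hg, h1, h2⟩ := ih (nextState s b)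
    refine ⟨fun v => g (stepLenInv s b v), hg.comp (continuous_stepLenInv s b), fun v => ?_,
      fun v => ?_⟩
    · simp only [pathLen, h1, stepLen_stepLenInv]
    · simp only [pathLen, stepLenInv_stepLen, h2]

theorem sum_length_mul_stepLen (s : Fin 7) (b : Bool) (W : Fin 4 → List (Fin 4))
    (v : Fin 4 → ℝ) :
    ∑ c, ((W c).length : ℝ) * stepLen s b v c
      = ∑ c, ((stepWord s b W c).length : ℝ) * v c := by
  fin_cases s <;> cases b <;>
    simp [Fin.sum_univ_four, stepLen, stepWord, winner, loser, topLast, botLast] <;> ring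

theorem sum_length_mul_pathLen (s : Fin 7) (p : List Bool) (W : Fin 4 → List (Fin 4))
    (v : Fin 4 → ℝ) :
    ∑ c, ((W c).length : ℝ) * pathLen s p v c
      = ∑ c, ((pathWord s p W c).length : ℝ) * v c := by
  induction p generalizing s W with
  | nil => rfl
  | cons b p ih => rw [pathLen, pathWord, sum_length_mul_stepLen, ih]

/-! ### Itineraries and return words -/

/-- The orbit of `z` under `T` reads the word `X` and then arrives at `z'`. -/
def Reads (T : ℝ → ℝ) (I : Fin 4 → Set ℝ) : ℝ → List (Fin 4) → ℝ → Prop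
  | z, [], z' => z = z'
  | z, a :: X, z' => z ∈ I a ∧ Reads T I (T z) X z'

section Reads

variable {T : ℝ → ℝ} {I : Fin 4 → Set ℝ}

theorem reads_append {z z'' : ℝ} {X Y : List (Fin 4)} :
    Reads T I z (X ++ Y) z'' ↔ ∃ z', Reads T I z X z' ∧ Reads T I z' Y z'' := by
  induction X generalizing z with
  | nil => simp [Reads]
  | cons a X ih => simp only [List.cons_append, Reads, ih]; tauto

theorem Reads.append {z z' z'' : ℝ} {X Y : List (Fin 4)} (h : Reads T I z X z')
    (h' : Reads T I z' Y z'') : Reads T I z (X ++ Y) z'' :=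
  reads_append.2 ⟨z', h, h'⟩

theorem Reads.iterate {z z' : ℝ} {X : List (Fin 4)} (h : Reads T I z X z') :
    T^[X.length] z = z' := by
  induction X generalizing z with
  | nil => exact h
  | cons a X ih => exact ih h.2

theorem Reads.mem {z z' : ℝ} {X : List (Fin 4)} (h : Reads T I z X z') (i : ℕ)
    (hi : i < X.length) : T^[i] z ∈ I (X.get ⟨i, hi⟩) := by
  induction X generalizing z i with
  | nil => simp at hi
  | cons a X ih =>
    cases i with
    | zero => exact h.1
    | succ i => exact ih h.2 i (by simpa using hi)

theorem reads_of_mem {z : ℝ} {X : List (Fin 4)}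
    (h : ∀ (i : ℕ) (hi : i < X.length), T^[i] z ∈ I (X.get ⟨i, hi⟩)) :
    Reads T I z X (T^[X.length] z) := by
  induction X generalizing z with
  | nil => rfl
  | cons a X ih =>
    exact ⟨h 0 (by simp), ih fun i hi => h (i + 1) (by simpa using hi)⟩

theorem Reads.isPrefix_of_le (hI : ∀ a b x, x ∈ I a → x ∈ I b → a = b) {z z' z'' : ℝ}
    {X Y : List (Fin 4)} (h : Reads T I z X z') (h' : Reads T I z Y z'')
    (hl : Y.length ≤ X.length) : Y <+: X := by
  induction X generalizing z Y with
  | nil => simp at hl; simp [hl]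
  | cons a X ih =>
    cases Y with
    | nil => simp
    | cons b Y =>
      obtain rfl := hI _ _ _ h.1 h'.1
      exact (List.prefix_cons_inj _).2 (ih h.2 h'.2 (by simpa using hl))

theorem Reads.translate {tr : Fin 4 → ℝ} (hT : ∀ a x, x ∈ I a → T x = x + tr a) {z z' : ℝ}
    {X : List (Fin 4)} (h : Reads T I z X z') : z' = z + (X.map tr).sum := by
  induction X generalizing z with
  | nil => simpa [Reads] using h.symm
  | cons a X ih => rw [ih h.2, hT a z h.1, List.map_cons, List.sum_cons, add_assoc]

end Reads

/-- Left endpoint of the interval of the letter `c` when letters are ordered by `pos`. -/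
noncomputable def offset (pos : Fin 4 → Fin 4) (v : Fin 4 → ℝ) (c : Fin 4) : ℝ :=
  ∑ d, if pos d < pos c then v d else 0

/-- The induced map of `T` is the interval exchange with state `s` and lengths `v`, with return
words `W`. -/
def Induces (T : ℝ → ℝ) (I : Fin 4 → Set ℝ) (s : Fin 7) (v : Fin 4 → ℝ)
    (W : Fin 4 → List (Fin 4)) : Prop :=
  ∀ c x, offset (topPos s) v c ≤ x → x < offset (topPos s) v c + v c →
    Reads T I x (W c) (x - offset (topPos s) v c + offset (botPos s) v c)

/-- The towers of the induced map fill `[0, r)`. -/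
def Covers (T : ℝ → ℝ) (I : Fin 4 → Set ℝ) (r : ℝ) (s : Fin 7) (v : Fin 4 → ℝ)
    (W : Fin 4 → List (Fin 4)) : Prop :=
  ∀ y, 0 ≤ y → y < r → ∃ c x X Y, offset (topPos s) v c ≤ x ∧ x < offset (topPos s) v c + v c ∧
    W c = X ++ Y ∧ Y ≠ [] ∧ Reads T I x X y

/-- Every singularity of the induced map lies on the backward orbit of the singularity of the
original map with the same label. -/
def Singular (T : ℝ → ℝ) (D : Fin 4 → ℝ) (s : Fin 7) (v : Fin 4 → ℝ) : Prop :=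
  ∀ c, c ≠ 0 → ∃ i, T^[i] (offset (topPos s) v c) = D c

theorem offset_step_of_ne_loser (s : Fin 7) (b : Bool) {v : Fin 4 → ℝ} (hv : ∀ c, 0 ≤ v c)
    (c : Fin 4) (hc : c ≠ loser s b) :
    offset (topPos s) (stepLen s b v) c = offset (topPos (nextState s b)) v c ∧
    offset (botPos s) (stepLen s b v) c = offset (botPos (nextState s b)) v c ∧
    v c ≤ stepLen s b v c := by
  have h0 := hv 0
  have h1 := hv 1
  have h2 := hv 2
  have h3 := hv 3
  fin_cases s <;> cases b <;> fin_cases c <;>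
    simp [loser, topLast, botLast] at hc <;>
    simp [Fin.sum_univ_four, stepLen, winner, loser, topLast, botLast, offset, topPos, botPos,
      nextState] <;>
    linarith

theorem offset_step_loser_top (s : Fin 7) (v : Fin 4 → ℝ) :
    offset (topPos (nextState s true)) v (botLast s)
        = offset (topPos s) (stepLen s true v) (botLast s) ∧
    offset (botPos s) (stepLen s true v) (botLast s)
        = offset (topPos s) (stepLen s true v) (topLast s) + v (topLast s) ∧
    offset (botPos (nextState s true)) v (botLast s)
        = offset (botPos s) (stepLen s true v) (topLast s) + v (topLast s) := by
  fin_cases s <;>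
    simp [Fin.sum_univ_four, stepLen, winner, loser, topLast, botLast, offset, topPos, botPos,
      nextState] <;>
    (try refine ⟨?_, ?_⟩) <;> (try ring_nf)

theorem offset_step_loser_bot (s : Fin 7) (v : Fin 4 → ℝ) :
    offset (topPos (nextState s false)) v (topLast s)
        = offset (topPos s) (stepLen s false v) (botLast s) + v (botLast s) ∧
    offset (botPos s) (stepLen s false v) (botLast s) + v (botLast s)
        = offset (topPos s) (stepLen s false v) (topLast s) ∧
    offset (botPos (nextState s false)) v (topLast s)
        = offset (botPos s) (stepLen s false v) (topLast s) := by
  fin_cases s <;>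
    simp [Fin.sum_univ_four, stepLen, winner, loser, topLast, botLast, offset, topPos, botPos,
      nextState] <;>
    (try refine ⟨?_, ?_⟩) <;> (try ring_nf)

theorem topLast_ne_botLast (s : Fin 7) : topLast s ≠ botLast s := by
  revert s; decide

theorem stepLen_winner (s : Fin 7) (b : Bool) (v : Fin 4 → ℝ) :
    stepLen s b v (winner s b) = v (winner s b) + v (loser s b) := by
  simp [stepLen]

theorem stepLen_of_ne (s : Fin 7) (b : Bool) (v : Fin 4 → ℝ) {c : Fin 4} (hc : c ≠ winner s b) :
    stepLen s b v c = v c := by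
  simp [stepLen, hc]

section Induction

variable {T : ℝ → ℝ} {I : Fin 4 → Set ℝ} {s : Fin 7} {b : Bool} {v : Fin 4 → ℝ}
  {W : Fin 4 → List (Fin 4)}

/-- A point of the loser's new interval first reads the word of the last bottom letter. -/
theorem Induces.loser_aux (h : Induces T I s (stepLen s b v) W) (hv : ∀ c, 0 ≤ v c) {x : ℝ}
    (h1 : offset (topPos (nextState s b)) v (loser s b) ≤ x)
    (h2 : x < offset (topPos (nextState s b)) v (loser s b) + v (loser s b)) :
    ∃ y, Reads T I x (W (botLast s)) y ∧
      offset (topPos s) (stepLen s b v) (topLast s) ≤ y ∧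
      y < offset (topPos s) (stepLen s b v) (topLast s) + stepLen s b v (topLast s) ∧
      Reads T I y (W (topLast s)) (x - offset (topPos (nextState s b)) v (loser s b)
        + offset (botPos (nextState s b)) v (loser s b)) ∧
      (b = false → y - offset (topPos s) (stepLen s b v) (topLast s)
        = x - offset (topPos (nextState s b)) v (loser s b)) := by
  have hb := h (botLast s) x
  have ht := h (topLast s)
  have hvt := hv (topLast s)
  have hvb := hv (botLast s)
  cases b
  · simp only [loser, Bool.false_eq_true, if_false] at h1 h2 hb ht ⊢
    obtain ⟨e1, e2, e3⟩ := offset_step_loser_bot s v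
    have w1 : stepLen s false v (botLast s) = v (botLast s) + v (topLast s) :=
      stepLen_winner s false v
    have w2 : stepLen s false v (topLast s) = v (topLast s) :=
      stepLen_of_ne s false v (topLast_ne_botLast s)
    refine ⟨_, hb (by linarith) (by linarith), by linarith, by linarith, ?_, fun _ => by linarith⟩
    convert ht (x - offset (topPos s) (stepLen s false v) (botLast s)
      + offset (botPos s) (stepLen s false v) (botLast s)) (by linarith) (by linarith) using 1
    linarith
  · simp only [loser, if_true] at h1 h2 hb ht ⊢
    obtain ⟨e1, e2, e3⟩ := offset_step_loser_top s v
    have w1 : stepLen s true v (topLast s) = v (topLast s) + v (botLast s) :=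
      stepLen_winner s true v
    have w2 : stepLen s true v (botLast s) = v (botLast s) :=
      stepLen_of_ne s true v (topLast_ne_botLast s).symm
    refine ⟨_, hb (by linarith) (by linarith), by linarith, by linarith, ?_, by simp⟩
    convert ht (x - offset (topPos s) (stepLen s true v) (botLast s)
      + offset (botPos s) (stepLen s true v) (botLast s)) (by linarith) (by linarith) using 1
    linarith

theorem Induces.step (h : Induces T I s (stepLen s b v) W) (hv : ∀ c, 0 ≤ v c) :
    Induces T I (nextState s b) v (stepWord s b W) := by
  intro c x h1 h2
  by_cases hc : c = loser s b
  · subst hc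
    obtain ⟨y, hy1, -, -, hy2, -⟩ := h.loser_aux hv h1 h2
    simpa [stepWord] using hy1.append hy2
  · obtain ⟨e1, e2, e3⟩ := offset_step_of_ne_loser s b hv c hc
    have := h c x (by linarith) (by linarith)
    simpa [stepWord, hc, e1, e2] using this

/-- A point of an old interval is in the corresponding new one, or in the loser's one, or it is
reached from the loser's one. -/
theorem mem_step_cases (s : Fin 7) (b : Bool) {v : Fin 4 → ℝ} (hv : ∀ c, 0 ≤ v c) {c : Fin 4}
    {x : ℝ} (h1 : offset (topPos s) (stepLen s b v) c ≤ x)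
    (h2 : x < offset (topPos s) (stepLen s b v) c + stepLen s b v c) :
    (c ≠ loser s b ∧ offset (topPos (nextState s b)) v c ≤ x ∧
      x < offset (topPos (nextState s b)) v c + v c) ∨
    (c = botLast s ∧ offset (topPos (nextState s b)) v (loser s b) ≤ x ∧
      x < offset (topPos (nextState s b)) v (loser s b) + v (loser s b)) ∨
    (c = topLast s ∧ ∃ x0, offset (topPos (nextState s b)) v (loser s b) ≤ x0 ∧
      x0 < offset (topPos (nextState s b)) v (loser s b) + v (loser s b) ∧
      x = x0 - offset (topPos s) (stepLen s b v) (botLast s)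
        + offset (botPos s) (stepLen s b v) (botLast s)) := by
  have hvt := hv (topLast s)
  have hvb := hv (botLast s)
  cases b
  · simp only [loser, Bool.false_eq_true, if_false]
    obtain ⟨e1, e2, e3⟩ := offset_step_loser_bot s v
    have w1 : stepLen s false v (botLast s) = v (botLast s) + v (topLast s) :=
      stepLen_winner s false v
    have w2 : stepLen s false v (topLast s) = v (topLast s) :=
      stepLen_of_ne s false v (topLast_ne_botLast s)
    by_cases hc : c = topLast s
    · subst hc
      right; right
      refine ⟨rfl, x + offset (topPos s) (stepLen s false v) (botLast s)
        - offset (botPos s) (stepLen s false v) (botLast s), ?_, ?_, ?_⟩ <;> linarith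
    · obtain ⟨f1, f2, f3⟩ := offset_step_of_ne_loser s false hv c hc
      by_cases hcb : c = botLast s
      · subst hcb
        by_cases hx : x < offset (topPos (nextState s false)) v (botLast s) + v (botLast s)
        · exact Or.inl ⟨hc, by linarith, hx⟩
        · exact Or.inr (Or.inl ⟨rfl, by linarith, by linarith⟩)
      · rw [stepLen_of_ne s false v hcb] at h2
        exact Or.inl ⟨hc, by linarith, by linarith⟩
  · simp only [loser, if_true]
    obtain ⟨e1, e2, e3⟩ := offset_step_loser_top s v
    have w1 : stepLen s true v (topLast s) = v (topLast s) + v (botLast s) :=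
      stepLen_winner s true v
    have w2 : stepLen s true v (botLast s) = v (botLast s) :=
      stepLen_of_ne s true v (topLast_ne_botLast s).symm
    by_cases hc : c = botLast s
    · subst hc
      exact Or.inr (Or.inl ⟨rfl, by linarith, by linarith⟩)
    · obtain ⟨f1, f2, f3⟩ := offset_step_of_ne_loser s true hv c hc
      by_cases hct : c = topLast s
      · subst hct
        by_cases hx : x < offset (topPos (nextState s true)) v (topLast s) + v (topLast s)
        · exact Or.inl ⟨hc, by linarith, hx⟩
        · refine Or.inr (Or.inr ⟨rfl, x + offset (topPos s) (stepLen s true v) (botLast s)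
            - offset (botPos s) (stepLen s true v) (botLast s), ?_, ?_, ?_⟩) <;> linarith
      · rw [stepLen_of_ne s true v hct] at h2
        exact Or.inl ⟨hc, by linarith, by linarith⟩

theorem Covers.step {r : ℝ} (h : Induces T I s (stepLen s b v) W)
    (hr : Covers T I r s (stepLen s b v) W) (hv : ∀ c, 0 ≤ v c) :
    Covers T I r (nextState s b) v (stepWord s b W) := by
  intro y hy0 hyr
  obtain ⟨c, x, X, Y, h1, h2, hW, hY, hX⟩ := hr y hy0 hyr
  rcases mem_step_cases s b hv h1 h2 with ⟨hc, g1, g2⟩ | ⟨hc, g1, g2⟩ | ⟨hc, x0, g1, g2, g3⟩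
  · exact ⟨c, x, X, Y, g1, g2, by simp [stepWord, hc, hW], hY, hX⟩
  · subst hc
    exact ⟨loser s b, x, X, Y ++ W (topLast s), g1, g2, by simp [stepWord, hW], by simp [hY], hX⟩
  · subst hc
    obtain ⟨z, hz, -⟩ := h.loser_aux hv g1 g2
    have hv' : ∀ c, 0 ≤ stepLen s b v c := stepLen_nonneg s b hv
    have hvt := hv (topLast s)
    have hvb := hv (botLast s)
    have : Reads T I x0 (W (botLast s)) x := by
      rw [g3]
      apply h
      · cases b
        · simp only [loser, Bool.false_eq_true, if_false] at g1 g2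
          linarith [(offset_step_loser_bot s v).1]
        · simp only [loser, if_true] at g1 g2
          linarith [(offset_step_loser_top s v).1]
      · cases b
        · simp only [loser, Bool.false_eq_true, if_false] at g1 g2
          have w1 : stepLen s false v (botLast s) = v (botLast s) + v (topLast s) :=
            stepLen_winner s false v
          linarith [(offset_step_loser_bot s v).1]
        · simp only [loser, if_true] at g1 g2
          have w2 : stepLen s true v (botLast s) = v (botLast s) :=
            stepLen_of_ne s true v (topLast_ne_botLast s).symm
          linarith [(offset_step_loser_top s v).1]
    exact ⟨loser s b, x0, W (botLast s) ++ X, Y, g1, g2, by simp [stepWord, hW], hY,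
      this.append hX⟩

theorem Singular.step {D : Fin 4 → ℝ} (h : Induces T I s (stepLen s b v) W)
    (hs : Singular T D s (stepLen s b v)) (hv : ∀ c, 0 < v c) :
    Singular T D (nextState s b) v := by
  intro c hc
  obtain ⟨i, hi⟩ := hs c hc
  have hv' : ∀ c, 0 ≤ v c := fun c => (hv c).le
  by_cases hcl : c = loser s b
  · subst hcl
    cases b
    · obtain ⟨y, hy1, hy2, -, -, hy3⟩ := h.loser_aux hv' le_rfl
        (by linarith [hv (loser s false)])
      refine ⟨i + (W (botLast s)).length, ?_⟩
      rw [Function.iterate_add_apply, hy1.iterate, ← hi]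
      congr 1
      simp only [loser, Bool.false_eq_true, if_false] at hy3 ⊢
      linarith [hy3 trivial]
    · refine ⟨i, ?_⟩
      simp only [loser, if_true] at hi ⊢
      rw [(offset_step_loser_top s v).1, hi]
  · exact ⟨i, by rw [← (offset_step_of_ne_loser s b hv' c hcl).1, hi]⟩

end Induction

section PathInduction

variable {T : ℝ → ℝ} {I : Fin 4 → Set ℝ}

theorem Induces.path {s : Fin 7} {p : List Bool} {v : Fin 4 → ℝ} {W : Fin 4 → List (Fin 4)}
    (h : Induces T I s (pathLen s p v) W) (hv : ∀ c, 0 < v c) :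
    Induces T I (endState s p) v (pathWord s p W) := by
  induction p generalizing s W with
  | nil => exact h
  | cons b p ih => exact ih (h.step fun c => (pathLen_pos _ _ hv c).le)

theorem Covers.path {r : ℝ} {s : Fin 7} {p : List Bool} {v : Fin 4 → ℝ}
    {W : Fin 4 → List (Fin 4)} (h : Induces T I s (pathLen s p v) W)
    (hr : Covers T I r s (pathLen s p v) W) (hv : ∀ c, 0 < v c) :
    Covers T I r (endState s p) v (pathWord s p W) := by
  induction p generalizing s W with
  | nil => exact hr
  | cons b p ih =>
    have hp : ∀ c, 0 ≤ pathLen (nextState s b) p v c := fun c => (pathLen_pos _ _ hv c).le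
    exact ih (h.step hp) (hr.step h hp)

theorem Singular.path {D : Fin 4 → ℝ} {s : Fin 7} {p : List Bool} {v : Fin 4 → ℝ}
    {W : Fin 4 → List (Fin 4)} (h : Induces T I s (pathLen s p v) W)
    (hs : Singular T D s (pathLen s p v)) (hv : ∀ c, 0 < v c) :
    Singular T D (endState s p) v := by
  induction p generalizing s W with
  | nil => exact hs
  | cons b p ih =>
    have hp : ∀ c, 0 < pathLen (nextState s b) p v c := pathLen_pos _ _ hv
    exact ih (h.step fun c => (hp c).le) (hs.step h hp)

end PathInduction

theorem exists_state_of_moveA {π π' : Equiv.Perm (Fin 4)} {s : Fin 7}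
    (hs : ∀ c, π (topPos s c) = botPos s c) (h : RauzyMoveA π π') :
    ∀ c, π' (topPos (nextState s false) c) = botPos (nextState s false) c := by
  have key : π.symm (lastIdx 4) = topPos s (botLast s) := by
    rw [Equiv.symm_apply_eq, hs]
    exact (by decide : ∀ s, lastIdx 4 = botPos s (botLast s)) s
  have h' : ∀ j : Fin 4, ((j : ℕ) ≤ (topPos s (botLast s) : ℕ) → π' j = π j) ∧
    ((j : ℕ) = (topPos s (botLast s) : ℕ) + 1 → π' j = π 3) ∧
    ((topPos s (botLast s) : ℕ) + 1 < (j : ℕ) → π' j = π (j - 1)) := by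
    intro j
    have := h j
    rw [key] at this
    refine ⟨this.1, this.2.1, fun hj => ?_⟩
    rw [this.2.2 hj]
    congr 1
    revert hj
    fin_cases j <;> simp
  clear h key
  have p0 := hs 0
  have p1 := hs 1
  have p2 := hs 2
  have p3 := hs 3
  have h0 := h' 0
  have h1 := h' 1
  have h2 := h' 2
  have h3 := h' 3
  clear h' hs
  fin_cases s <;> simp [topPos, botPos, botLast] at p0 p1 p2 p3 h0 h1 h2 h3 <;>
  simp [Fin.forall_fin_succ, nextState, topPos, botPos, *]

theorem exists_state_of_moveB {π π' : Equiv.Perm (Fin 4)} {s : Fin 7}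
    (hs : ∀ c, π (topPos s c) = botPos s c) (h : RauzyMoveB π π') :
    ∀ c, π' (topPos (nextState s true) c) = botPos (nextState s true) c := by
  have p0 := hs 0
  have p1 := hs 1
  have p2 := hs 2
  have p3 := hs 3
  have h0 := h 0
  have h1 := h 1
  have h2 := h 2
  have h3 := h 3
  have e : lastIdx 4 = 3 := rfl
  rw [e] at h0 h1 h2 h3
  clear h hs
  fin_cases s <;> simp [topPos, botPos] at p0 p1 p2 p3 <;>
    simp [*] at h0 h1 h2 h3 <;>
  simp [Fin.forall_fin_succ, nextState, topPos, botPos, *, Fin.ext_iff]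

theorem exists_state_of_inRauzyClass {π : Equiv.Perm (Fin 4)} (h : InRauzyClass perm4321 π) :
    ∃ s, ∀ c, π (topPos s c) = botPos s c := by
  induction h with
  | refl => exact ⟨0, by decide⟩
  | tail _ h ih =>
    obtain ⟨s, hs⟩ := ih
    rcases h with h | h
    · exact ⟨_, exists_state_of_moveA hs h⟩
    · exact ⟨_, exists_state_of_moveB hs h⟩

/-! ### The interval exchange as its own induced map -/

/-- The intervals of the exchange. -/
def cell (L : Fin 4 → ℝ) (j : Fin 4) : Set ℝ := Set.Ico (leftEnd L j) (leftEnd L j + L j)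

/-- The translation applied on each interval of the exchange. -/
noncomputable def shift (π : Equiv.Perm (Fin 4)) (L : Fin 4 → ℝ) (j : Fin 4) : ℝ :=
  (∑ k, if π k < π j then L k else 0) - leftEnd L j

theorem leftEnd_eq (L : Fin 4 → ℝ) (j : Fin 4) :
    leftEnd L j = ∑ k, if k < j then L k else 0 := by
  rw [leftEnd, Finset.sum_filter]

theorem cell_disjoint {L : Fin 4 → ℝ} (hL : ∀ j, 0 ≤ L j) (a b : Fin 4) (x : ℝ)
    (ha : x ∈ cell L a) (hb : x ∈ cell L b) : a = b := by
  have h0 := hL 0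
  have h1 := hL 1
  have h2 := hL 2
  have h3 := hL 3
  unfold cell at ha hb
  rw [leftEnd_eq, Set.mem_Ico] at ha hb
  fin_cases a <;> fin_cases b <;> simp [Fin.sum_univ_four] at ha hb ⊢ <;> linarith

theorem exists_mem_cell {L : Fin 4 → ℝ} {x : ℝ} (h0 : 0 ≤ x) (h1 : x < ∑ j, L j) :
    ∃ j, x ∈ cell L j := by
  by_contra! h
  have a0 := h 0
  have a1 := h 1
  have a2 := h 2
  have a3 := h 3
  simp [cell, leftEnd_eq, Fin.sum_univ_four] at a0 a1 a2 a3 h1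
  linarith [a3 (a2 (a1 (a0 h0)))]

theorem ietMap_of_mem_cell (π : Equiv.Perm (Fin 4)) {L : Fin 4 → ℝ} (hL : ∀ j, 0 ≤ L j)
    (j : Fin 4) (x : ℝ) (hx : x ∈ cell L j) : ietMap π L x = x + shift π L j := by
  have h : ∃ j, x ∈ Set.Ico (leftEnd L j) (leftEnd L j + L j) := ⟨j, hx⟩
  have hj : h.choose = j := cell_disjoint hL _ _ x h.choose_spec hx
  rw [ietMap, dif_pos h, hj, Finset.sum_filter, shift]
  ring

theorem topPos_bijective (s : Fin 7) : Function.Bijective (topPos s) := by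
  revert s; decide

theorem botPos_bijective (s : Fin 7) : Function.Bijective (botPos s) := by
  revert s; decide

theorem offset_topPos (s : Fin 7) (L : Fin 4 → ℝ) (c : Fin 4) :
    offset (topPos s) (fun d => L (topPos s d)) c = leftEnd L (topPos s c) := by
  rw [leftEnd_eq, offset]
  exact (topPos_bijective s).sum_comp fun k => if k < topPos s c then L k else 0

theorem offset_botPos {π : Equiv.Perm (Fin 4)} {s : Fin 7}
    (hs : ∀ c, π (topPos s c) = botPos s c) (L : Fin 4 → ℝ) (c : Fin 4) :
    offset (botPos s) (fun d => L (topPos s d)) c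
      = ∑ k, if π k < π (topPos s c) then L k else 0 := by
  rw [hs, offset, ← (topPos_bijective s).sum_comp fun k => if π k < botPos s c then L k else 0]
  simp only [hs]

theorem induces_ietMap {π : Equiv.Perm (Fin 4)} {s : Fin 7}
    (hs : ∀ c, π (topPos s c) = botPos s c) {L : Fin 4 → ℝ} (hL : ∀ j, 0 ≤ L j) :
    Induces (ietMap π L) (cell L) s (fun c => L (topPos s c)) (fun c => [topPos s c]) := by
  intro c x h1 h2
  rw [offset_botPos hs]
  rw [offset_topPos] at h1 h2 ⊢
  refine ⟨⟨h1, h2⟩, ?_⟩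
  rw [Reads, ietMap_of_mem_cell π hL _ x ⟨h1, h2⟩, shift]
  ring

theorem covers_ietMap (π : Equiv.Perm (Fin 4)) (s : Fin 7) (L : Fin 4 → ℝ) :
    Covers (ietMap π L) (cell L) (∑ j, L j) s (fun c => L (topPos s c))
      (fun c => [topPos s c]) := by
  intro y h0 h1
  obtain ⟨j, hj⟩ := exists_mem_cell h0 h1
  obtain ⟨c, rfl⟩ := (topPos_bijective s).2 j
  refine ⟨c, y, [], [topPos s c], ?_, ?_, rfl, by simp, rfl⟩
  · rw [offset_topPos]; exact hj.1
  · rw [offset_topPos]; exact hj.2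

theorem singular_ietMap (π : Equiv.Perm (Fin 4)) (s : Fin 7) (L : Fin 4 → ℝ) :
    Singular (ietMap π L) (fun c => leftEnd L (topPos s c)) s (fun c => L (topPos s c)) :=
  fun c _ => ⟨0, offset_topPos s L c⟩

theorem sum_topPos (s : Fin 7) (L : Fin 4 → ℝ) : ∑ c, L (topPos s c) = ∑ j, L j :=
  (topPos_bijective s).sum_comp L

/-- The intervals ordered by the bijection `pos` tile `[0, ∑ v)`. -/
theorem exists_offset_mem {pos : Fin 4 → Fin 4} (hp : Function.Bijective pos) (v : Fin 4 → ℝ)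
    {x : ℝ} (h0 : 0 ≤ x) (h1 : x < ∑ c, v c) :
    ∃ c, offset pos v c ≤ x ∧ x < offset pos v c + v c := by
  let e := Equiv.ofBijective pos hp
  have hx : x < ∑ j, v (e.symm j) := by rwa [Equiv.sum_comp e.symm v]
  obtain ⟨j, hj⟩ := exists_mem_cell h0 hx
  have hl : leftEnd (fun j => v (e.symm j)) j = offset pos v (e.symm j) := by
    rw [leftEnd_eq, offset, ← Equiv.sum_comp e]
    have h2 : ∀ d, pos d = e d := fun _ => rfl
    simp [h2]
  exact ⟨e.symm j, by rw [← hl]; exact hj.1, by rw [← hl]; exact hj.2⟩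

theorem offset_nonneg (pos : Fin 4 → Fin 4) {v : Fin 4 → ℝ} (hv : ∀ c, 0 ≤ v c) (c : Fin 4) :
    0 ≤ offset pos v c :=
  Finset.sum_nonneg fun d _ => by split_ifs <;> simp [hv]

theorem offset_add_le (pos : Fin 4 → Fin 4) {v : Fin 4 → ℝ} (hv : ∀ c, 0 ≤ v c) (c : Fin 4) :
    offset pos v c + v c ≤ ∑ d, v d := by
  have : offset pos v c + (∑ d, if d = c then v d else 0) ≤ ∑ d, v d := by
    rw [offset, ← Finset.sum_add_distrib]
    refine Finset.sum_le_sum fun d _ => ?_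
    by_cases h : d = c
    · subst h; simp
    · simp only [h, if_false, add_zero]; split_ifs <;> simp [hv]
  simpa using this

/-! ### Powers of words and the lengths they realise -/

theorem wpow_succ {α : Type*} (u : List α) (n : ℕ) : wpow u (n + 1) = u ++ wpow u n := by
  simp [wpow, List.replicate_succ]

theorem wpow_add {α : Type*} (u : List α) (m n : ℕ) : wpow u (m + n) = wpow u m ++ wpow u n := by
  rw [wpow, List.replicate_add, List.flatten_append, wpow, wpow]

theorem length_wpow {α : Type*} (u : List α) (n : ℕ) : (wpow u n).length = n * u.length := by
  simp [wpow]

theorem exists_add_mul_eq_mul {a d : ℕ} (h : a.Coprime d) (hd : 0 < d) (m : ℕ) :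
    ∃ i j, i < d ∧ m + i * a = j * d := by
  obtain rfl | hd1 := Nat.eq_or_lt_of_le (Nat.succ_le_of_lt hd)
  · exact ⟨0, m, by simp, by simp⟩
  obtain ⟨x, hx⟩ := Nat.exists_mul_mod_eq_one_of_coprime h hd1
  have hx : a * x ≡ 1 [MOD d] := by rw [Nat.ModEq, hx.2, Nat.mod_eq_of_lt hd1]
  refine ⟨(x * (d - 1) * m) % d, (m + (x * (d - 1) * m) % d * a) / d, Nat.mod_lt _ hd, ?_⟩
  rw [Nat.div_mul_cancel]
  apply (Nat.modEq_zero_iff_dvd).1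
  have h1 : (x * (d - 1) * m) % d * a ≡ (x * (d - 1) * m) * a [MOD d] :=
    (Nat.mod_modEq _ _).mul_right _
  have h2 : (x * (d - 1) * m) * a ≡ 1 * ((d - 1) * m) [MOD d] := by
    convert hx.mul_right ((d - 1) * m) using 1
    ring
  have h3 : m + (x * (d - 1) * m) % d * a ≡ m + 1 * ((d - 1) * m) [MOD d] :=
    (h1.trans h2).add_left m
  refine h3.trans ((Nat.modEq_zero_iff_dvd).2 ⟨m, ?_⟩)
  obtain ⟨d, rfl⟩ := Nat.exists_eq_succ_of_ne_zero hd.ne'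
  simp only [Nat.succ_eq_add_one, Nat.add_sub_cancel]
  ring

/-- A word containing long powers of two words of coprime lengths contains words of any prescribed
length in a window, with prescribed ends. -/
theorem exists_infix_length_eq {α : Type*} {A D u v P Q P' Q' F X Y Z : List α} {K S n : ℕ}
    (hA : A = P ++ u ++ Q) (hD : D = P' ++ v ++ Q') (hD0 : D ≠ [])
    (hco : A.length.Coprime D.length)
    (hX : X = Y ++ wpow A K ++ Z) (hK : D.length ≤ K)
    (h1 : X.length + F.length + D.length ≤ n)
    (h2 : n + Y.length + A.length + A.length * D.length < X.length + S) :
    ∃ R w R', w.length = n ∧ u <+: w ∧ v <:+ w ∧ X ++ F ++ wpow D S = R ++ w ++ R' := by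
  have hd : 0 < D.length := List.length_pos_iff.2 hD0
  have hDl : D.length = P'.length + v.length + Q'.length := by simp [hD, add_assoc]
  have hAl : A.length = P.length + u.length + Q.length := by simp [hA, add_assoc]
  obtain ⟨i, j, hi, hij⟩ := exists_add_mul_eq_mul hco hd
    (n + Y.length + P.length - (X.length + F.length + P'.length + v.length))
  have hXl : X.length = Y.length + K * A.length + Z.length := by
    rw [hX]; simp [length_wpow, add_assoc]
  obtain ⟨e, rfl⟩ : ∃ e, K = i + (1 + e) := ⟨K - i - 1, by omega⟩
  have hjS : j < S := by
    have : j * 1 ≤ j * D.length := Nat.mul_le_mul_left _ hd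
    have : i * A.length ≤ A.length * D.length := by
      rw [mul_comm]; exact Nat.mul_le_mul_left _ hi.le
    omega
  obtain ⟨f, rfl⟩ : ∃ f, S = j + (1 + f) := ⟨S - j - 1, by omega⟩
  have hone : ∀ B : List α, wpow B 1 = B := fun B => by simp [wpow]
  refine ⟨Y ++ wpow A i ++ P, u ++ (Q ++ wpow A e ++ Z ++ F ++ wpow D j ++ P') ++ v,
    Q' ++ wpow D f, ?_, ⟨_, by rw [List.append_assoc]⟩, ⟨_, rfl⟩, ?_⟩
  · have e1 : (i + (1 + e)) * A.length = i * A.length + A.length + e * A.length := by ring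
    simp only [List.length_append, length_wpow]
    omega
  · rw [hX]
    simp only [wpow_add, hone]
    nth_rewrite 2 [hA]
    nth_rewrite 2 [hD]
    simp only [List.append_assoc]

/-! ### Dynamics near the end of a path -/

/-- The induced exchange is in state `4` (top `0 2 3 1`, bottom `3 2 1 0`), and letters `1` and
`3` minus `0` are short compared to letters `0` and `2`. -/
structure NearRotation (T : ℝ → ℝ) (I : Fin 4 → Set ℝ) (v : Fin 4 → ℝ)
    (W : Fin 4 → List (Fin 4)) (M : ℕ) : Prop where
  pos : ∀ c, 0 < v c
  lt : v 0 < v 3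
  small₀ : M * (v 3 - v 0 + v 1) < v 0
  small₂ : M * (v 3 - v 0 + v 1) < v 2
  read₀ : ∀ x, 0 ≤ x → x < v 0 → Reads T I x (W 0) (x + v 1 + v 2 + v 3)
  read₂ : ∀ x, v 0 ≤ x → x < v 0 + v 2 → Reads T I x (W 2) (x + (v 3 - v 0))
  read₃ : ∀ x, v 0 + v 2 ≤ x → x < v 0 + v 2 + v 3 → Reads T I x (W 3) (x - v 0 - v 2)
  read₁ : ∀ x, v 0 + v 2 + v 3 ≤ x → x < v 0 + v 2 + v 3 + v 1 → Reads T I x (W 1) (x - v 0)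

section NearRotation

variable {T : ℝ → ℝ} {I : Fin 4 → Set ℝ} {v : Fin 4 → ℝ} {W : Fin 4 → List (Fin 4)} {M : ℕ}

theorem Induces.nearRotation (h : Induces T I 4 v W) (pos : ∀ c, 0 < v c) (lt : v 0 < v 3)
    (small₀ : M * (v 3 - v 0 + v 1) < v 0) (small₂ : M * (v 3 - v 0 + v 1) < v 2) :
    NearRotation T I v W M := by
  have e0 := h 0
  have e1 := h 1
  have e2 := h 2
  have e3 := h 3
  simp [offset, topPos, botPos, Fin.sum_univ_four] at e0 e1 e2 e3
  refine ⟨pos, lt, small₀, small₂, fun x h1 h2 => ?_, fun x h1 h2 => ?_, fun x h1 h2 => ?_,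
    fun x h1 h2 => ?_⟩
  · convert e0 x (by linarith) (by linarith) using 1; ring
  · convert e2 x (by linarith) (by linarith) using 1; ring
  · convert e3 x (by linarith) (by linarith) using 1; ring
  · convert e1 x (by linarith) (by linarith) using 1; ring

namespace NearRotation

theorem gap_pos (h : NearRotation T I v W M) : 0 < v 3 - v 0 + v 1 := by
  linarith [h.lt, h.pos 1]

theorem mul_gap_lt (h : NearRotation T I v W M) {m : ℕ} (hm : m ≤ M) :
    m * (v 3 - v 0 + v 1) < v 0 ∧ m * (v 3 - v 0 + v 1) < v 2 := by
  have : (m : ℝ) * (v 3 - v 0 + v 1) ≤ M * (v 3 - v 0 + v 1) :=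
    mul_le_mul_of_nonneg_right (by exact_mod_cast hm) h.gap_pos.le
  exact ⟨this.trans_lt h.small₀, this.trans_lt h.small₂⟩

theorem reads_rise (h : NearRotation T I v W M) (hM : 1 ≤ M) {x : ℝ} (h0 : 0 ≤ x)
    (h1 : x < v 0 - v 1) : Reads T I x (W 0 ++ W 3) (x + (v 3 - v 0 + v 1)) := by
  have := h.pos 1
  have hg := h.gap_pos
  have := h.lt
  have := h.mul_gap_lt hM
  norm_num at this
  refine (h.read₀ x h0 (by linarith)).append ?_
  convert h.read₃ (x + v 1 + v 2 + v 3) (by linarith) (by linarith) using 1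
  ring

theorem reads_wrap (h : NearRotation T I v W M) (hM : 1 ≤ M) {x : ℝ} (h0 : v 0 - v 1 ≤ x)
    (h1 : x < v 0) :
    Reads T I x (W 0 ++ W 1 ++ W 3) (x + (v 3 - v 0 + v 1) - v 0) := by
  have := h.pos 1
  have hg := h.gap_pos
  have := h.lt
  have := h.mul_gap_lt hM
  norm_num at this
  refine ((h.read₀ x (by linarith) h1).append
    (h.read₁ (x + v 1 + v 2 + v 3) (by linarith) (by linarith))).append ?_
  convert h.read₃ (x + v 1 + v 2 + v 3 - v 0) (by linarith) (by linarith) using 1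
  ring

theorem reads_wpow_rise (h : NearRotation T I v W M) (hM : 1 ≤ M) (m : ℕ) {x : ℝ} (h0 : 0 ≤ x)
    (h1 : x + m * (v 3 - v 0 + v 1) < v 0) :
    Reads T I x (wpow (W 0 ++ W 3) m) (x + m * (v 3 - v 0 + v 1)) := by
  induction m generalizing x with
  | zero => simp [wpow, Reads]
  | succ m ih =>
    have hg := h.gap_pos
    have hm : 0 ≤ (m : ℝ) * (v 3 - v 0 + v 1) := by positivity
    have := h.lt
    push_cast at h1 ⊢
    rw [wpow_succ]
    refine (h.reads_rise hM h0 (by linarith)).append ?_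
    convert ih (x := x + (v 3 - v 0 + v 1)) (by linarith) (by linarith) using 1
    ring

theorem reads_wpow_glide (h : NearRotation T I v W M) (m : ℕ) {x : ℝ} (h0 : v 0 ≤ x)
    (h1 : x + m * (v 3 - v 0) < v 0 + v 2) :
    Reads T I x (wpow (W 2) m) (x + m * (v 3 - v 0)) := by
  induction m generalizing x with
  | zero => simp [wpow, Reads]
  | succ m ih =>
    have hg : 0 < v 3 - v 0 := by linarith [h.lt]
    have hm : 0 ≤ (m : ℝ) * (v 3 - v 0) := by positivity
    push_cast at h1 ⊢
    rw [wpow_succ]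
    refine (h.read₂ x h0 (by linarith)).append ?_
    convert ih (x := x + (v 3 - v 0)) (by linarith) (by linarith) using 1
    ring

theorem exists_nat_crossing {x g b : ℝ} {K : ℕ} (h0 : x < b) (h1 : b ≤ x + K * g) :
    ∃ m < K, x + m * g < b ∧ b ≤ x + m * g + g := by
  induction K with
  | zero => simp at h1; linarith
  | succ K ih =>
    by_cases hK : b ≤ x + K * g
    · obtain ⟨m, hm, hm'⟩ := ih hK
      exact ⟨m, by omega, hm'⟩
    · push_cast at h1
      exact ⟨K, by omega, by linarith, by linarith⟩

/-- Near the beginning of the first interval, or anywhere after a bounded word, a long power of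
one of the two words is read. -/
theorem exists_run_of_lt (h : NearRotation T I v W M) {K : ℕ} (hK : K + 1 ≤ M) {x : ℝ}
    (h0 : 0 ≤ x) (h1 : x < v 3 - v 0 + v 1) :
    ∃ z, Reads T I x (wpow (W 0 ++ W 3) K) z := by
  have := h.mul_gap_lt hK
  push_cast at this
  exact ⟨_, h.reads_wpow_rise (by omega) K h0 (by linarith)⟩

theorem exists_run_first (h : NearRotation T I v W M) {K : ℕ} (hK : K + 1 ≤ M) {x : ℝ}
    (h0 : 0 ≤ x) (h1 : x < v 0) :
    ∃ Y z, Y.length ≤ (K + 1) * ∑ c, (W c).length ∧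
      (Reads T I x (Y ++ wpow (W 2) K) z ∨ Reads T I x (Y ++ wpow (W 0 ++ W 3) K) z) := by
  by_cases hx : x + K * (v 3 - v 0 + v 1) < v 0
  · exact ⟨[], _, by simp, Or.inr (h.reads_wpow_rise (by omega) K h0 hx)⟩
  obtain ⟨m, hm, hm1, hm2⟩ := exists_nat_crossing h1 (not_lt.1 hx)
  have hg := h.gap_pos
  have hp : 0 ≤ (m : ℝ) * (v 3 - v 0 + v 1) := by positivity
  have r1 := h.reads_wpow_rise (by omega) m h0 hm1
  have hlen : ∀ B : List (Fin 4), B.length ≤ ∑ c, (W c).length →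
      (wpow (W 0 ++ W 3) m ++ B).length ≤ (K + 1) * ∑ c, (W c).length := by
    intro B hB
    have h03 : (W 0 ++ W 3).length ≤ ∑ c, (W c).length := by
      rw [Fin.sum_univ_four, List.length_append]; omega
    rw [List.length_append, length_wpow]
    have := Nat.mul_le_mul hm.le h03
    linarith
  have h1M := h.mul_gap_lt (m := 1) (by omega)
  have hKM := h.mul_gap_lt (m := K + 1) hK
  push_cast at h1M hKM
  by_cases hy : x + m * (v 3 - v 0 + v 1) < v 0 - v 1
  · refine ⟨wpow (W 0 ++ W 3) m ++ (W 0 ++ W 3), _, hlen _ ?_, Or.inl ((r1.append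
      (h.reads_rise (by omega) (by linarith) hy)).append (h.reads_wpow_glide K hm2 ?_))⟩
    · rw [Fin.sum_univ_four, List.length_append]; omega
    · have : (K : ℝ) * (v 3 - v 0) ≤ K * (v 3 - v 0 + v 1) :=
        mul_le_mul_of_nonneg_left (by linarith [h.pos 1]) (by positivity)
      linarith
  · obtain ⟨z, hz⟩ := h.exists_run_of_lt hK
      (x := x + m * (v 3 - v 0 + v 1) + (v 3 - v 0 + v 1) - v 0) (by linarith) (by linarith)
    refine ⟨wpow (W 0 ++ W 3) m ++ (W 0 ++ W 1 ++ W 3), z, hlen _ ?_, Or.inr ((r1.append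
      (h.reads_wrap (by omega) (by linarith) hm1)).append hz)⟩
    rw [Fin.sum_univ_four]; simp only [List.length_append]; omega

theorem exists_run_second (h : NearRotation T I v W M) {K : ℕ} (hK : K + 1 ≤ M) {x : ℝ}
    (h0 : v 0 ≤ x) (h1 : x < v 0 + v 2) :
    ∃ Y z, Y.length ≤ (K + 1) * ∑ c, (W c).length ∧
      (Reads T I x (Y ++ wpow (W 2) K) z ∨ Reads T I x (Y ++ wpow (W 0 ++ W 3) K) z) := by
  by_cases hx : x + K * (v 3 - v 0) < v 0 + v 2
  · exact ⟨[], _, by simp, Or.inl (h.reads_wpow_glide K h0 hx)⟩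
  obtain ⟨m, hm, hm1, hm2⟩ := exists_nat_crossing h1 (not_lt.1 hx)
  have hg : 0 < v 3 - v 0 := by linarith [h.lt]
  have hp : 0 ≤ (m : ℝ) * (v 3 - v 0) := by positivity
  have r1 := h.reads_wpow_glide m h0 hm1
  have hp0 := h.pos 0
  have hp1 := h.pos 1
  obtain ⟨z, hz⟩ := h.exists_run_of_lt hK
      (x := x + m * (v 3 - v 0) + (v 3 - v 0) - v 0 - v 2) (by linarith) (by linarith)
  refine ⟨wpow (W 2) m ++ W 2 ++ W 3, z, ?_, Or.inr (((r1.append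
      (h.read₂ _ (by linarith) hm1)).append (h.read₃ _ (by linarith) (by linarith))).append hz)⟩
  have h2 : (W 2).length ≤ ∑ c, (W c).length := by rw [Fin.sum_univ_four]; omega
  have h3 : (W 2).length + (W 3).length ≤ ∑ c, (W c).length := by rw [Fin.sum_univ_four]; omega
  have := Nat.mul_le_mul hm.le h2
  simp only [List.length_append, length_wpow]
  linarith

theorem exists_run (h : NearRotation T I v W M) {K : ℕ} (hK : K + 1 ≤ M) {x : ℝ}
    (h0 : 0 ≤ x) (h1 : x < ∑ c, v c) :
    ∃ Y z, Y.length ≤ (K + 3) * ∑ c, (W c).length ∧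
      (Reads T I x (Y ++ wpow (W 2) K) z ∨ Reads T I x (Y ++ wpow (W 0 ++ W 3) K) z) := by
  have hg := h.gap_pos
  have hlt := h.lt
  have hp0 := h.pos 0
  have hp1 := h.pos 1
  have h1M := h.mul_gap_lt (m := 1) (by omega)
  push_cast at h1M
  have main : ∀ X y, X.length ≤ 2 * ∑ c, (W c).length → Reads T I x X y → 0 ≤ y →
      y < v 0 + v 2 → ∃ Y z, Y.length ≤ (K + 3) * ∑ c, (W c).length ∧
      (Reads T I x (Y ++ wpow (W 2) K) z ∨ Reads T I x (Y ++ wpow (W 0 ++ W 3) K) z) := by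
    intro X y hX hr hy0 hy1
    obtain ⟨Y, z, hY, hz⟩ : ∃ Y z, Y.length ≤ (K + 1) * ∑ c, (W c).length ∧
        (Reads T I y (Y ++ wpow (W 2) K) z ∨ Reads T I y (Y ++ wpow (W 0 ++ W 3) K) z) := by
      by_cases hy : y < v 0
      · exact h.exists_run_first hK hy0 hy
      · exact h.exists_run_second hK (not_lt.1 hy) hy1
    refine ⟨X ++ Y, z, ?_, ?_⟩
    · rw [List.length_append]; linarith
    · rw [List.append_assoc, List.append_assoc]
      exact hz.imp hr.append hr.append
  have hl : ∀ c, (W c).length ≤ ∑ c, (W c).length := fun c =>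
    Finset.single_le_sum (f := fun c => (W c).length) (fun _ _ => Nat.zero_le _)
      (Finset.mem_univ c)
  rw [Fin.sum_univ_four] at h1
  by_cases ha : x < v 0 + v 2
  · exact main [] x (by simp) rfl h0 ha
  by_cases hb : x < v 0 + v 2 + v 3
  · exact main _ _ (by linarith [hl 3]) (h.read₃ x (by linarith) hb) (by linarith) (by linarith)
  · refine main _ _ ?_ ((h.read₁ x (by linarith) (by linarith)).append
      (h.read₃ (x - v 0) (by linarith) (by linarith))) (by linarith) (by linarith)
    rw [List.length_append]
    linarith [hl 3, hl 1]

/-- Just to the right of the common endpoint of the first two intervals. -/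
theorem exists_reads_right (h : NearRotation T I v W M) {S : ℕ} (hS : S + 1 ≤ M) {x : ℝ}
    (h0 : v 0 ≤ x) (h1 : x < v 0 + (v 3 - v 0 + v 1)) :
    ∃ z, Reads T I x (wpow (W 2) S) z := by
  refine ⟨_, h.reads_wpow_glide S h0 ?_⟩
  have h1M := h.mul_gap_lt hS
  push_cast at h1M
  have : (S : ℝ) * (v 3 - v 0) ≤ S * (v 3 - v 0 + v 1) :=
    mul_le_mul_of_nonneg_left (by linarith [h.pos 1]) (by positivity)
  linarith

/-- Just to the left of the common endpoint of the first two intervals. -/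
theorem exists_reads_left (h : NearRotation T I v W M) {S : ℕ} (hS : S + 1 ≤ M) {x : ℝ}
    (h0 : v 0 - v 1 ≤ x) (h1 : x < v 0) :
    ∃ z, Reads T I x (W 0 ++ W 1 ++ W 3 ++ wpow (W 0 ++ W 3) S) z := by
  have := h.lt
  obtain ⟨z, hz⟩ := h.exists_run_of_lt hS (x := x + (v 3 - v 0 + v 1) - v 0)
    (by linarith) (by linarith)
  exact ⟨z, (h.reads_wrap (by omega) h0 h1).append hz⟩

end NearRotation

end NearRotation

theorem Reads.of_induces {T : ℝ → ℝ} {I : Fin 4 → Set ℝ} {s : Fin 7} {v : Fin 4 → ℝ}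
    {W : Fin 4 → List (Fin 4)} (h : Induces T I s v W) {c : Fin 4} {y : ℝ}
    (h0 : offset (botPos s) v c ≤ y) (h1 : y < offset (botPos s) v c + v c) :
    Reads T I (y - offset (botPos s) v c + offset (topPos s) v c) (W c) y := by
  convert h c (y - offset (botPos s) v c + offset (topPos s) v c) (by linarith)
    (by linarith) using 1
  ring

/-- The backward orbit of the singularity between the first two intervals avoids singularities. -/
theorem no_connection {T : ℝ → ℝ} {I : Fin 4 → Set ℝ} {v : Fin 4 → ℝ}
    {W : Fin 4 → List (Fin 4)} {D : Fin 4 → ℝ} (h : Induces T I 4 v W) (hv : ∀ c, 0 < v c)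
    (hs : Singular T D 4 v) (hW : ∀ c, W c ≠ [])
    (hD : ∀ i j, i ≠ 0 → j ≠ 0 → ∀ m n, T^[m] (D i) = T^[n] (D j) → i = j ∧ m = n)
    {c : Fin 4} {m : ℕ} (hc : c ≠ 3)
    (hm : T^[m] (offset (botPos 4) v c) = v 0) : False := by
  have hp0 := hv 0
  have h2 : offset (topPos 4) v 2 = v 0 := by
    simp [offset, topPos, Fin.sum_univ_four]
  obtain ⟨i₂, hi₂⟩ := hs 2 (by decide)
  rw [h2] at hi₂
  have key : ∀ c, c ≠ 0 → ∀ J, 0 < J → T^[J] (offset (topPos 4) v c) = v 0 → False := by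
    intro c hc J hJ hcJ
    have : ∀ i, T^[i] (offset (topPos 4) v c) = D c → c = 2 ∧ J + i₂ = i := fun i hi => by
      refine (and_congr_left' eq_comm).1 ?_
      have h3 := hD c 2 hc (by decide) (i₂ + J) i ?_
      · exact ⟨h3.1.symm, by omega⟩
      · rw [← hi, ← Function.iterate_add_apply, ← hi₂, ← hcJ, ← Function.iterate_add_apply,
          ← Function.iterate_add_apply]
        congr 1
        omega
    obtain ⟨i, hi⟩ := hs c hc
    obtain ⟨rfl, -⟩ := this i hi
    rw [h2] at this
    have := (this i₂ hi₂).2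
    omega
  have first : ∀ c, T^[(W c).length] (offset (topPos 4) v c) = offset (botPos 4) v c := fun c => by
    have := (h c _ le_rfl (by linarith [hv c])).iterate
    simpa using this
  have hlen : ∀ c, 0 < (W c).length := fun c => List.length_pos_iff.2 (hW c)
  by_cases hc0 : c = 0
  · subst hc0
    refine key 3 (by decide) (m + (W 0).length + (W 3).length) (by have := hlen 3; omega) ?_
    have e : offset (botPos 4) v 3 = offset (topPos 4) v 0 := by
      simp [offset, topPos, botPos]
    rw [Function.iterate_add_apply, first 3, e, Function.iterate_add_apply, first 0, hm]
  · refine key c hc0 (m + (W c).length) (by have := hlen c; omega) ?_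
    rw [Function.iterate_add_apply, first c, hm]

/-- Arbitrarily long words are read by whole neighbourhoods of points whose orbit reaches the
singularity between the first two intervals. -/
theorem exists_backward {T : ℝ → ℝ} {I : Fin 4 → Set ℝ} {v : Fin 4 → ℝ}
    {W : Fin 4 → List (Fin 4)} {D : Fin 4 → ℝ} (h : Induces T I 4 v W) (hv : ∀ c, 0 < v c)
    (hs : Singular T D 4 v) (hW : ∀ c, W c ≠ [])
    (hD : ∀ i j, i ≠ 0 → j ≠ 0 → ∀ m n, T^[m] (D i) = T^[n] (D j) → i = j ∧ m = n) (N : ℕ) :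
    ∃ X y e, 0 < e ∧ N ≤ X.length ∧ X.length ≤ N + ∑ c, (W c).length ∧ 0 ≤ y - e ∧
      y + e ≤ ∑ c, v c ∧ ∀ z, y - e < z → z < y + e → Reads T I z X (z + (v 0 - y)) := by
  have hl : ∀ c, (W c).length ≤ ∑ c, (W c).length := fun c =>
    Finset.single_le_sum (f := fun c => (W c).length) (fun _ _ => Nat.zero_le _)
      (Finset.mem_univ c)
  have hv' : ∀ c, 0 ≤ v c := fun c => (hv c).le
  induction N with
  | zero =>
    have h0 := hv 0
    have h1 := hv 1
    have h2 := hv 2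
    have h3 := hv 3
    refine ⟨[], v 0, min (v 0) (v 1), lt_min h0 h1, by simp, by simp, ?_, ?_, fun z _ _ => ?_⟩
    · linarith [min_le_left (v 0) (v 1)]
    · rw [Fin.sum_univ_four]; linarith [min_le_right (v 0) (v 1)]
    · simp [Reads]
  | succ N ih =>
    obtain ⟨X, y, e, he, hX1, hX2, hy0, hy1, hr⟩ := ih
    by_cases hXN : N + 1 ≤ X.length
    · exact ⟨X, y, e, he, hXN, by omega, hy0, hy1, hr⟩
    obtain ⟨c, hc0, hc1⟩ := exists_offset_mem (botPos_bijective 4) v (x := y) (by linarith)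
      (by linarith)
    have hy : T^[X.length] y = v 0 := by
      have := (hr y (by linarith) (by linarith)).iterate
      simpa using this
    have hne : offset (botPos 4) v c < y := by
      refine lt_of_le_of_ne hc0 fun hcy => ?_
      by_cases hc3 : c = 3
      · subst hc3
        have : offset (botPos 4) v 3 = 0 := by simp [offset, botPos]
        linarith
      · exact no_connection h hv hs hW hD hc3 (by rw [hcy, hy])
    have ht0 := offset_nonneg (topPos 4) hv' c
    have ht1 := offset_add_le (topPos 4) hv' c
    set e' := min e (min (y - offset (botPos 4) v c) (offset (botPos 4) v c + v c - y)) with he'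
    have l1 : e' ≤ e := min_le_left _ _
    have l2 : e' ≤ y - offset (botPos 4) v c := (min_le_right _ _).trans (min_le_left _ _)
    have l3 : e' ≤ offset (botPos 4) v c + v c - y := (min_le_right _ _).trans (min_le_right _ _)
    refine ⟨W c ++ X, y - offset (botPos 4) v c + offset (topPos 4) v c, e',
      lt_min he (lt_min (by linarith) (by linarith)), ?_, ?_, by linarith, by linarith,
      fun z hz0 hz1 => ?_⟩
    · have := List.length_pos_iff.2 (hW c)
      rw [List.length_append]; omega
    · have := hl c
      rw [List.length_append]; omega
    · have r := Reads.of_induces h (c := c)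
        (y := z - offset (topPos 4) v c + offset (botPos 4) v c) (by linarith) (by linarith)
      have r' := hr (z - offset (topPos 4) v c + offset (botPos 4) v c) (by linarith)
        (by linarith)
      convert r.append r' using 1 <;> ring

/-- Mixing for words that occur in the return words of letters `2` and `0 3`. -/
theorem NearRotation.exists_mixing {T : ℝ → ℝ} {I : Fin 4 → Set ℝ} {v : Fin 4 → ℝ}
    {W : Fin 4 → List (Fin 4)} {D : Fin 4 → ℝ} {M : ℕ} (hn : NearRotation T I v W M)
    (hI : ∀ a b x, x ∈ I a → x ∈ I b → a = b) (h : Induces T I 4 v W)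
    (hs : Singular T D 4 v) (hW : ∀ c, W c ≠ [])
    (hD : ∀ i j, i ≠ 0 → j ≠ 0 → ∀ m n, T^[m] (D i) = T^[n] (D j) → i = j ∧ m = n)
    (hco : (W 2).length.Coprime (W 0 ++ W 3).length)
    (hM : 2 * (∑ c, (W c).length) * (∑ c, (W c).length) + 7 * (∑ c, (W c).length) + 2 ≤ M) :
    ∃ N, ∀ a b, a <:+: W 2 → b <:+: W 2 → a <:+: W 0 ++ W 3 → b <:+: W 0 ++ W 3 →
      ∀ n, N < n → ∃ w, w.length = n ∧ a <+: w ∧ b <:+ w ∧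
        ∃ x R z, 0 ≤ x ∧ x < ∑ c, v c ∧ Reads T I x (R ++ w) z := by
  have hl2 : (W 2).length ≤ ∑ c, (W c).length := by rw [Fin.sum_univ_four]; omega
  have hl03 : (W 0 ++ W 3).length ≤ ∑ c, (W c).length := by
    rw [Fin.sum_univ_four, List.length_append]; omega
  have hl013 : (W 0 ++ W 1 ++ W 3).length ≤ ∑ c, (W c).length := by
    rw [Fin.sum_univ_four, List.length_append, List.length_append]; omega
  set H := ∑ c, (W c).length with hH
  refine ⟨2 * H * H + 6 * H, fun a b ha2 hb2 ha3 hb3 n hnN => ?_⟩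
  have hHH : (W 2).length * (W 0 ++ W 3).length ≤ H * H := Nat.mul_le_mul hl2 hl03
  have hHH' : (W 0 ++ W 3).length * (W 2).length ≤ H * H := Nat.mul_le_mul hl03 hl2
  have e1 : 2 * H * H = 2 * (H * H) := by ring
  have e2 : (H + 3) * H = H * H + 3 * H := by ring
  obtain ⟨X, y, e, he, hX1, hX2, hy0, hy1, hr⟩ := exists_backward h hn.pos hs hW hD (n - 3 * H)
  rw [← hH] at hX2
  obtain ⟨Y, z, hY, hz⟩ := hn.exists_run (K := H) (by omega) (x := y) (by linarith) (by linarith)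
  rw [← hH, e2] at hY
  have hry := hr y (by linarith) (by linarith)
  rw [add_sub_cancel] at hry
  obtain ⟨P, Q, hP⟩ := ha2
  obtain ⟨P', Q', hP'⟩ := hb2
  obtain ⟨R, S, hR⟩ := ha3
  obtain ⟨R', S', hR'⟩ := hb3
  rcases hz with hz | hz
  · obtain ⟨Z, hZ⟩ := hry.isPrefix_of_le hI hz (by
      rw [List.length_append, length_wpow]
      have := Nat.mul_le_mul_left H hl2
      omega)
    have hv1 := hn.pos 1
    have m1 : min e (v 1) ≤ e := min_le_left _ _
    have m2 : min e (v 1) ≤ v 1 := min_le_right _ _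
    have m3 : 0 < min e (v 1) := lt_min he hv1
    have hrl := hr (y - min e (v 1) / 2) (by linarith) (by linarith)
    obtain ⟨z', hz'⟩ := hn.exists_reads_left (S := 2 * (H * H) + 7 * H + 1) (by omega)
      (x := y - min e (v 1) / 2 + (v 0 - y)) (by linarith) (by linarith)
    have hall := hrl.append hz'
    rw [← List.append_assoc] at hall
    obtain ⟨B, w, B', hw1, hw2, hw3, hw4⟩ := exists_infix_length_eq (n := n)
      (S := 2 * (H * H) + 7 * H + 1) (F := W 0 ++ W 1 ++ W 3) hP.symm hR'.symm (by simp [hW])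
      hco hZ.symm hl03 (by omega) (by omega)
    rw [hw4, reads_append] at hall
    obtain ⟨z'', hzz, -⟩ := hall
    exact ⟨w, hw1, hw2, hw3, _, B, z'', by linarith, by linarith, hzz⟩
  · obtain ⟨Z, hZ⟩ := hry.isPrefix_of_le hI hz (by
      rw [List.length_append, length_wpow]
      have := Nat.mul_le_mul_left H hl03
      omega)
    obtain ⟨z', hz'⟩ := hn.exists_reads_right (S := 2 * (H * H) + 7 * H + 1) (by omega)
      (x := v 0) le_rfl (by linarith [hn.gap_pos])
    have hall := hry.append hz'
    obtain ⟨B, w, B', hw1, hw2, hw3, hw4⟩ := exists_infix_length_eq (n := n)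
      (S := 2 * (H * H) + 7 * H + 1) (F := []) hR.symm hP'.symm (hW 2)
      hco.symm hZ.symm hl2 (by simp only [List.length_nil]; omega) (by omega)
    rw [List.append_nil] at hw4
    rw [hw4, reads_append] at hall
    obtain ⟨z'', hzz, -⟩ := hall
    exact ⟨w, hw1, hw2, hw3, _, B, z'', by linarith, by linarith, hzz⟩

/-! ### Small cones are dense -/

/-- Every open cone containing `v` contains the cone of some path from `s` to the central state. -/
def Good (s : Fin 7) (v : Fin 4 → ℝ) : Prop :=
  ∀ O : Set (Fin 4 → ℝ), IsOpen O → (∀ t : ℝ, 0 < t → ∀ x ∈ O, t • x ∈ O) → v ∈ O →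
    ∃ p, endState s p = 0 ∧ ∀ c, pathLen s p (Pi.single c 1) ∈ O

theorem Good.step {s : Fin 7} {b : Bool} {v : Fin 4 → ℝ} (h : Good (nextState s b) v) :
    Good s (stepLen s b v) := by
  intro O hO hc hv
  obtain ⟨p, hp, hp'⟩ := h (stepLen s b ⁻¹' O) (hO.preimage (continuous_stepLen s b))
    (fun t ht x hx => by
      rw [Set.mem_preimage, stepLen_smul]
      exact hc t ht _ hx) hv
  exact ⟨b :: p, hp, hp'⟩

theorem Good.path {s : Fin 7} {p : List Bool} {v : Fin 4 → ℝ} (h : Good (endState s p) v) :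
    Good s (pathLen s p v) := by
  induction p generalizing s with
  | nil => exact h
  | cons b p ih => exact (ih h).step

theorem Good.smul {s : Fin 7} {v : Fin 4 → ℝ} (h : Good s v) {t : ℝ} (ht : 0 < t) :
    Good s (t • v) := by
  intro O hO hc hv
  refine h O hO hc ?_
  have := hc t⁻¹ (inv_pos.2 ht) _ hv
  rwa [smul_smul, inv_mul_cancel₀ ht.ne', one_smul] at this

theorem eventually_nsmul_add_mem {O : Set (Fin 4 → ℝ)} (hO : IsOpen O)
    (hc : ∀ t : ℝ, 0 < t → ∀ x ∈ O, t • x ∈ O) {v : Fin 4 → ℝ} (hv : v ∈ O) (u : Fin 4 → ℝ) :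
    ∀ᶠ K : ℕ in Filter.atTop, (K : ℝ) • v + u ∈ O := by
  have h1 : Filter.Tendsto (fun K : ℕ => v + ((K : ℝ)⁻¹) • u) Filter.atTop (nhds v) := by
    have := (tendsto_const_nhds (x := v)).add
      ((tendsto_inv_atTop_nhds_zero_nat (𝕜 := ℝ)).smul_const u)
    simpa using this
  filter_upwards [h1.eventually (hO.mem_nhds hv), Filter.eventually_gt_atTop 0] with K hK hK0
  have hK' : (0 : ℝ) < K := by exact_mod_cast hK0
  have := hc K hK' _ hK
  rwa [smul_add, smul_smul, mul_inv_cancel₀ hK'.ne', one_smul] at this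

theorem good_of_nsmul_add {s : Fin 7} {v u : Fin 4 → ℝ}
    (h : ∀ K : ℕ, 0 < K → Good s ((K : ℝ) • v + u)) : Good s v := by
  intro O hO hc hv
  obtain ⟨K, hK, hK0⟩ := ((eventually_nsmul_add_mem hO hc hv u).and
    (Filter.eventually_gt_atTop 0)).exists
  exact h K hK0 O hO hc hK

theorem endState_wpow_of_loop {s : Fin 7} {p : List Bool} (hp : endState s p = s) (K : ℕ) :
    endState s (wpow p K) = s := by
  induction K with
  | zero => rfl
  | succ K ih => rw [wpow_succ, endState_append, hp, ih]

theorem pathLen_wpow_of_loop {s : Fin 7} {p : List Bool} (hp : endState s p = s)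
    {f : (Fin 4 → ℝ) → ℝ} {u : Fin 4 → ℝ} (hl : ∀ v, pathLen s p v = v + f v • u)
    (hf : ∀ v (t : ℝ), f (v + t • u) = f v) (K : ℕ) (v : Fin 4 → ℝ) :
    pathLen s (wpow p K) v = v + ((K : ℝ) * f v) • u := by
  induction K with
  | zero => simp [wpow, pathLen]
  | succ K ih =>
    rw [wpow_succ, pathLen_append, hp, ih, hl, hf, add_assoc, ← add_smul]
    push_cast
    ring_nf

/-- Repeating a self-loop adds multiples of the loser's length to the winner's. -/
theorem pathLen_wpow_selfLoop {s : Fin 7} {b : Bool} (hs : nextState s b = s) (K : ℕ)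
    (v : Fin 4 → ℝ) :
    pathLen s (wpow [b] K) v = v + ((K : ℝ) * v (loser s b)) • Pi.single (winner s b) 1 := by
  refine pathLen_wpow_of_loop (f := fun v => v (loser s b)) (by simpa [endState] using hs)
    (fun v => ?_) (fun v t => ?_) K v
  · ext c
    simp only [pathLen, stepLen, Pi.add_apply, Pi.smul_apply, smul_eq_mul, Pi.single_apply]
    split_ifs <;> ring
  · simp [(winner_ne_loser s b).symm]

theorem pathLen_wpow_top (K : ℕ) (v : Fin 4 → ℝ) :
    pathLen 0 (wpow [true, true, true] K) v
      = v + ((K : ℝ) * (v 0 + v 1 + v 2)) • Pi.single 3 1 := by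
  refine pathLen_wpow_of_loop (f := fun v => v 0 + v 1 + v 2) rfl (fun v => ?_) (fun v t => ?_) K v
  · ext c
    fin_cases c <;>
      simp [pathLen, stepLen, nextState, winner, loser, topLast, botLast]
    ring
  · simp

theorem pathLen_wpow_bot (K : ℕ) (v : Fin 4 → ℝ) :
    pathLen 0 (wpow [false, false, false] K) v
      = v + ((K : ℝ) * (v 1 + v 2 + v 3)) • Pi.single 0 1 := by
  refine pathLen_wpow_of_loop (f := fun v => v 1 + v 2 + v 3) rfl (fun v => ?_) (fun v t => ?_) K v
  · ext c
    fin_cases c <;>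
      simp [pathLen, stepLen, nextState, winner, loser, topLast, botLast]
    ring
  · simp

theorem good_single {g : Fin 4} {p : List Bool} (hp : endState 0 p = 0)
    {f : (Fin 4 → ℝ) → ℝ}
    (hl : ∀ (K : ℕ) v, pathLen 0 (wpow p K) v = v + ((K : ℝ) * f v) • Pi.single g 1)
    (hf0 : f (Pi.single g 1) = 0) (hf1 : ∀ c, c ≠ g → f (Pi.single c 1) = 1) :
    Good 0 (Pi.single g 1) := by
  intro O hO hc hv
  have : ∀ᶠ K : ℕ in Filter.atTop, ∀ c, pathLen 0 (wpow p K) (Pi.single c 1) ∈ O := by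
    rw [Filter.eventually_all]
    intro c
    by_cases hcg : c = g
    · refine Filter.Eventually.of_forall fun K => ?_
      simp [hl, hcg, hf0, hv]
    · filter_upwards [eventually_nsmul_add_mem hO hc hv (Pi.single c 1)] with K hK
      rwa [hl, hf1 c hcg, mul_one, add_comm]
  obtain ⟨K, hK⟩ := this.exists
  exact ⟨_, endState_wpow_of_loop hp K, hK⟩

theorem good_single_top : Good 0 (Pi.single 3 1) :=
  good_single rfl pathLen_wpow_top (by simp) fun c hc => by fin_cases c <;> simp at hc ⊢

theorem good_single_bot : Good 0 (Pi.single 0 1) :=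
  good_single rfl pathLen_wpow_bot (by simp) fun c hc => by fin_cases c <;> simp at hc ⊢

/-- Index of a set of letters. -/
def setIndex (S : Fin 4 → Bool) : ℕ :=
  (S 0).toNat + 2 * (S 1).toNat + 4 * (S 2).toNat + 8 * (S 3).toNat

/-- The number of limiting procedures used to reach integer vectors with a given support. -/
def closureDepth (s : Fin 7) (S : Fin 4 → Bool) : ℕ :=
  (![[0, 0, 2, 1, 2, 1, 2, 2, 0, 1, 1, 2, 1, 2, 2, 3],
    [0, 1, 2, 3, 2, 2, 2, 2, 1, 1, 1, 2, 1, 2, 2, 3],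
    [0, 1, 2, 1, 2, 2, 2, 3, 1, 1, 1, 2, 1, 2, 2, 3],
    [0, 1, 2, 1, 2, 1, 2, 2, 1, 1, 2, 2, 3, 2, 2, 3],
    [0, 1, 2, 1, 2, 1, 2, 2, 1, 1, 2, 2, 1, 2, 3, 3],
    [0, 1, 2, 3, 3, 3, 2, 2, 1, 1, 1, 2, 2, 3, 2, 3],
    [0, 1, 3, 2, 2, 1, 2, 2, 1, 1, 3, 3, 3, 2, 2, 3]] s).getD (setIndex S) 0

/-- The number of moves with a losing letter of length zero before the next change of lengths. -/
def idleMoves (s : Fin 7) (S : Fin 4 → Bool) : ℕ :=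
  (![[0, 0, 0, 2, 0, 1, 2, 1, 0, 0, 1, 0, 2, 0, 1, 0],
    [0, 1, 0, 0, 0, 1, 1, 1, 1, 2, 0, 0, 1, 1, 0, 0],
    [0, 0, 0, 3, 0, 0, 0, 0, 0, 1, 2, 1, 0, 0, 0, 0],
    [0, 1, 0, 1, 0, 0, 1, 0, 1, 2, 1, 1, 0, 0, 1, 0],
    [0, 0, 0, 0, 0, 2, 0, 0, 0, 1, 0, 0, 3, 1, 0, 0],
    [0, 2, 0, 0, 0, 0, 0, 0, 2, 3, 1, 1, 0, 0, 0, 0],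
    [0, 2, 0, 0, 0, 1, 0, 0, 2, 3, 0, 0, 0, 1, 0, 0]] s).getD (setIndex S) 0

set_option synthInstance.maxHeartbeats 400000 in
set_option synthInstance.maxSize 4096 in
theorem closureDepth_cases (s : Fin 7) (S : Fin 4 → Bool) (hS : ∃ c, S c = true) :
    (S (topLast s) = true ∧ S (botLast s) = true ∧
      (∀ b, closureDepth (nextState s b) S ≤ closureDepth s S) ∧
      ∃ b, closureDepth (nextState s b) (Function.update S (winner s b) false)
        ≤ closureDepth s S) ∨
    (∃ b, S (loser s b) = false ∧ (closureDepth (nextState s b) S < closureDepth s S ∨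
      closureDepth (nextState s b) S = closureDepth s S ∧
        idleMoves (nextState s b) S < idleMoves s S)) ∨
    (∃ a, closureDepth s (Function.update S a true) < closureDepth s S) ∨
    (∃ b, nextState s b = s ∧ S (winner s b) = true ∧ S (loser s b) = false ∧
      closureDepth s (Function.update (Function.update S (winner s b) false) (loser s b) true)
        < closureDepth s S) ∨
    (s = 0 ∧ ((∀ c, S c = true ↔ c = 0) ∨ (∀ c, S c = true ↔ c = 3))) := by
  revert s S
  decide +kernel

/-- Support of a vector of natural numbers. -/
def natSupport (v : Fin 4 → ℕ) : Fin 4 → Bool := fun c => decide (0 < v c)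

theorem lex_induction {α : Type*} (f g h : α → ℕ) {P : α → Prop}
    (ih : ∀ x, (∀ y, (f y < f x ∨ f y = f x ∧ (g y < g x ∨ g y = g x ∧ h y < h x)) → P y) → P x)
    (x : α) : P x := by
  have wf := InvImage.wf (fun x => toLex (f x, toLex (g x, h x)))
    (wellFounded_lt (α := ℕ ×ₗ (ℕ ×ₗ ℕ)))
  refine wf.induction x fun x hx => ih x fun y hy => hx y ?_
  simpa [InvImage, Prod.Lex.toLex_lt_toLex] using hy

theorem natCast_eq_stepLen {s : Fin 7} {b : Bool} {v : Fin 4 → ℕ}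
    (h : v (loser s b) ≤ v (winner s b)) :
    (fun c => (v c : ℝ)) = stepLen s b (fun c =>
      ((Function.update v (winner s b) (v (winner s b) - v (loser s b)) c : ℕ) : ℝ)) := by
  ext c
  have := winner_ne_loser s b
  unfold stepLen
  split_ifs with hc
  · subst hc
    simp [Function.update_of_ne this.symm, Nat.cast_sub h]
  · simp [Function.update_of_ne hc]

theorem sum_update_lt {v : Fin 4 → ℕ} {a : Fin 4} {n : ℕ} (h : n < v a) :
    ∑ c, Function.update v a n c < ∑ c, v c := by
  refine Finset.sum_lt_sum (fun c _ => ?_) ⟨a, Finset.mem_univ a, by simpa using h⟩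
  by_cases hc : c = a
  · subst hc; simpa using h.le
  · simp [hc]

/-- Every nonzero vector of natural numbers is good. -/
theorem good_natCast (s : Fin 7) (v : Fin 4 → ℕ) (hv : ∃ c, 0 < v c) :
    Good s (fun c => (v c : ℝ)) := by
  suffices H : ∀ x : Fin 7 × (Fin 4 → ℕ), (∃ c, 0 < x.2 c) → Good x.1 (fun c => (x.2 c : ℝ)) from
    H (s, v) hv
  clear hv v s
  refine lex_induction (fun x => closureDepth x.1 (natSupport x.2)) (fun x => ∑ c, x.2 c)
    (fun x => idleMoves x.1 (natSupport x.2)) fun x ih hv => ?_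
  obtain ⟨s, v⟩ := x
  simp only [Prod.forall] at ih hv ⊢
  rcases closureDepth_cases s (natSupport v) (by simpa [natSupport] using hv) with
    ⟨ht, hb, hd, b₀, hb₀⟩ | ⟨b, hb, hd⟩ | ⟨a, ha⟩ | ⟨b, hb, hw, hl, hd⟩ | ⟨rfl, hS⟩
  · simp only [natSupport, decide_eq_true_eq] at ht hb
    have hpos : ∀ b, 0 < v (loser s b) := fun b => by cases b <;> simpa [loser]
    have hnew : ∀ b, ∃ c, 0 < Function.update v (winner s b)
        (v (winner s b) - v (loser s b)) c := fun b =>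
      ⟨loser s b, by rw [Function.update_of_ne (winner_ne_loser s b).symm]; exact hpos b⟩
    by_cases heq : v (topLast s) = v (botLast s)
    · have heq' : v (loser s b₀) = v (winner s b₀) := by cases b₀ <;> simp [loser, winner, heq]
      rw [natCast_eq_stepLen heq'.le]
      refine (ih _ _ ?_ (hnew b₀)).step
      have hsup : natSupport (Function.update v (winner s b₀)
          (v (winner s b₀) - v (loser s b₀)))
          = Function.update (natSupport v) (winner s b₀) false := by
        ext c
        by_cases hc : c = winner s b₀
        · subst hc; simp [natSupport, heq']
        · simp [natSupport, hc]
      rw [hsup]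
      have := sum_update_lt (v := v) (a := winner s b₀) (n := v (winner s b₀) - v (loser s b₀))
        (by have := hpos b₀; omega)
      exact (lt_or_eq_of_le hb₀).imp_right fun h => ⟨h, Or.inl this⟩
    · obtain ⟨b, hlt⟩ : ∃ b, v (loser s b) < v (winner s b) := by
        rcases lt_or_gt_of_ne heq with h | h
        · exact ⟨false, by simpa [loser, winner]⟩
        · exact ⟨true, by simpa [loser, winner]⟩
      rw [natCast_eq_stepLen hlt.le]
      refine (ih _ _ ?_ (hnew b)).step
      have hsup : natSupport (Function.update v (winner s b)
          (v (winner s b) - v (loser s b))) = natSupport v := by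
        ext c
        by_cases hc : c = winner s b
        · subst hc
          simp only [natSupport, Function.update_self]
          exact decide_eq_decide.2 (by omega)
        · simp [natSupport, hc]
      rw [hsup]
      have := sum_update_lt (v := v) (a := winner s b) (n := v (winner s b) - v (loser s b))
        (by have := hpos b; omega)
      exact (lt_or_eq_of_le (hd b)).imp_right fun h => ⟨h, Or.inl this⟩
  · have h0 : v (loser s b) = 0 := by simpa [natSupport] using hb
    rw [natCast_eq_stepLen (s := s) (b := b) (by omega)]
    rw [h0, Nat.sub_zero, Function.update_eq_self]
    exact (ih _ _ (hd.imp_right fun h => ⟨h.1, Or.inr ⟨rfl, h.2⟩⟩) hv).step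
  · refine good_of_nsmul_add (u := Pi.single a 1) fun K hK => ?_
    convert ih s (K • v + Pi.single a 1) (Or.inl ?_) ⟨a, by simp⟩ using 1
    · ext c
      by_cases hc : c = a
      · subst hc; simp
      · simp [hc]
    · convert ha using 2
      ext c
      by_cases hc : c = a
      · subst hc; simp [natSupport]
      · simp [natSupport, hc, hK]
  · have hw' : 0 < v (winner s b) := by simpa [natSupport] using hw
    have hl' : v (loser s b) = 0 := by simpa [natSupport] using hl
    have hne := winner_ne_loser s b
    refine good_of_nsmul_add (u := (v (winner s b) : ℝ) • Pi.single (loser s b) 1) fun K hK => ?_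
    have hg := ih s (Function.update (Function.update (K • v) (winner s b) 0) (loser s b)
      (v (winner s b))) (Or.inl ?_) ⟨loser s b, by simpa using hw'⟩
    · have hloop : endState s [b] = s := hb
      convert Good.path (p := wpow [b] K)
        (by rw [endState_wpow_of_loop hloop K]; exact hg) using 1
      rw [pathLen_wpow_selfLoop hb]
      ext c
      by_cases hc : c = loser s b
      · subst hc; simp [hne.symm, hl']
      · by_cases hc' : c = winner s b
        · subst hc'; simp [hne]
        · simp [hc, hc']
    · convert hd using 2
      ext c
      by_cases hc : c = loser s b
      · subst hc; simp [natSupport, hw']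
      · by_cases hc' : c = winner s b
        · subst hc'; simp [natSupport, hne]
        · simp [natSupport, hc, hc', hK]
  · have main : ∀ g : Fin 4, Good 0 (Pi.single g 1) →
        (∀ c, natSupport v c = true ↔ c = g) → Good 0 (fun c => (v c : ℝ)) := by
      intro g hg hS
      have hpos : 0 < v g := by simpa [natSupport] using (hS g).2 rfl
      convert hg.smul (t := (v g : ℝ)) (by exact_mod_cast hpos) using 1
      ext c
      by_cases hc : c = g
      · subst hc; simp
      · have : v c = 0 := by
          by_contra h
          exact hc ((hS c).1 (by simpa [natSupport] using Nat.pos_of_ne_zero h))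
        simp [this, hc]
    exact hS.elim (main 0 good_single_bot) (main 3 good_single_top)

theorem good_of_pos (s : Fin 7) {v : Fin 4 → ℝ} (hv : ∀ c, 0 < v c) : Good s v := by
  intro O hO hc hvO
  have hlim : Filter.Tendsto (fun K : ℕ => fun c => (⌊v c * (K : ℝ)⌋₊ : ℝ) / K) Filter.atTop
      (nhds v) :=
    tendsto_pi_nhds.2 fun c =>
      (tendsto_nat_floor_mul_div_atTop (hv c).le).comp tendsto_natCast_atTop_atTop
  obtain ⟨K, hK, hK0, hK1⟩ := ((hlim.eventually (hO.mem_nhds hvO)).and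
    ((Filter.eventually_gt_atTop 0).and ((tendsto_natCast_atTop_atTop (R := ℝ)).const_mul_atTop
      (hv 0) |>.eventually_ge_atTop 1))).exists
  have heq : (fun c => (⌊v c * (K : ℝ)⌋₊ : ℝ) / K)
      = (K : ℝ)⁻¹ • fun c => (⌊v c * (K : ℝ)⌋₊ : ℝ) := by
    ext c
    simp [div_eq_inv_mul]
  rw [heq] at hK
  exact (good_natCast s (fun c => ⌊v c * (K : ℝ)⌋₊) ⟨0, Nat.floor_pos.2 hK1⟩).smul
    (t := (K : ℝ)⁻¹) (by positivity) O hO hc hK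

theorem pathLen_eq_sum (s : Fin 7) (p : List Bool) (v : Fin 4 → ℝ) :
    pathLen s p v = ∑ c, v c • pathLen s p (Pi.single c 1) := by
  simp only [Fin.sum_univ_four, ← pathLen_smul, ← pathLen_add]
  congr 1
  ext c
  fin_cases c <;> simp

/-- Every neighbourhood of a positive direction contains the directions of all length vectors that
follow some path to the central state. -/
theorem exists_path_near (s : Fin 7) {v : Fin 4 → ℝ} (hv : ∀ c, 0 < v c) (hv1 : ∑ c, v c = 1)
    {r : ℝ} (hr : 0 < r) :
    ∃ p, endState s p = 0 ∧ ∀ u : Fin 4 → ℝ, (∀ c, 0 < u c) → ∀ c,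
      |pathLen s p u c - (∑ d, pathLen s p u d) * v c| < r * ∑ d, pathLen s p u d := by
  obtain ⟨p, hp, h⟩ := good_of_pos s hv
    {x | ∀ c, |x c - (∑ d, x d) * v c| < r * ∑ d, x d} (by
      simp only [Set.ofPred_forall]
      exact isOpen_iInter_of_finite fun c => isOpen_lt (by fun_prop) (by fun_prop))
    (fun t ht x hx c => by
      simp only [Pi.smul_apply, smul_eq_mul, ← Finset.mul_sum]
      rw [show t * x c - t * (∑ d, x d) * v c = t * (x c - (∑ d, x d) * v c) by ring, abs_mul,
        abs_of_pos ht, mul_left_comm]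
      exact mul_lt_mul_of_pos_left (hx c) ht)
    (fun c => by simpa [hv1] using hr)
  refine ⟨p, hp, fun u hu c => ?_⟩
  have h1 : pathLen s p u c - (∑ d, pathLen s p u d) * v c
      = ∑ e, u e * (pathLen s p (Pi.single e 1) c
          - (∑ d, pathLen s p (Pi.single e 1) d) * v c) := by
    rw [pathLen_eq_sum s p u]
    simp only [Fin.sum_univ_four, Pi.add_apply, Pi.smul_apply, smul_eq_mul]
    ring
  have h2 : r * ∑ d, pathLen s p u d
      = ∑ e, u e * (r * ∑ d, pathLen s p (Pi.single e 1) d) := by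
    rw [pathLen_eq_sum s p u]
    simp only [Fin.sum_univ_four, Pi.add_apply, Pi.smul_apply, smul_eq_mul]
    ring
  rw [h1, h2]
  refine (Finset.abs_sum_le_sum_abs _ _).trans_lt (Finset.sum_lt_sum_of_nonempty ⟨0, by simp⟩
    fun e _ => ?_)
  rw [abs_mul, abs_of_pos (hu e)]
  exact mul_lt_mul_of_pos_left (h e c) (hu e)

/-! ### Stability of allowed blocks -/

/-- The orbit of `y`, computed with the translations prescribed by `w`, visits the interiors of the
intervals prescribed by `w`. -/
def Visits (π : Equiv.Perm (Fin 4)) (w : List (Fin 4)) (L : Fin 4 → ℝ) (y : ℝ) : Prop :=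
  0 < y ∧ y < 1 ∧ ∀ i : Fin w.length,
    leftEnd L (w.get i) < y + ((w.take i).map (shift π L)).sum ∧
      y + ((w.take i).map (shift π L)).sum < leftEnd L (w.get i) + L (w.get i)

theorem continuous_leftEnd (j : Fin 4) : Continuous fun L : Fin 4 → ℝ => leftEnd L j := by
  unfold leftEnd
  fun_prop

theorem continuous_shift (π : Equiv.Perm (Fin 4)) (j : Fin 4) :
    Continuous fun L : Fin 4 → ℝ => shift π L j := by
  simp only [shift]
  refine Continuous.sub (continuous_finsetSum _ fun k _ => ?_) (continuous_leftEnd j)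
  split_ifs <;> fun_prop

theorem isOpen_visits (π : Equiv.Perm (Fin 4)) (w : List (Fin 4)) :
    IsOpen {q : (Fin 4 → ℝ) × ℝ | Visits π w q.1 q.2} := by
  have hs : ∀ X : List (Fin 4), Continuous fun q : (Fin 4 → ℝ) × ℝ =>
      q.2 + (X.map (shift π q.1)).sum := by
    intro X
    refine continuous_snd.add ?_
    induction X with
    | nil => simpa using continuous_const
    | cons a X ih =>
      simp only [List.map_cons, List.sum_cons]
      exact ((continuous_shift π a).comp continuous_fst).add ih
  simp only [Visits, Set.ofPred_and, Set.ofPred_forall]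
  have hl : ∀ j : Fin 4, Continuous fun q : (Fin 4 → ℝ) × ℝ => leftEnd q.1 j := fun j =>
    (continuous_leftEnd j).comp continuous_fst
  refine (isOpen_lt continuous_const continuous_snd).inter
    ((isOpen_lt continuous_snd continuous_const).inter (isOpen_iInter_of_finite fun i =>
      (isOpen_lt (hl _) (hs _)).inter (isOpen_lt (hs _) ((hl _).add (by fun_prop)))))

theorem iterate_eq_of_forall_mem {T : ℝ → ℝ} {I : Fin 4 → Set ℝ} {tr : Fin 4 → ℝ}
    (hT : ∀ a x, x ∈ I a → T x = x + tr a) {w : List (Fin 4)} {y : ℝ} {i : ℕ} (hi : i ≤ w.length)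
    (h : ∀ (j : ℕ) (hj : j < w.length), j < i → T^[j] y ∈ I (w.get ⟨j, hj⟩)) :
    T^[i] y = y + ((w.take i).map tr).sum := by
  have hl : (w.take i).length = i := by simpa using hi
  have := (reads_of_mem (X := w.take i) (z := y) (T := T) (I := I) fun j hj => by
    have hj' : j < i := by omega
    simpa using h j (by omega) hj').translate hT
  rwa [hl] at this

theorem Visits.iterate_mem {π : Equiv.Perm (Fin 4)} {w : List (Fin 4)} {L : Fin 4 → ℝ} {y : ℝ}
    (h : Visits π w L y) (hL : ∀ j, 0 ≤ L j) (i : ℕ) (hi : i < w.length) :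
    (ietMap π L)^[i] y ∈ cell L (w.get ⟨i, hi⟩) := by
  induction i using Nat.strong_induction_on with
  | _ i ih =>
    rw [iterate_eq_of_forall_mem (ietMap_of_mem_cell π hL) hi.le fun j hj hji => ih j hji hj]
    exact ⟨(h.2.2 ⟨i, hi⟩).1.le, (h.2.2 ⟨i, hi⟩).2⟩

theorem IsAllowedBlock.exists_visits {π : Equiv.Perm (Fin 4)} {w : List (Fin 4)} {L : Fin 4 → ℝ}
    (h : IsAllowedBlock π L w) (hL : ∀ j, 0 < L j) (hL1 : ∑ j, L j = 1) :
    ∃ y, Visits π w L y := by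
  have hL0 : ∀ j, 0 ≤ L j := fun j => (hL j).le
  obtain ⟨y, h0, h1, hy⟩ : ∃ y : ℝ, 0 ≤ y ∧ y < 1 ∧ ∀ i : Fin w.length,
      leftEnd L (w.get i) ≤ y + ((w.take i).map (shift π L)).sum ∧
        y + ((w.take i).map (shift π L)).sum < leftEnd L (w.get i) + L (w.get i) := by
    obtain ⟨x, hx⟩ := h
    by_cases hw : w = []
    · subst hw
      exact ⟨0, le_rfl, one_pos, fun i => i.elim0⟩
    · have hx' : ∀ (i : ℕ) (hi : i < w.length),
          (ietMap π L)^[i] (ietMap π L x) ∈ cell L (w.get ⟨i, hi⟩) := hx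
      have h0 := hx' 0 (List.length_pos_iff.2 hw)
      refine ⟨ietMap π L x, ?_, ?_, fun i => ?_⟩
      · exact (Finset.sum_nonneg fun _ _ => hL0 _).trans h0.1
      · refine h0.2.trans_le ?_
        have := offset_add_le id hL0 (w.get ⟨0, List.length_pos_iff.2 hw⟩)
        rwa [hL1, show offset id L _ = leftEnd L _ from (leftEnd_eq L _).symm] at this
      · rw [← iterate_eq_of_forall_mem (ietMap_of_mem_cell π hL0) i.2.le fun j hj _ => hx' j hj]
        exact hx' i i.2
  have hlim : ∀ a : ℝ, Filter.Tendsto (fun e : ℝ => y + e + a) (nhdsWithin 0 (Set.Ioi 0))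
      (nhds (y + a)) := fun a => by
    have : Continuous fun e : ℝ => y + e + a := by fun_prop
    simpa using (this.tendsto 0).mono_left nhdsWithin_le_nhds
  have hpos : ∀ᶠ e : ℝ in nhdsWithin 0 (Set.Ioi 0), 0 < e := self_mem_nhdsWithin
  have hlt : ∀ᶠ e : ℝ in nhdsWithin 0 (Set.Ioi 0), y + e + 0 < 1 :=
    (hlim 0).eventually_lt_const (by simpa using h1)
  obtain ⟨e, he, he1, hei⟩ := (hpos.and (hlt.and (Filter.eventually_all.2 fun i : Fin w.length =>
    (hlim _).eventually_lt_const (hy i).2))).exists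
  exact ⟨y + e, by linarith, by linarith, fun i => ⟨by linarith [(hy i).1], hei i⟩⟩

/-- On a small neighbourhood of some length vector, the cylinders of all allowed `k`-blocks contain
intervals of a fixed length. -/
theorem exists_stable_blocks (π : Equiv.Perm (Fin 4)) (k : ℕ) {U : Set (Fin 4 → ℝ)}
    (hU : IsOpen U) (hne : ∃ L ∈ U, (∀ j, 0 < L j) ∧ ∑ j, L j = 1) :
    ∃ (L₀ : Fin 4 → ℝ) (r : ℝ), 0 < r ∧ (∀ j, 0 < L₀ j) ∧ ∑ j, L₀ j = 1 ∧
      ∀ L : Fin 4 → ℝ, (∀ j, 0 < L j) → ∑ j, L j = 1 → (∀ j, |L j - L₀ j| < r) → L ∈ U ∧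
        ∀ w : List (Fin 4), w.length = k → IsAllowedBlock π L w → ∃ y, ∀ z, |z - y| < r →
          0 < z ∧ z < 1 ∧ ∀ (i : ℕ) (hi : i < w.length),
            (ietMap π L)^[i] z ∈ cell L (w.get ⟨i, hi⟩) := by
  let S : (Fin 4 → ℝ) → Set (List (Fin 4)) := fun L => {w | w.length = k ∧ ∃ y, Visits π w L y}
  have hfin : ∀ L, (S L).Finite := fun L =>
    (List.finite_length_eq (Fin 4) k).subset fun w hw => hw.1
  let A : Set ℕ := {n | ∃ L ∈ U, (∀ j, 0 < L j) ∧ ∑ j, L j = 1 ∧ (S L).ncard = n}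
  have hA : BddAbove A := by
    refine ⟨{w : List (Fin 4) | w.length = k}.ncard, ?_⟩
    rintro _ ⟨L, -, -, -, rfl⟩
    exact Set.ncard_le_ncard (fun w hw => hw.1) (List.finite_length_eq (Fin 4) k)
  obtain ⟨L₀, hLU, hpos, hsum, hcard⟩ : sSup A ∈ A := Nat.sSup_mem
    (by obtain ⟨L, h1, h2, h3⟩ := hne; exact ⟨_, L, h1, h2, h3, rfl⟩) hA
  have hev : ∀ w ∈ S L₀, ∃ y, ∀ᶠ r : ℝ in nhdsWithin 0 (Set.Ioi 0), ∀ L z,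
      dist L L₀ < r → dist z y < r → Visits π w L z := by
    rintro w ⟨-, y, hy⟩
    obtain ⟨e, he, hb⟩ := Metric.isOpen_iff.1 (isOpen_visits π w) (L₀, y) hy
    refine ⟨y, ?_⟩
    filter_upwards [Ioo_mem_nhdsGT he] with r hr L z hL hz
    have hmem : (L, z) ∈ Metric.ball (L₀, y) e := by
      rw [Metric.mem_ball, Prod.dist_eq]
      exact max_lt (hL.trans hr.2) (hz.trans hr.2)
    exact hb hmem
  choose! Y hY using hev
  have hUev : ∀ᶠ r : ℝ in nhdsWithin 0 (Set.Ioi 0), ∀ L, dist L L₀ < r → L ∈ U := by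
    obtain ⟨e, he, hb⟩ := Metric.isOpen_iff.1 hU L₀ hLU
    filter_upwards [Ioo_mem_nhdsGT he] with r hr L hL
    exact hb (hL.trans hr.2)
  have hpev : ∀ᶠ r : ℝ in nhdsWithin 0 (Set.Ioi 0), 0 < r := self_mem_nhdsWithin
  obtain ⟨r, hr, hrU, hrS⟩ := (hpev.and (hUev.and ((hfin L₀).eventually_all.2 hY))).exists
  refine ⟨L₀, r, hr, hpos, hsum, fun L hL hL1 hd => ?_⟩
  have hdist : dist L L₀ < r := (dist_pi_lt_iff hr).2 hd
  refine ⟨hrU L hdist, fun w hw hb => ?_⟩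
  have hsub : S L₀ ⊆ S L := fun w hw =>
    ⟨hw.1, Y w, hrS w hw L _ hdist (by simpa using hr)⟩
  have heq : S L₀ = S L := Set.eq_of_subset_of_ncard_le hsub
    (hcard ▸ le_csSup hA ⟨L, hrU L hdist, hL, hL1, rfl⟩) (hfin L)
  have hwS : w ∈ S L₀ := heq ▸ ⟨hw, hb.exists_visits hL hL1⟩
  refine ⟨Y w, fun z hz => ?_⟩
  have hv := hrS w hwS L z hdist hz
  exact ⟨hv.1, hv.2.1, hv.iterate_mem fun j => (hL j).le⟩

/-! ### Words occurring in the dominating tower -/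

/-- A word whose cylinder is longer than the union of all towers but the last one and of the last
floors of that tower occurs in the last return word. -/
theorem isInfix_of_cylinder {T : ℝ → ℝ} {I : Fin 4 → Set ℝ} {tr : Fin 4 → ℝ}
    (hT : ∀ a x, x ∈ I a → T x = x + tr a) (hI : ∀ a b x, x ∈ I a → x ∈ I b → a = b) {s : Fin 7}
    {v : Fin 4 → ℝ} (hv : ∀ c, 0 < v c) {W : Fin 4 → List (Fin 4)} (h : Induces T I s v W)
    (hc : Covers T I 1 s v W) {w : List (Fin 4)} {y r : ℝ}
    (hw : ∀ z, |z - y| < r → 0 < z ∧ z < 1 ∧ ∀ (i : ℕ) (hi : i < w.length),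
      T^[i] z ∈ I (w.get ⟨i, hi⟩))
    (hsmall : (W 0).length * v 0 + (W 1).length * v 1 + (W 2).length * v 2 + w.length * v 3
      < 2 * r) : w <:+: W 3 := by
  by_contra hn
  let R : Fin 4 → Finset ℕ := fun c =>
    if c = 3 then Finset.Ico ((W 3).length - w.length) (W 3).length
    else Finset.range (W c).length
  let o : Fin 4 → ℕ → ℝ := fun c i => offset (topPos s) v c + (((W c).take i).map tr).sum
  have hsub : Set.Ioo (y - r) (y + r) ⊆ ⋃ c, ⋃ i ∈ R c, Set.Ico (o c i) (o c i + v c) := by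
    intro z hz
    obtain ⟨h0, h1, hzw⟩ := hw z (abs_lt.2 ⟨by linarith [hz.1], by linarith [hz.2]⟩)
    obtain ⟨c, x, X, Y, hx1, hx2, hWc, hY, hX⟩ := hc z h0.le h1
    have hYl : 0 < Y.length := List.length_pos_iff.2 hY
    have hl : (W c).length = X.length + Y.length := by simp [hWc]
    simp only [Set.mem_iUnion]
    refine ⟨c, X.length, ?_, ?_⟩
    · by_cases hc3 : c = 3
      · subst hc3
        simp only [R, if_true, Finset.mem_Ico]
        refine ⟨?_, by omega⟩
        by_contra hlt
        refine hn ?_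
        have hr := h 3 x hx1 hx2
        rw [hWc] at hr ⊢
        obtain ⟨z', hz', hr'⟩ := reads_append.1 hr
        obtain rfl : z = z' := hX.iterate.symm.trans hz'.iterate
        have hp := hr'.isPrefix_of_le hI (reads_of_mem hzw) (by omega)
        exact hp.isInfix.trans (List.suffix_append _ _).isInfix
      · simp only [R, hc3, if_false, Finset.mem_range]
        omega
    · have hz' := hX.translate hT
      have : (W c).take X.length = X := by simp [hWc]
      simp only [o, this]
      exact ⟨by linarith, by linarith⟩
  have hvol := measure_mono (μ := volume) hsub
  rw [Real.volume_Ioo] at hvol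
  have hle : volume (⋃ c, ⋃ i ∈ R c, Set.Ico (o c i) (o c i + v c))
      ≤ ∑ c, ENNReal.ofReal ((R c).card * v c) := by
    refine (measure_iUnion_fintype_le _ _).trans (Finset.sum_le_sum fun c _ => ?_)
    refine (measure_biUnion_finset_le _ _).trans ?_
    simp [ENNReal.ofReal_mul, Real.volume_Ico]
  rw [← ENNReal.ofReal_sum_of_nonneg fun c _ => mul_nonneg (Nat.cast_nonneg _) (hv c).le] at hle
  have hfin := (ENNReal.ofReal_le_ofReal_iff (Finset.sum_nonneg fun c _ =>
    mul_nonneg (Nat.cast_nonneg _) (hv c).le)).1 (hvol.trans hle)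
  have h3 : ((R 3).card : ℝ) * v 3 ≤ w.length * v 3 := by
    refine mul_le_mul_of_nonneg_right ?_ (hv 3).le
    simp only [R, if_true, Nat.card_Ico]
    exact_mod_cast (by omega)
  have e0 : (R 0).card = (W 0).length := by simp [R]
  have e1 : (R 1).card = (W 1).length := by simp [R]
  have e2 : (R 2).card = (W 2).length := by simp [R]
  rw [Fin.sum_univ_four, e0, e1, e2] at hfin
  linarith

/-! ### Return words along paths -/

theorem isInfix_stepWord {s : Fin 7} {b : Bool} {W : Fin 4 → List (Fin 4)} {w : List (Fin 4)}
    (h : ∀ c, w <:+: W c) (c : Fin 4) : w <:+: stepWord s b W c := by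
  unfold stepWord
  split_ifs
  · exact List.infix_append_of_infix_left (h _)
  · exact h c

theorem isInfix_pathWord {s : Fin 7} {p : List Bool} {W : Fin 4 → List (Fin 4)} {w : List (Fin 4)}
    (h : ∀ c, w <:+: W c) (c : Fin 4) : w <:+: pathWord s p W c := by
  induction p generalizing s W with
  | nil => exact h c
  | cons b p ih => exact ih fun c => isInfix_stepWord h c

theorem pathWord_ne_nil {s : Fin 7} {p : List Bool} {W : Fin 4 → List (Fin 4)}
    (h : ∀ c, W c ≠ []) (c : Fin 4) : pathWord s p W c ≠ [] := by
  induction p generalizing s W with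
  | nil => exact h c
  | cons b p ih =>
    refine ih fun c => ?_
    unfold stepWord
    split_ifs
    · simp [h]
    · exact h c

theorem eq_one_of_dvd_pathWord {s : Fin 7} {p : List Bool} {W : Fin 4 → List (Fin 4)}
    (h : ∀ d, (∀ c, d ∣ (W c).length) → d = 1) (d : ℕ)
    (hd : ∀ c, d ∣ (pathWord s p W c).length) : d = 1 := by
  induction p generalizing s W with
  | nil => exact h d hd
  | cons b p ih =>
    refine ih (W := stepWord s b W) (fun d hd => h d fun c => ?_) hd
    have hw : d ∣ (W (winner s b)).length := by
      simpa [stepWord, winner_ne_loser] using hd (winner s b)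
    by_cases hc : c = loser s b
    · subst hc
      have hl : d ∣ (W (botLast s)).length + (W (topLast s)).length := by
        simpa [stepWord] using hd (loser s b)
      cases b
      · exact (Nat.dvd_add_right hw).1 hl
      · exact (Nat.dvd_add_left hw).1 hl
    · simpa [stepWord, hc] using hd c

theorem length_pathWord_wpow {s : Fin 7} {b : Bool} (hs : nextState s b = s) (n : ℕ)
    (W : Fin 4 → List (Fin 4)) (c : Fin 4) :
    (pathWord s (wpow [b] n) W c).length
      = (W c).length + if c = loser s b then n * (W (winner s b)).length else 0 := by
  induction n generalizing W with
  | zero => simp [wpow, pathWord]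
  | succ n ih =>
    have hne := winner_ne_loser s b
    have hsum : (W (botLast s)).length + (W (topLast s)).length
        = (W (loser s b)).length + (W (winner s b)).length := by
      cases b
      · exact add_comm _ _
      · rfl
    rw [wpow_succ, List.singleton_append, pathWord, hs, ih]
    by_cases hc : c = loser s b
    · subst hc
      simp only [stepWord, if_true, if_neg hne, List.length_append, hsum]
      ring
    · simp [stepWord, hc]

theorem exists_coprime_add_mul {a b c : ℕ} (ha : a ≠ 0)
    (h : ∀ d, d ∣ a → d ∣ b → d ∣ c → d = 1) : ∃ x, a.Coprime (b + x * c) := by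
  refine ⟨∏ p ∈ a.primeFactors with ¬ p ∣ b, p, Nat.coprime_of_dvd fun p hp hpa hpx => ?_⟩
  by_cases hpb : p ∣ b
  · have hx := (Nat.dvd_add_right hpb).1 hpx
    rcases hp.dvd_mul.1 hx with hx | hx
    · obtain ⟨q, hq, hpq⟩ := (hp.prime.dvd_finsetProd_iff _).1 hx
      simp only [Finset.mem_filter, Nat.mem_primeFactors] at hq
      rw [(Nat.prime_dvd_prime_iff_eq hp hq.1.1).1 hpq] at hpb
      exact hq.2 hpb
    · exact hp.one_lt.ne' (h p hpa hpb hx)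
  · refine hpb ((Nat.dvd_add_left (Dvd.dvd.mul_right ?_ c)).1 hpx)
    exact Finset.dvd_prod_of_mem _ (by simp [hp, hpa, ha, hpb])

/-- From the central state one can reach the state with three intervals in the limit so that
the two relevant return times are coprime. -/
theorem exists_coprime_path {W : Fin 4 → List (Fin 4)} (hW : ∀ c, W c ≠ [])
    (h : ∀ d, (∀ c, d ∣ (W c).length) → d = 1) :
    ∃ p, endState 0 p = 4 ∧
      (pathWord 0 p W 2).length.Coprime (pathWord 0 p W 0 ++ pathWord 0 p W 3).length := by
  have hpos : ∀ c, 0 < (W c).length := fun c => List.length_pos_iff.2 (hW c)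
  have hlen : ∀ x y : ℕ,
      endState 0 ([false, true] ++ wpow [false] y ++ [true, false] ++ wpow [true] x) = 4 ∧
      ∀ V, V = pathWord 0 ([false, true] ++ wpow [false] y ++ [true, false] ++ wpow [true] x) W →
      (V 2).length = (W 2).length + y * (W 1).length + (W 0).length + (W 2).length ∧
      (V 0 ++ V 3).length = 2 * (W 0).length + (W 2).length + (W 3).length
        + x * ((W 1).length + (W 2).length + y * (W 1).length) := by
    intro x y
    have e6 : endState 6 (wpow [false] y) = 6 := endState_wpow_of_loop rfl y
    have e4 : endState 4 (wpow [true] x) = 4 := endState_wpow_of_loop rfl x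
    have e0 : endState 0 [false, true] = 6 := rfl
    have e6' : endState 6 [true, false] = 4 := rfl
    refine ⟨by simp only [endState_append, e0, e6, e6', e4], ?_⟩
    rintro _ rfl
    have hs6 : nextState 6 false = 6 := rfl
    have hs4 : nextState 4 true = 4 := rfl
    have n6 : nextState 6 true = 3 := rfl
    have n0 : nextState 0 false = 3 := rfl
    simp only [pathWord_append, endState_append, e0, e6, e6', List.length_append,
      length_pathWord_wpow hs4, pathWord, stepWord, n6, n0, winner, loser, topLast, botLast]
    simp [length_pathWord_wpow hs6, stepWord, winner, loser, topLast, botLast]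
    constructor <;> ring
  obtain ⟨y, hy⟩ := exists_coprime_add_mul
    (a := Nat.gcd (Int.natAbs ((W 0).length + (W 2).length - (W 1).length : ℤ))
      (2 * (W 0).length + (W 2).length + (W 3).length))
    (b := (W 1).length + (W 2).length) (c := (W 1).length)
    (Nat.gcd_pos_of_pos_right _ (by have := hpos 0; omega)).ne' fun d hd h12 h1 => by
      have h2 : d ∣ (W 2).length := (Nat.dvd_add_right h1).1 h12
      have h0 : d ∣ (W 0).length := by
        have := Int.natCast_dvd.2 (hd.trans (Nat.gcd_dvd_left _ _))
        rw [← Int.natCast_dvd_natCast] at h1 h2 ⊢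
        have := (this.add h1).sub h2
        simpa using this
      have h3 : d ∣ (W 3).length :=
        (Nat.dvd_add_right ((h0.mul_left 2).add h2)).1 (hd.trans (Nat.gcd_dvd_right _ _))
      exact h d fun c => by fin_cases c <;> assumption
  obtain ⟨x, hx⟩ := exists_coprime_add_mul
    (a := (W 2).length + y * (W 1).length + (W 0).length + (W 2).length)
    (b := 2 * (W 0).length + (W 2).length + (W 3).length)
    (c := (W 1).length + (W 2).length + y * (W 1).length)
    (by have := hpos 0; omega) fun d h2 hc h1 => by
      refine Nat.dvd_one.1 (hy ▸ Nat.dvd_gcd (Nat.dvd_gcd ?_ hc) h1)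
      rw [← Int.natCast_dvd]
      rw [← Int.natCast_dvd_natCast] at h1 h2
      have e : ((W 0).length + (W 2).length - (W 1).length : ℤ)
          = ((W 2).length + y * (W 1).length + (W 0).length + (W 2).length : ℕ)
            - ((W 1).length + (W 2).length + y * (W 1).length : ℕ) := by
        push_cast
        ring
      rw [e]
      exact h2.sub h1
  obtain ⟨h4, hV⟩ := hlen x y
  obtain ⟨hV2, hV3⟩ := hV _ rfl
  exact ⟨_, h4, by rw [hV2, hV3]; exact hx⟩

theorem isInfix_pathWord_wpow_top (W : Fin 4 → List (Fin 4)) (K : ℕ) (c : Fin 4) :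
    W 3 <:+: pathWord 0 (wpow [true, true, true] (K + 1)) W c := by
  rw [wpow_succ, pathWord_append]
  refine isInfix_pathWord (fun c => ?_) c
  fin_cases c <;>
    simp [pathWord, stepWord, nextState, loser, topLast, botLast,
      (List.suffix_append _ (W 3)).isInfix]

theorem le_length_pathWord_wpow_bot {W : Fin 4 → List (Fin 4)} (hW : ∀ c, W c ≠ []) (J : ℕ) :
    J ≤ (pathWord 0 (wpow [false, false, false] J) W 3).length := by
  have h := sum_length_mul_pathLen 0 (wpow [false, false, false] J) W (Pi.single 3 1)
  rw [pathLen_wpow_bot] at h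
  simp [Fin.sum_univ_four] at h
  have h0 : 1 ≤ ((W 0).length : ℝ) := by exact_mod_cast List.length_pos_iff.2 (hW 0)
  have h3 : (0 : ℝ) ≤ (W 3).length := Nat.cast_nonneg _
  have hJ : (0 : ℝ) ≤ J := Nat.cast_nonneg _
  have : (J : ℝ) ≤ (pathWord 0 (wpow [false, false, false] J) W 3).length := by nlinarith
  exact_mod_cast this

/-- Some path makes all words of length `k` with long cylinders occur in all return words, with
coprime relevant return times. -/
theorem exists_path_isInfix_pathWord {W : Fin 4 → List (Fin 4)} (hW : ∀ c, W c ≠ [])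
    (hgcd : ∀ d, (∀ c, d ∣ (W c).length) → d = 1) (k : ℕ) {r : ℝ} (hr : 0 < r) :
    ∃ p, endState 0 p = 4 ∧
      (pathWord 0 p W 2).length.Coprime (pathWord 0 p W 0 ++ pathWord 0 p W 3).length ∧
      ∀ (T : ℝ → ℝ) (I : Fin 4 → Set ℝ) (tr : Fin 4 → ℝ), (∀ a x, x ∈ I a → T x = x + tr a) →
      (∀ a b x, x ∈ I a → x ∈ I b → a = b) → ∀ v : Fin 4 → ℝ, (∀ c, 0 < v c) →
      Induces T I 0 (pathLen 0 p v) W → Covers T I 1 0 (pathLen 0 p v) W →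
      ∑ c, ((W c).length : ℝ) * pathLen 0 p v c = 1 → ∀ w : List (Fin 4), w.length = k →
      (∃ y, ∀ z, |z - y| < r → 0 < z ∧ z < 1 ∧ ∀ (i : ℕ) (hi : i < w.length),
        T^[i] z ∈ I (w.get ⟨i, hi⟩)) → ∀ c, w <:+: pathWord 0 p W c := by
  obtain ⟨J, hJ⟩ := exists_nat_gt (max (k / r) 1)
  have hJ1 : (1 : ℝ) < J := (le_max_right _ _).trans_lt hJ
  have hJk : (k : ℝ) < J * r := (div_lt_iff₀ hr).1 ((le_max_left _ _).trans_lt hJ)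
  set B := wpow [false, false, false] J with hB
  set W₁ := pathWord 0 B W with hW₁
  obtain ⟨K, hK⟩ := exists_nat_gt (((∑ c, (W₁ c).length : ℕ) : ℝ) / r)
  have hKr := (div_lt_iff₀ hr).1 hK
  set A := wpow [true, true, true] (K + 1) with hA
  have eB : endState 0 B = 0 := endState_wpow_of_loop rfl J
  have eA : endState 0 A = 0 := endState_wpow_of_loop rfl (K + 1)
  obtain ⟨q, hq, hco⟩ := exists_coprime_path (W := pathWord 0 A W₁)
    (pathWord_ne_nil (pathWord_ne_nil hW))
    (eq_one_of_dvd_pathWord (eq_one_of_dvd_pathWord hgcd))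
  have hword : pathWord 0 (B ++ (A ++ q)) W = pathWord 0 q (pathWord 0 A W₁) := by
    rw [pathWord_append, eB, pathWord_append, eA]
  refine ⟨B ++ (A ++ q), by rw [endState_append, eB, endState_append, eA, hq],
    by rw [hword]; exact hco, fun T I tr hT hI v hv hind hcov hsum w hw hcyl => ?_⟩
  obtain ⟨y, hy⟩ := hcyl
  rw [hword]
  rw [pathLen_append, eB] at hind hcov hsum
  rw [sum_length_mul_pathLen, ← hW₁] at hsum
  have hu := pathLen_pos 0 (A ++ q) hv
  have hu' := pathLen_pos 0 q hv
  have h1 := hind.path hu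
  have h2 := hcov.path hind hu
  rw [eB, ← hW₁] at h1 h2
  have hw3 : w <:+: W₁ 3 := by
    refine isInfix_of_cylinder hT hI hu h1 h2 hy ?_
    have hlen : (J : ℝ) ≤ (W₁ 3).length := by exact_mod_cast le_length_pathWord_wpow_bot hW J
    have e : pathLen 0 (A ++ q) v = pathLen 0 q v + (((K + 1 : ℕ) : ℝ)
        * (pathLen 0 q v 0 + pathLen 0 q v 1 + pathLen 0 q v 2)) • Pi.single 3 1 := by
      rw [pathLen_append, eA, hA, pathLen_wpow_top]
    have e0 := congrFun e 0
    have e1 := congrFun e 1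
    have e2 := congrFun e 2
    have e3 := congrFun e 3
    simp at e0 e1 e2 e3
    have p0 := hu 0
    have p1 := hu 1
    have p2 := hu 2
    have p3 := hu 3
    have p3' := hu' 3
    rw [← e0, ← e1, ← e2] at e3
    rw [Fin.sum_univ_four] at hsum
    push_cast [Fin.sum_univ_four] at hKr
    rw [hw]
    generalize pathLen 0 (A ++ q) v = u at *
    have n0 : (0 : ℝ) ≤ (W₁ 0).length := Nat.cast_nonneg _
    have n1 : (0 : ℝ) ≤ (W₁ 1).length := Nat.cast_nonneg _
    have n2 : (0 : ℝ) ≤ (W₁ 2).length := Nat.cast_nonneg _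
    have n3 : (0 : ℝ) ≤ (W₁ 3).length := Nat.cast_nonneg _
    have m0 := mul_nonneg n0 p0.le
    have m1 := mul_nonneg n1 p1.le
    have m2 := mul_nonneg n2 p2.le
    have hu3 : J * u 3 ≤ 1 := (mul_le_mul_of_nonneg_right hlen p3.le).trans (by linarith)
    have hu31 : u 3 ≤ 1 := by linarith [mul_le_mul_of_nonneg_right hJ1.le p3.le]
    have hk : k * u 3 < r := by
      linarith [mul_lt_mul_of_pos_right hJk p3, mul_le_mul_of_nonneg_left hu3 hr.le]
    set σ := u 0 + u 1 + u 2 with hσ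
    have hσ0 : 0 < σ := by positivity
    have hKσ : K * σ ≤ 1 := by linarith
    have hlow : (W₁ 0).length * u 0 + (W₁ 1).length * u 1 + (W₁ 2).length * u 2
        ≤ ((W₁ 0).length + (W₁ 1).length + (W₁ 2).length + (W₁ 3).length) * σ := by
      have a0 : u 0 ≤ σ := by linarith
      have a1 : u 1 ≤ σ := by linarith
      have a2 : u 2 ≤ σ := by linarith
      have b0 := mul_le_mul_of_nonneg_left a0 n0
      have b1 := mul_le_mul_of_nonneg_left a1 n1
      have b2 := mul_le_mul_of_nonneg_left a2 n2
      have b3 := mul_nonneg n3 hσ0.le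
      linarith
    linarith [mul_lt_mul_of_pos_right hKr hσ0, mul_le_mul_of_nonneg_left hKσ hr.le]
  exact fun c => isInfix_pathWord
    (fun c => hw3.trans (isInfix_pathWord_wpow_top W₁ K c)) c

theorem exists_pos_mem_of_isOpen {U : Set (stdSimplex ℝ (Fin 4))} (hU : IsOpen U)
    (hne : U.Nonempty) : ∃ L : stdSimplex ℝ (Fin 4), L ∈ U ∧ ∀ j, 0 < (L : Fin 4 → ℝ) j := by
  obtain ⟨U₀, hU₀, rfl⟩ := isOpen_induced_iff.1 hU
  obtain ⟨L, hL⟩ := hne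
  have hcont : Continuous fun t : ℝ => fun j => (1 - t) * (L : Fin 4 → ℝ) j + t * (1 / 4) := by
    fun_prop
  have hev : ∀ᶠ t : ℝ in nhdsWithin 0 (Set.Ioi 0),
      (fun j => (1 - t) * (L : Fin 4 → ℝ) j + t * (1 / 4)) ∈ U₀ := by
    refine (hcont.tendsto 0).mono_left nhdsWithin_le_nhds |>.eventually (hU₀.mem_nhds ?_)
    have : (fun j => (1 - 0) * (L : Fin 4 → ℝ) j + 0 * (1 / 4)) = L.1 := by
      ext j
      change (1 - 0) * L.1 j + 0 * (1 / 4) = L.1 j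
      ring
    rw [this]
    exact hL
  obtain ⟨t, htU, ht0, ht1⟩ := (hev.and (Ioo_mem_nhdsGT one_pos)).exists
  have h0 : ∀ j, 0 ≤ (L : Fin 4 → ℝ) j := L.2.1
  have h1 : ∑ j, (L : Fin 4 → ℝ) j = 1 := L.2.2
  have hpos : ∀ j, 0 < (1 - t) * (L : Fin 4 → ℝ) j + t * (1 / 4) := fun j => by
    have := mul_nonneg (sub_nonneg.2 ht1.le) (h0 j)
    linarith
  refine ⟨⟨_, fun j => (hpos j).le, ?_⟩, htU, hpos⟩
  rw [Finset.sum_add_distrib, ← Finset.mul_sum, h1]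
  simp
  ring

/-- For `π` in the Rauzy class of `(4321)`, `k : ℕ` and a nonempty open
`U ⊆ Δ₃`, there is a nonempty open `V ⊆ U` such that every `L ∈ V` with positive
entries for which `T_{L,π}` satisfies the Keane condition is `k`-alphabet mixing. -/
theorem open_set_alphabet_mixing (π : Equiv.Perm (Fin 4))
    (hπ : InRauzyClass perm4321 π) (k : ℕ)
    (U : Set (stdSimplex ℝ (Fin 4))) (hUopen : IsOpen U) (hUne : U.Nonempty) :
    ∃ V : Set (stdSimplex ℝ (Fin 4)), V ⊆ U ∧ IsOpen V ∧ V.Nonempty ∧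
      ∀ L ∈ V, (∀ i, 0 < (L : Fin 4 → ℝ) i) →
        KeaneCondition π (L : Fin 4 → ℝ) →
        AlphabetMixing π (L : Fin 4 → ℝ) k := by
  obtain ⟨s, hs⟩ := exists_state_of_inRauzyClass hπ
  obtain ⟨L₁, hL₁U, hL₁⟩ := exists_pos_mem_of_isOpen hUopen hUne
  obtain ⟨U₀, hU₀, rfl⟩ := isOpen_induced_iff.1 hUopen
  obtain ⟨L₀, r, hr, hL₀, hL₀1, hstable⟩ := exists_stable_blocks π k hU₀ ⟨L₁, hL₁U, hL₁, L₁.2.2⟩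
  obtain ⟨p₁, hp₁, hnear⟩ := exists_path_near s (v := fun c => L₀ (topPos s c))
    (fun c => hL₀ _) (by rw [sum_topPos, hL₀1]) hr
  let W₀ : Fin 4 → List (Fin 4) := fun c => [topPos s c]
  have hW₀ : ∀ c, W₀ c ≠ [] := fun c => by simp [W₀]
  obtain ⟨p₂, hp₂, hco, hsub⟩ := exists_path_isInfix_pathWord (W := pathWord s p₁ W₀)
    (pathWord_ne_nil hW₀) (eq_one_of_dvd_pathWord fun d hd => Nat.dvd_one.1 (hd 0)) k hr
  obtain ⟨g, hg, hg1, hg2⟩ := exists_pathLen_inverse s (p₁ ++ p₂)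
  have hlen : ∀ v : Fin 4 → ℝ, pathLen s (p₁ ++ p₂) v = pathLen s p₁ (pathLen 0 p₂ v) := fun v => by
    rw [pathLen_append, hp₁]
  set W := pathWord 0 p₂ (pathWord s p₁ W₀) with hW
  have hWne : ∀ c, W c ≠ [] := pathWord_ne_nil (pathWord_ne_nil hW₀)
  set M := 2 * (∑ c, (W c).length) * (∑ c, (W c).length) + 7 * (∑ c, (W c).length) + 2 with hM
  let C : Set (Fin 4 → ℝ) := {v | (∀ c, 0 < v c) ∧ v 0 < v 3 ∧ M * (v 3 - v 0 + v 1) < v 0 ∧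
    M * (v 3 - v 0 + v 1) < v 2}
  have hC : IsOpen C := by
    simp only [C, Set.ofPred_and, Set.ofPred_forall]
    exact (isOpen_iInter_of_finite fun c => isOpen_lt (by fun_prop) (by fun_prop)).inter
      ((isOpen_lt (by fun_prop) (by fun_prop)).inter
        ((isOpen_lt (by fun_prop) (by fun_prop)).inter (isOpen_lt (by fun_prop) (by fun_prop))))
  let h : stdSimplex ℝ (Fin 4) → Fin 4 → ℝ := fun L => g fun c => (L : Fin 4 → ℝ) (topPos s c)
  have hcoord : ∀ j, Continuous fun L : stdSimplex ℝ (Fin 4) => (L : Fin 4 → ℝ) j := fun j =>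
    (continuous_apply j).comp continuous_subtype_val
  have hh : Continuous h := hg.comp (continuous_pi fun c => hcoord _)
  have hlenh : ∀ L : stdSimplex ℝ (Fin 4), (fun c => (L : Fin 4 → ℝ) (topPos s c))
      = pathLen s p₁ (pathLen 0 p₂ (h L)) := fun L => by rw [← hlen, hg1]
  let V : Set (stdSimplex ℝ (Fin 4)) := {L | (∀ j, |(L : Fin 4 → ℝ) j - L₀ j| < r) ∧ h L ∈ C}
  have hpos : ∀ L ∈ V, ∀ j, 0 < (L : Fin 4 → ℝ) j := fun L hL j => by
    obtain ⟨c, rfl⟩ := (topPos_bijective s).2 j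
    have := pathLen_pos s p₁ (pathLen_pos 0 p₂ hL.2.1) c
    rwa [← hlenh] at this
  refine ⟨V, fun L hL => (hstable L (hpos L hL) L.2.2 hL.1).1, ?_, ?_, fun L hL hLpos hK => ?_⟩
  · simp only [V, Set.ofPred_and, Set.ofPred_forall]
    exact (isOpen_iInter_of_finite fun j => isOpen_lt
      ((hcoord j).sub continuous_const).abs continuous_const).inter
      (hC.preimage hh)
  · let v : Fin 4 → ℝ := ![1, 1 / (2 * M + 1), 1, 1 + 1 / (2 * M + 1)]
    have hMpos : (0 : ℝ) < 2 * M + 1 := by positivity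
    have hv : ∀ c, 0 < v c := fun c => by fin_cases c <;> simp [v] <;> positivity
    set x := pathLen s p₁ (pathLen 0 p₂ v) with hx
    have hxpos : ∀ c, 0 < x c := pathLen_pos s p₁ (pathLen_pos 0 p₂ hv)
    set S := ∑ c, x c with hS
    have hSpos : 0 < S := Finset.sum_pos (fun c _ => hxpos c) ⟨0, by simp⟩
    let e := Equiv.ofBijective _ (topPos_bijective s)
    have he : ∀ c, e.symm (topPos s c) = c := fun c => e.symm_apply_apply c
    let L : stdSimplex ℝ (Fin 4) := ⟨fun j => S⁻¹ * x (e.symm j),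
      fun j => (mul_pos (inv_pos.2 hSpos) (hxpos _)).le, by
        rw [← Finset.mul_sum, Equiv.sum_comp e.symm x, ← hS, inv_mul_cancel₀ hSpos.ne']⟩
    have hLh : h L = S⁻¹ • v := by
      have : (fun c => (L : Fin 4 → ℝ) (topPos s c)) = pathLen s (p₁ ++ p₂) (S⁻¹ • v) := by
        rw [pathLen_smul, hlen]
        ext c
        change S⁻¹ * x (e.symm (topPos s c)) = _
        rw [he]
        rfl
      change g _ = _
      rw [this, hg2]
    refine ⟨L, fun j => ?_, ?_⟩
    · obtain ⟨c, rfl⟩ := (topPos_bijective s).2 j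
      change |S⁻¹ * x (e.symm (topPos s c)) - _| < r
      rw [he]
      have := hnear _ (pathLen_pos 0 p₂ hv) c
      rw [← hx, ← hS] at this
      rw [show S⁻¹ * x c - L₀ (topPos s c) = S⁻¹ * (x c - S * L₀ (topPos s c)) by
        field_simp, abs_mul, abs_of_pos (inv_pos.2 hSpos), inv_mul_lt_iff₀ hSpos, mul_comm S r]
      exact this
    · rw [hLh]
      have hi := inv_pos.2 hSpos
      have hlt : M * (v 3 - v 0 + v 1) < 1 := by
        simp only [v, Matrix.cons_val]
        rw [show (M : ℝ) * (1 + 1 / (2 * M + 1) - 1 + 1 / (2 * M + 1)) = 2 * M / (2 * M + 1) by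
          field_simp; ring, div_lt_one hMpos]
        linarith
      have hlt' := mul_lt_mul_of_pos_left hlt hi
      have hv0 : v 0 = 1 := rfl
      have hv2 : v 2 = 1 := rfl
      refine ⟨fun c => mul_pos hi (hv c), ?_, ?_, ?_⟩
      · refine mul_lt_mul_of_pos_left ?_ hi
        simp [v]
        positivity
      · simp only [Pi.smul_apply, smul_eq_mul]
        rw [hv0] at hlt' ⊢
        linarith
      · simp only [Pi.smul_apply, smul_eq_mul]
        rw [hv2]
        linarith
  · have hL0 : ∀ j, 0 ≤ (L : Fin 4 → ℝ) j := fun j => (hLpos j).le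
    have hL1 : ∑ j, (L : Fin 4 → ℝ) j = 1 := L.2.2
    obtain ⟨hv, hlt, hs0, hs2⟩ := hL.2
    set T := ietMap π (L : Fin 4 → ℝ) with hT
    set I := cell (L : Fin 4 → ℝ) with hI
    have hv₂ := pathLen_pos 0 p₂ hv
    have hi₀ : Induces T I s (fun c => (L : Fin 4 → ℝ) (topPos s c)) W₀ := induces_ietMap hs hL0
    have hc₀ := covers_ietMap π s (L : Fin 4 → ℝ)
    have hd₀ := singular_ietMap π s (L : Fin 4 → ℝ)
    have hsurj : ∀ y, 0 ≤ y → y < 1 → ∃ x, T x = y := fun y h0 h1 => by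
      obtain ⟨c, hc1, hc2⟩ := exists_offset_mem (botPos_bijective s)
        (fun c => (L : Fin 4 → ℝ) (topPos s c)) h0 (by rwa [sum_topPos, hL1])
      exact ⟨_, (Reads.of_induces hi₀ hc1 hc2).2⟩
    rw [hL1] at hc₀
    rw [hlenh L] at hi₀ hc₀ hd₀
    have hi₁ := hi₀.path hv₂
    have hc₁ := hc₀.path hi₀ hv₂
    have hd₁ := hd₀.path hi₀ hv₂
    rw [hp₁] at hi₁ hc₁ hd₁
    have hi₂ := hi₁.path hv
    have hd₂ := hd₁.path hi₁ hv
    rw [hp₂] at hi₂ hd₂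
    have hsum : ∑ c, ((pathWord s p₁ W₀ c).length : ℝ) * pathLen 0 p₂ (h L) c = 1 := by
      rw [← sum_length_mul_pathLen, ← hlenh]
      simp [W₀, sum_topPos, hL1]
    have hdisj : ∀ a b x, x ∈ I a → x ∈ I b → a = b := cell_disjoint hL0
    have hsv : ∑ c, h L c ≤ 1 := by
      rw [← hsum, sum_length_mul_pathLen]
      refine Finset.sum_le_sum fun c _ => ?_
      have : (1 : ℝ) ≤ (W c).length := by exact_mod_cast List.length_pos_iff.2 (hWne c)
      exact le_mul_of_one_le_left (hv c).le this
    have htop : ∀ c, c ≠ 0 → ((topPos s c : Fin 4) : ℕ) ≠ 0 :=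
      (by decide : ∀ s c, c ≠ 0 → ((topPos s c : Fin 4) : ℕ) ≠ 0) s
    obtain ⟨N, hN⟩ := (hi₂.nearRotation hv hlt hs0 hs2).exists_mixing hdisj hi₂ hd₂ hWne
      (fun i j hi hj m n hmn => by
        obtain ⟨h1, h2⟩ := hK _ _ (htop i hi) (htop j hj) m n hmn
        exact ⟨(topPos_bijective s).1 h1, h2⟩) hco le_rfl
    refine ⟨N, fun a b ha hb hab hbb n hn => ?_⟩
    have key : ∀ w : List (Fin 4), w.length = k → IsAllowedBlock π (L : Fin 4 → ℝ) w →
        ∀ c, w <:+: W c := fun w hw hb =>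
      hsub T I _ (ietMap_of_mem_cell π hL0) hdisj _ hv hi₁ hc₁ hsum w hw
        ((hstable L hLpos hL1 hL.1).2 w hw hb)
    have hka := key a ha hab
    have hkb := key b hb hbb
    obtain ⟨w, hwl, haw, hbw, x, R, z, hx0, hx1, hread⟩ := hN a b (hka 2) (hkb 2)
      ((hka 3).trans (List.suffix_append _ _).isInfix)
      ((hkb 3).trans (List.suffix_append _ _).isInfix) n hn
    refine ⟨w, hwl, ?_, haw, hbw⟩
    obtain ⟨x', hx'⟩ := hsurj x hx0 (hx1.trans_le hsv)
    obtain ⟨y, hRy, hwy⟩ := reads_append.1 hread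
    refine ⟨T^[R.length] x', fun i hi => ?_⟩
    have : T^[i + 1] (T^[R.length] x') = T^[i] y := by
      rw [Function.iterate_succ_apply, ← Function.iterate_succ_apply' T,
        Function.iterate_succ_apply, hx', hRy.iterate]
    rw [← hT, this]
    exact hwy.mem i hi

end IETPaper
end

section
/- Let d > 3 and let π be an irreducible non-degenerate permutation of {1,…,d}. Then the Rauzy class of π contains a permutation σ that is either a (4321) proxy, meaning σ(d−3)=d, σ(d−2)=d−1, σ(d−1)=d−2 and σ(d)=1, or a (4321) quasi-proxy, meaning σ(1)=d, σ(d−2)=d−1, σ(d−1)=d−2 and σ(d)=1. -/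
open Finset MeasureTheory

namespace IETPaper

section ListRauzy

variable {α : Type*}

/-- A Rauzy move on a pair (top row, bottom row) of words: the last letter `z` of one row is
inserted in that row right after the last letter `w` of the other row. -/
inductive RowStep : List α × List α → List α × List α → Prop
  | top (P Q R : List α) (w z : α) :
      RowStep (P ++ w :: (Q ++ [z]), R ++ [w]) (P ++ w :: z :: Q, R ++ [w])
  | bot (P Q R : List α) (w z : α) :
      RowStep (R ++ [w], P ++ w :: (Q ++ [z])) (R ++ [w], P ++ w :: z :: Q)

/-- Reachability of pairs of rows by Rauzy moves. -/
def RowReach : List α × List α → List α × List α → Prop := Relation.ReflTransGen RowStep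

theorem RowStep.swap {s t : List α × List α} (h : RowStep s t) : RowStep s.swap t.swap := by
  cases h with
  | top P Q R w z => exact .bot P Q R w z
  | bot P Q R w z => exact .top P Q R w z

theorem RowReach.swap {s t : List α × List α} (h : RowReach s t) : RowReach s.swap t.swap :=
  Relation.ReflTransGen.lift (p := RowStep) Prod.swap (fun _ _ => RowStep.swap) s t h

theorem RowReach.rotate_top (P R : List α) (w : α) (S Q : List α) :
    RowReach (P ++ w :: (Q ++ S), R ++ [w]) (P ++ w :: (S ++ Q), R ++ [w]) := by
  induction S using List.reverseRecOn generalizing Q with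
  | nil =>
    rw [List.append_nil, List.nil_append]
    exact Relation.ReflTransGen.refl
  | append_singleton S z ih =>
    have h := RowStep.top P (Q ++ S) R w z
    have h' := ih (z :: Q)
    simp only [List.append_assoc, List.cons_append, List.nil_append] at h h' ⊢
    exact Relation.ReflTransGen.head h h'

theorem RowReach.rotate_bot (P R : List α) (w : α) (S Q : List α) :
    RowReach (R ++ [w], P ++ w :: (Q ++ S)) (R ++ [w], P ++ w :: (S ++ Q)) :=
  (RowReach.rotate_top P R w S Q).swap

theorem RowStep.perm {s t : List α × List α} (h : RowStep s t) :
    s.1.Perm t.1 ∧ s.2.Perm t.2 := by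
  have key : ∀ (P Q : List α) (w z : α), (P ++ w :: (Q ++ [z])).Perm (P ++ w :: z :: Q) :=
    fun P Q w z => ((List.perm_append_singleton z Q).cons w).append_left P
  cases h with
  | top P Q R w z => exact ⟨key .., .refl _⟩
  | bot P Q R w z => exact ⟨.refl _, key ..⟩

/-- No proper nonempty prefix of the top row has the same letters as a prefix of the bottom row. -/
def RowIrred (T B : List α) : Prop :=
  ∀ T₁ T₂ B₁ B₂, T = T₁ ++ T₂ → B = B₁ ++ B₂ → T₁.Perm B₁ → T₁ = [] ∨ T₂ = []

theorem RowIrred.swap {T B : List α} (hp : T.Perm B) (h : RowIrred T B) : RowIrred B T := by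
  intro B₁ B₂ T₁ T₂ hB hT hperm
  have hl := hp.length_eq
  have hl' := hperm.length_eq
  rcases h T₁ T₂ B₁ B₂ hT hB hperm.symm with h | h <;> subst h hT hB
  · left; simpa using hl'
  · right
    simp only [List.length_append, List.length_nil] at hl
    exact List.length_eq_zero_iff.1 (by omega)

/-- `x` is immediately followed by `y` in `L`. -/
def Adjacent (x y : α) (L : List α) : Prop := [x, y] <:+: L

theorem adjacent_append {x y : α} {L M : List α} :
    Adjacent x y (L ++ M) ↔
      Adjacent x y L ∨ (L.getLast? = some x ∧ M.head? = some y) ∨ Adjacent x y M := by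
  unfold Adjacent
  induction L with
  | nil => simp
  | cons a L ih =>
    rw [List.cons_append, List.infix_cons_iff, ih, List.infix_cons_iff]
    cases L with
    | nil => cases M <;> simp [List.cons_prefix_cons, @eq_comm _ x, @eq_comm _ y]
    | cons b L =>
      have h : [x, y] <+: a :: (b :: L ++ M) ↔ [x, y] <+: a :: b :: L := by
        simp [List.cons_prefix_cons]
      rw [h, List.getLast?_cons_cons, or_assoc]

theorem not_adjacent_last {x y : α} {L : List α} (h : (L ++ [x]).Nodup) :
    ¬ Adjacent x y (L ++ [x]) := by
  rw [adjacent_append]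
  have hx : x ∉ L := by grind
  rintro (h | ⟨h, -⟩ | h)
  · exact hx (h.subset (by simp))
  · exact hx (List.mem_of_getLast? h)
  · simpa using h.length_le

/-- The singularity at the left endpoint is removable. -/
def LeftDegenerate (T B : List α) : Prop :=
  ∃ a f c e, T.head? = some a ∧ B.head? = some f ∧ Adjacent c f T ∧ Adjacent e a B ∧
    (c = e ∨ (B.getLast? = some c ∧ T.getLast? = some e))

theorem LeftDegenerate.swap {T B : List α} (h : LeftDegenerate T B) : LeftDegenerate B T := by
  obtain ⟨a, f, c, e, h₁, h₂, h₃, h₄, h₅⟩ := h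
  exact ⟨f, a, e, c, h₂, h₁, h₄, h₃, h₅.imp Eq.symm And.symm⟩

theorem LeftDegenerate.of_top {P Q R : List α} {w z : α}
    (hT : (P ++ w :: z :: Q).Nodup) (hB : (R ++ [w]).Nodup)
    (h : LeftDegenerate (P ++ w :: z :: Q) (R ++ [w])) :
    LeftDegenerate (P ++ w :: (Q ++ [z])) (R ++ [w]) := by
  obtain ⟨a, f, c, e, h₁, h₂, h₃, h₄, h₅⟩ := h
  have e₁ : P ++ w :: z :: Q = (P ++ [w]) ++ z :: Q := by simp
  have e₂ : P ++ w :: (Q ++ [z]) = (P ++ [w]) ++ (Q ++ [z]) := by simp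
  have hhead : (P ++ w :: (Q ++ [z])).head? = some a := by
    rw [← h₁]; cases P <;> simp
  have hlast : (P ++ w :: (Q ++ [z])).getLast? = some z := by rw [e₂, ← List.append_assoc, List.getLast?_concat]
  have hPw : (P ++ [w]).Nodup := by grind
  have hwe : w ≠ e := by
    rintro rfl
    exact not_adjacent_last hB h₄
  have hcw : (R ++ [w]).getLast? = some c ↔ w = c := by simp
  rw [hcw] at h₅
  rw [e₁, adjacent_append] at h₃
  rcases h₃ with h₃ | ⟨h₃, h₃'⟩ | h₃
  · have hc : c = e := by
      rcases h₅ with h | ⟨rfl, -⟩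
      · exact h
      · exact absurd h₃ (not_adjacent_last hPw)
    refine ⟨a, f, c, e, hhead, h₂, ?_, h₄, .inl hc⟩
    rw [e₂, adjacent_append]; exact .inl h₃
  · obtain rfl : w = c := by simpa using h₃
    obtain rfl : z = f := by simpa using h₃'
    rcases h₅ with h | ⟨-, h⟩
    · exact absurd h hwe
    rcases List.eq_nil_or_concat Q with rfl | ⟨Q, q, rfl⟩
    · exact ⟨a, z, w, e, hhead, h₂, ⟨P, [], by simp⟩, h₄, .inr ⟨by simp, h⟩⟩
    · have hq : q = e := by
        rw [e₁] at h
        have e₃ : P ++ [w] ++ z :: Q.concat q = (P ++ w :: z :: Q) ++ [q] := by simp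
        rw [e₃, List.getLast?_concat] at h
        exact Option.some.inj h
      subst hq
      exact ⟨a, z, q, q, hhead, h₂, ⟨P ++ w :: Q, [], by simp⟩, h₄, .inl rfl⟩
  · rw [Adjacent, List.infix_cons_iff] at h₃
    rcases h₃ with h₃ | h₃
    · obtain ⟨V, hV⟩ := h₃
      simp only [List.cons_append, List.nil_append, List.cons.injEq] at hV
      obtain ⟨rfl, rfl⟩ := hV
      rcases h₅ with rfl | ⟨rfl, -⟩
      · exact ⟨a, f, w, c, hhead, h₂, ⟨P, V ++ [c], by simp⟩, h₄, .inr ⟨by simp, hlast⟩⟩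
      · grind
    · have hc : c = e := by
        rcases h₅ with h | ⟨rfl, -⟩
        · exact h
        · have := h₃.subset (List.mem_cons_self)
          grind
      refine ⟨a, f, c, e, hhead, h₂, ?_, h₄, .inl hc⟩
      rw [e₂, adjacent_append]; exact .inr (.inr (adjacent_append.2 (.inl h₃)))

/-- The properties of a pair of rows preserved by Rauzy moves. -/
structure RowInv (s : List α × List α) : Prop where
  nodup : s.1.Nodup
  perm : s.1.Perm s.2
  irred : RowIrred s.1 s.2
  nondeg : ¬ LeftDegenerate s.1 s.2

theorem RowInv.swap {s : List α × List α} (h : RowInv s) : RowInv s.swap :=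
  ⟨h.perm.nodup_iff.1 h.nodup, h.perm.symm, h.irred.swap h.perm, fun h' => h.nondeg h'.swap⟩

theorem RowInv.step_top {P Q R : List α} {w z : α}
    (h : RowInv (P ++ w :: (Q ++ [z]), R ++ [w])) : RowInv (P ++ w :: z :: Q, R ++ [w]) := by
  have hp := (RowStep.top P Q R w z).perm.1
  have hn : (P ++ w :: z :: Q).Nodup := hp.nodup_iff.1 h.nodup
  have hB : (R ++ [w]).Nodup := h.perm.nodup_iff.1 h.nodup
  refine ⟨hn, hp.symm.trans h.perm, ?_, fun h' => h.nondeg (h'.of_top hn hB)⟩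
  intro T₁ T₂ B₁ B₂ hT hB' hperm
  rcases List.eq_nil_or_concat B₂ with rfl | ⟨B₂, w', rfl⟩
  · right
    have h₁ := hperm.length_eq
    have h₂ := (hp.symm.trans h.perm).length_eq
    dsimp only at h₂ hT hB'
    rw [hT, hB'] at h₂
    simp only [List.length_append, List.length_nil] at h₂
    exact List.length_eq_zero_iff.1 (by omega)
  · dsimp only at hT hB'
    have hw : w ∉ T₁ := by
      rw [hperm.mem_iff]
      rw [hB'] at hB
      have : w = w' := by
        have := congrArg List.getLast? hB'
        simpa [← List.append_assoc] using this
      subst this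
      grind
    rcases List.append_eq_append_iff.1 hT with ⟨V, rfl, hV⟩ | ⟨V, rfl, hV⟩
    · cases V with
      | nil =>
        have := h.irred P (w :: (Q ++ [z])) B₁ _ rfl hB' (by simpa using hperm)
        simp_all
      | cons v V => simp_all
    · left
      have := h.irred T₁ (V ++ w :: (Q ++ [z])) B₁ _ (by simp) hB' hperm
      simpa using this

theorem RowInv.step {s t : List α × List α} (hs : RowInv s) (h : RowStep s t) : RowInv t := by
  cases h with
  | top P Q R w z => exact hs.step_top
  | bot P Q R w z => exact (RowInv.step_top hs.swap).swap

theorem RowInv.reach {s t : List α × List α} (hs : RowInv s) (h : RowReach s t) : RowInv t := by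
  induction h with
  | refl => exact hs
  | tail _ h ih => exact ih.step h

/-- The standard pair of rows with extreme letters `A`, `D` and inner words `X`, `Y`. -/
def standardRows (A D : α) (X Y : List α) : List α × List α :=
  (A :: (X ++ [D]), D :: (Y ++ [A]))

theorem exists_standard_aux (m : ℕ) : ∀ (T₀ R S : List α) (t : α), T₀ ≠ [] → R.length = m →
    RowInv (T₀ ++ [t], R ++ t :: S) →
    ∃ A D X Y, RowReach (T₀ ++ [t], R ++ t :: S) (standardRows A D X Y) := by
  induction m using Nat.strong_induction_on with
  | _ m ih =>
    intro T₀ R S t hT₀ hR h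
    have hn : (T₀ ++ [t]).Nodup := h.nodup
    have hp : (T₀ ++ [t]).Perm (R ++ t :: S) := h.perm
    have hnB := hp.nodup_iff.1 hn
    have hlen := hp.length_eq
    simp only [List.length_append, List.length_cons, List.length_nil] at hlen
    rcases Nat.eq_zero_or_pos m with rfl | hm
    · obtain rfl := List.length_eq_zero_iff.1 hR
      obtain ⟨a, X, rfl⟩ := List.exists_cons_of_ne_nil hT₀
      have ha : a ∈ S := by
        have : a ∈ [] ++ t :: S := hp.subset (by simp)
        have hat : a ≠ t := by grind
        simpa [hat] using this
      obtain ⟨S₁, S₂, rfl⟩ := List.append_of_mem ha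
      refine ⟨a, t, X, S₂ ++ S₁, ?_⟩
      have := RowReach.rotate_bot [] (a :: X) t S₂ (S₁ ++ [a])
      simpa [standardRows] using this
    · obtain ⟨s, hsS, T₁, T₂, hT, hT₁⟩ :
          ∃ s ∈ S, ∃ T₁ T₂, T₀ = T₁ ++ s :: T₂ ∧ T₁.length < m := by
        by_contra! hcon
        have hsub : T₀.take m ⊆ R := by
          intro x hx
          obtain ⟨i, hi, rfl⟩ := List.mem_take_iff_getElem.1 hx
          have hiT : i < T₀.length := by omega
          have hmem : T₀[i] ∈ R ++ t :: S := hp.subset (by simp)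
          have hxt : T₀[i] ≠ t := by
            intro h
            have : t ∈ T₀ := h ▸ List.getElem_mem hiT
            grind
          have hxS : T₀[i] ∉ S := by
            intro hS
            have := hcon _ hS (T₀.take i) (T₀.drop (i + 1)) (by simp)
            simp only [List.length_take] at this
            omega
          simpa [hxt, hxS] using hmem
        have hperm : (T₀.take m).Perm R := by
          refine (List.subperm_of_subset ?_ hsub).perm_of_length_le ?_
          · exact ((List.take_sublist _ _).trans (List.sublist_append_left _ _)).nodup hn
          · simp only [List.length_take]; omega
        have := h.irred (T₀.take m) (T₀.drop m ++ [t]) R (t :: S)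
          (by simp [← List.append_assoc]) rfl hperm
        rcases this with h | h
        · simp only [List.take_eq_nil_iff] at h
          rcases h with h | h
          · omega
          · exact hT₀ h
        · simp at h
      obtain ⟨S₁, S₂, rfl⟩ := List.append_of_mem hsS
      have hr : RowReach (T₀ ++ [t], R ++ t :: (S₁ ++ s :: S₂))
          (T₀ ++ [t], (R ++ t :: (S₂ ++ S₁)) ++ [s]) := by
        simpa using RowReach.rotate_bot R T₀ t S₂ (S₁ ++ [s])
      have hinv := (h.reach hr).swap
      subst hT
      obtain ⟨A, D, X, Y, hst⟩ := ih T₁.length hT₁ (R ++ t :: (S₂ ++ S₁)) T₁ (T₂ ++ [t]) s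
        (by simp) rfl (by simpa using hinv)
      refine ⟨D, A, Y, X, Relation.ReflTransGen.trans hr ?_⟩
      have := hst.swap
      simp only [standardRows, Prod.swap_prod_mk, List.append_assoc, List.cons_append] at this ⊢
      exact this

theorem exists_standard {s : List α × List α} (h : RowInv s) (hlen : 2 ≤ s.1.length) :
    ∃ A D X Y, RowReach s (standardRows A D X Y) := by
  obtain ⟨T, B⟩ := s
  rcases List.eq_nil_or_concat T with rfl | ⟨T₀, t, rfl⟩
  · simp at hlen
  have ht : t ∈ B := h.perm.subset (by simp)
  obtain ⟨R, S, rfl⟩ := List.append_of_mem ht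
  rw [List.concat_eq_append] at *
  refine exists_standard_aux _ T₀ R S t ?_ rfl h
  rintro rfl
  simp at hlen

/-- Exchanging the first two of three blocks in both inner words of a standard pair, when the
blocks end with the same letters `u`, `v` in both words. -/
theorem RowReach.exchange (A D u v : α) (P Q S P' Q' S' : List α) :
    RowReach (standardRows A D (P ++ u :: (Q ++ v :: S)) (P' ++ u :: (Q' ++ v :: S')))
      (standardRows A D (Q ++ v :: (P ++ u :: S)) (Q' ++ v :: (P' ++ u :: S'))) := by
  have h₁ := RowReach.rotate_top [] (D :: (P' ++ u :: (Q' ++ v :: S'))) A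
    (Q ++ v :: (S ++ [D])) (P ++ [u])
  have h₂ := RowReach.rotate_bot (D :: P') (A :: (Q ++ v :: (S ++ D :: P))) u
    (S' ++ [A]) (Q' ++ [v])
  have h₃ := RowReach.rotate_top (A :: Q) (D :: (P' ++ u :: (S' ++ A :: Q'))) v
    (P ++ [u]) (S ++ [D])
  have h₄ := RowReach.rotate_bot [] (A :: (Q ++ v :: (P ++ u :: S))) D
    (Q' ++ [v]) (P' ++ u :: (S' ++ [A]))
  simp only [standardRows, List.append_assoc, List.cons_append, List.nil_append]
    at h₁ h₂ h₃ h₄ ⊢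
  exact ((h₁.trans h₂).trans h₃).trans h₄

theorem perm_exchange (u v : α) (P Q S : List α) :
    (P ++ u :: (Q ++ v :: S)).Perm (Q ++ v :: (P ++ u :: S)) := by
  have := (List.perm_append_comm (l₁ := P ++ [u]) (l₂ := Q ++ [v])).append_right S
  simpa using this

/-- The rows of a (4321) proxy or quasi-proxy. -/
def ProxyRows (s : List α × List α) : Prop :=
  ∃ p q r D U V, (s.1 = U ++ [p, q, r, D] ∨ s.1 = p :: (U ++ [q, r, D])) ∧
    s.2 = D :: (V ++ [r, q, p])

/-- The standard pair with inner words `X`, `Y` reaches a proxy or quasi-proxy. -/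
def ReachesProxy (A D : α) (X Y : List α) : Prop :=
  ∃ s, RowReach (standardRows A D X Y) s ∧ ProxyRows s

theorem reachesProxy_of_reversed_triple (A D p q r : α) (X₀ Y₀ Y₃ : List α) :
    ReachesProxy A D (X₀ ++ [p, q, r]) (Y₀ ++ r :: q :: p :: Y₃) := by
  refine ⟨(A :: (X₀ ++ [p, q, r, D]), D :: (Y₃ ++ A :: (Y₀ ++ [r, q, p]))), ?_,
    p, q, r, D, A :: X₀, Y₃ ++ A :: Y₀, by simp, by simp⟩
  have := RowReach.rotate_bot [] (A :: (X₀ ++ [p, q, r])) D (Y₃ ++ [A]) (Y₀ ++ [r, q, p])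
  simpa [standardRows] using this

theorem reachesProxy_of_reversed_pair (A D q r : α) (X₀ Y₀ : List α) :
    ReachesProxy A D (X₀ ++ [q, r]) (Y₀ ++ [r, q]) :=
  ⟨_, Relation.ReflTransGen.refl, A, q, r, D, X₀, Y₀, by simp [standardRows],
    by simp [standardRows]⟩

theorem ReachesProxy.of_exchange {A D u v : α} {P Q S P' Q' S' : List α}
    (h : ReachesProxy A D (Q ++ v :: (P ++ u :: S)) (Q' ++ v :: (P' ++ u :: S'))) :
    ReachesProxy A D (P ++ u :: (Q ++ v :: S)) (P' ++ u :: (Q' ++ v :: S')) := by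
  obtain ⟨s, hs, hs'⟩ := h
  exact ⟨s, (RowReach.exchange A D u v P Q S P' Q' S').trans hs, hs'⟩

theorem nodup_ne_of_mem_middle {U V : List α} {a b x : α}
    (h : (U ++ a :: (V ++ [b])).Nodup) (hx : x ∈ V) : x ≠ a ∧ x ≠ b := by
  grind

theorem nodup_middle {U V : List α} {a b : α} (h : (U ++ a :: (V ++ [b])).Nodup) :
    V.Nodup := by
  grind

theorem reachesProxy_aux (A D : α) (k : ℕ) : ∀ (X Y X₁ X₂ Y₁ Y₂ : List α) (m n : α),
    X = X₁ ++ m :: (X₂ ++ [n]) → Y = Y₁ ++ n :: (Y₂ ++ [m]) → X₂.length = k →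
    X.Nodup → X.Perm Y → ReachesProxy A D X Y := by
  induction k using Nat.strong_induction_on with
  | _ k ih =>
  intro X Y X₁ X₂ Y₁ Y₂ m n hX hY hk hn hp
  have hnY := hp.nodup_iff.1 hn
  have hnX₂ : X₂.Nodup := nodup_middle (hX ▸ hn)
  have hnY₂ : Y₂.Nodup := nodup_middle (hY ▸ hnY)
  -- a letter of `X₂` before `n` in the bottom word
  have before : ∀ (X Y X₁ X₂ Y₁ Y₂ : List α) (m n u : α),
      X = X₁ ++ m :: (X₂ ++ [n]) → Y = Y₁ ++ n :: (Y₂ ++ [m]) → X₂.length = k →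
      X.Nodup → X.Perm Y → u ∈ X₂ → u ∈ Y₁ → ReachesProxy A D X Y := by
    intro X Y X₁ X₂ Y₁ Y₂ m n u hX hY hk hn hp hu hu'
    obtain ⟨X₃, X₄, rfl⟩ := List.append_of_mem hu
    obtain ⟨Y₃, Y₄, rfl⟩ := List.append_of_mem hu'
    have eX : X = (X₁ ++ m :: X₃) ++ u :: (X₄ ++ n :: []) := by simp [hX]
    have eY : Y = Y₃ ++ u :: (Y₄ ++ n :: (Y₂ ++ [m])) := by simp [hY]
    have pX := perm_exchange u n (X₁ ++ m :: X₃) X₄ []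
    have pY := perm_exchange u n Y₃ Y₄ (Y₂ ++ [m])
    rw [← eX] at pX
    rw [← eY] at pY
    rw [eX, eY]
    apply ReachesProxy.of_exchange
    refine ih X₃.length ?_ _ _ (X₄ ++ n :: X₁) X₃ (Y₄ ++ n :: Y₃) Y₂ m u (by simp) (by simp) rfl
      (pX.nodup_iff.1 hn) (pX.symm.trans (hp.trans pY))
    rw [← hk]; simp
  -- two letters of `X₂` in the same order in the bottom word
  have ordered : ∀ (X₃ X₄ X₅ Z₃ Z₄ Z₅ : List α) (u v : α),
      X₂ = X₃ ++ u :: (X₄ ++ v :: X₅) → Y₂ = Z₃ ++ u :: (Z₄ ++ v :: Z₅) →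
      ReachesProxy A D X Y := by
    rintro X₃ X₄ X₅ Z₃ Z₄ Z₅ u v rfl rfl
    have eX : X = (X₁ ++ m :: X₃) ++ u :: (X₄ ++ v :: (X₅ ++ [n])) := by simp [hX]
    have eY : Y = (Y₁ ++ n :: Z₃) ++ u :: (Z₄ ++ v :: (Z₅ ++ [m])) := by simp [hY]
    have pX := perm_exchange u v (X₁ ++ m :: X₃) X₄ (X₅ ++ [n])
    have pY := perm_exchange u v (Y₁ ++ n :: Z₃) Z₄ (Z₅ ++ [m])
    rw [← eX] at pX
    rw [← eY] at pY
    rw [eX, eY]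
    apply ReachesProxy.of_exchange
    refine ih (X₃ ++ u :: X₅).length ?_ _ _ (X₄ ++ v :: X₁) (X₃ ++ u :: X₅) (Z₄ ++ v :: Y₁)
      (Z₃ ++ u :: Z₅) m n (by simp) (by simp) rfl
      (pX.nodup_iff.1 hn) (pX.symm.trans (hp.trans pY))
    rw [← hk]; simp
  -- a letter of `X₂` after a letter of `X₁` between `n` and `m`
  have crossed : ∀ (Y₃ Y₄ : List α) (u v : α), u ∈ X₁ → Y₂ = Y₃ ++ u :: Y₄ →
      v ∈ X₂ → v ∈ Y₄ → ReachesProxy A D X Y := by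
    rintro Y₃ Y₄ u v hu rfl hv hv'
    obtain ⟨X₃, X₄, rfl⟩ := List.append_of_mem hu
    have eX : X = X₃ ++ u :: (X₄ ++ m :: (X₂ ++ [n])) := by simp [hX]
    have eY : Y = (Y₁ ++ n :: Y₃) ++ u :: (Y₄ ++ m :: []) := by simp [hY]
    have pX := perm_exchange u m X₃ X₄ (X₂ ++ [n])
    have pY := perm_exchange u m (Y₁ ++ n :: Y₃) Y₄ []
    rw [← eX] at pX
    rw [← eY] at pY
    rw [eX, eY]
    apply ReachesProxy.of_exchange
    exact before _ _ (X₄ ++ m :: X₃) X₂ (Y₄ ++ m :: Y₁) Y₃ u n v (by simp) (by simp) hk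
      (pX.nodup_iff.1 hn) (pX.symm.trans (hp.trans pY)) hv (by simp [hv'])
  -- moving the letter `u` of `X₁` to the end of the bottom word
  have moved : ∀ (Y₃ Y₄ : List α) (u : α), u ∈ X₁ → Y₂ = Y₃ ++ u :: Y₄ →
      (∀ V W : List α, ReachesProxy A D (V ++ u :: (X₂ ++ [n])) (W ++ n :: (Y₃ ++ [u]))) →
      ReachesProxy A D X Y := by
    rintro Y₃ Y₄ u hu rfl h
    obtain ⟨X₃, X₄, rfl⟩ := List.append_of_mem hu
    have eX : X = X₃ ++ u :: (X₄ ++ m :: (X₂ ++ [n])) := by simp [hX]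
    have eY : Y = (Y₁ ++ n :: Y₃) ++ u :: (Y₄ ++ m :: []) := by simp [hY]
    rw [eX, eY]
    apply ReachesProxy.of_exchange
    simpa using h (X₄ ++ m :: X₃) (Y₄ ++ m :: Y₁)
  have split : ∀ y ∈ Y₂, y ∈ X₁ ∨ y ∈ X₂ := by
    intro y hy
    have : y ∈ X := hp.symm.subset (by simp [hY, hy])
    obtain ⟨hyn, hym⟩ := nodup_ne_of_mem_middle (hY ▸ hnY) hy
    simpa [hX, hym, hyn] using this
  by_cases hb : ∃ u ∈ X₂, u ∈ Y₁
  · obtain ⟨u, hu, hu'⟩ := hb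
    exact before X Y X₁ X₂ Y₁ Y₂ m n u hX hY hk hn hp hu hu'
  have hsub : ∀ x ∈ X₂, x ∈ Y₂ := by
    intro x hx
    have : x ∈ Y := hp.subset (by simp [hX, hx])
    obtain ⟨hxm, hxn⟩ := nodup_ne_of_mem_middle (hX ▸ hn) hx
    have hxY : x ∉ Y₁ := fun h => hb ⟨x, hx, h⟩
    simpa [hY, hxm, hxn, hxY] using this
  rcases List.eq_nil_or_concat X₂ with rfl | ⟨X', q, rfl⟩
  · cases Y₂ with
    | nil => subst hX hY; exact reachesProxy_of_reversed_pair A D m n X₁ Y₁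
    | cons u Y₄ =>
      refine moved [] Y₄ u (by simpa using split u) rfl fun V W => ?_
      exact reachesProxy_of_reversed_pair A D u n V W
  rw [List.concat_eq_append] at *
  obtain ⟨y, Y₄, rfl⟩ := List.exists_cons_of_ne_nil (List.ne_nil_of_mem (hsub q (by simp)))
  have hqY : y = q ∨ q ∈ Y₄ := by simpa [eq_comm] using hsub q (by simp)
  by_cases hyq : y = q
  swap
  · have hq : q ∈ Y₄ := hqY.resolve_left hyq
    rcases split y (by simp) with h | h
    · exact crossed [] Y₄ y q h rfl (by simp) hq
    · have h : y ∈ X' := by simpa [hyq] using h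
      obtain ⟨X₃, X₄, rfl⟩ := List.append_of_mem h
      obtain ⟨Z₄, Z₅, rfl⟩ := List.append_of_mem hq
      exact ordered X₃ X₄ [] [] Z₄ Z₅ y q (by simp) (by simp)
  subst hyq
  rcases List.eq_nil_or_concat X' with rfl | ⟨X', p, rfl⟩
  · cases Y₄ with
    | nil => subst hX hY; exact reachesProxy_of_reversed_triple A D m y n X₁ Y₁ []
    | cons u Y₅ =>
      have huy : u ≠ y := by rintro rfl; simp at hnY₂
      refine moved [y] Y₅ u (by simpa [huy] using split u) rfl fun V W => ?_
      exact reachesProxy_of_reversed_triple A D u y n V W []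
  rw [List.concat_eq_append] at *
  have hpy : p ≠ y := by rintro rfl; simp [List.nodup_append] at hnX₂
  have hpY : p ∈ Y₄ := by simpa [hpy] using hsub p (by simp)
  obtain ⟨x, Y₅, rfl⟩ := List.exists_cons_of_ne_nil (List.ne_nil_of_mem hpY)
  have hpx : x = p ∨ p ∈ Y₅ := by simpa [eq_comm] using hpY
  have hxy : x ≠ y := by rintro rfl; simp at hnY₂
  by_cases hxp : x = p
  · subst hxp hX hY
    simpa using reachesProxy_of_reversed_triple A D x y n (X₁ ++ m :: X') Y₁ (Y₅ ++ [m])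
  have hp' : p ∈ Y₅ := hpx.resolve_left hxp
  rcases split x (by simp) with h | h
  · exact crossed [y] Y₅ x p h rfl (by simp) hp'
  · have h : x ∈ X' := by simpa [hxy, hxp] using h
    obtain ⟨X₃, X₄, rfl⟩ := List.append_of_mem h
    obtain ⟨Z₄, Z₅, rfl⟩ := List.append_of_mem hp'
    exact ordered X₃ X₄ [y] [y] Z₄ Z₅ x p (by simp) (by simp)

theorem exists_proxyRows {s : List α × List α} (h : RowInv s) (hlen : 3 < s.1.length) :
    ∃ t, RowReach s t ∧ ProxyRows t := by
  obtain ⟨A, D, X, Y, hr⟩ := exists_standard h (by omega)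
  have hi := h.reach hr
  have hn : (A :: (X ++ [D])).Nodup := hi.nodup
  have hp : (A :: (X ++ [D])).Perm (D :: (Y ++ [A])) := hi.perm
  have hXY : X.Perm Y := by
    have h₁ : (A :: (X ++ [D])).Perm (A :: D :: X) := (List.perm_append_singleton D X).cons A
    have h₂ : (D :: (Y ++ [A])).Perm (A :: D :: Y) :=
      ((List.perm_append_singleton A Y).cons D).trans (.swap ..)
    exact ((h₁.symm.trans hp).trans h₂).cons_inv.cons_inv
  have hX : X ≠ [] := by
    rintro rfl
    have hl : s.1.length = (standardRows A D [] Y).1.length := by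
      clear hi hn hp hXY
      generalize standardRows A D [] Y = t at hr
      induction hr with
      | refl => rfl
      | tail _ h ih => exact ih.trans h.perm.1.length_eq
    simp [standardRows] at hl
    omega
  have hnX : X.Nodup := by grind
  rcases List.eq_nil_or_concat X with rfl | ⟨X', n, rfl⟩
  · exact absurd rfl hX
  rcases List.eq_nil_or_concat Y with rfl | ⟨Y', m, rfl⟩
  · exact absurd hXY.eq_nil hX
  rw [List.concat_eq_append] at *
  rw [List.concat_eq_append] at *
  have hmn : n ≠ m := by
    rintro rfl
    exact hi.nondeg ⟨A, D, n, n, rfl, rfl, ⟨A :: X', [], by simp [standardRows]⟩,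
      ⟨D :: Y', [], by simp [standardRows]⟩, .inl rfl⟩
  have hm : m ∈ X' := by simpa [hmn.symm] using hXY.symm.subset (a := m) (by simp)
  have hn' : n ∈ Y' := by simpa [hmn] using hXY.subset (a := n) (by simp)
  obtain ⟨X₁, X₂, rfl⟩ := List.append_of_mem hm
  obtain ⟨Y₁, Y₂, rfl⟩ := List.append_of_mem hn'
  obtain ⟨t, ht, ht'⟩ := reachesProxy_aux A D _ _ _ X₁ X₂ Y₁ Y₂ m n (by simp) (by simp) rfl
    hnX hXY
  exact ⟨t, hr.trans ht, ht'⟩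

end ListRauzy

/-- The rows `T` and `B` describe the permutation `π`: the letter at position `i` of `T` is at
position `π i` of `B`. -/
structure Represents {α : Type*} {d : ℕ} (π : Equiv.Perm (Fin d)) (s : List α × List α) :
    Prop where
  length_top : s.1.length = d
  length_bot : s.2.length = d
  nodup_bot : s.2.Nodup
  getElem?_eq : ∀ i : Fin d, s.2[(π i : ℕ)]? = s.1[(i : ℕ)]?

namespace Represents

variable {α : Type*} {d : ℕ} {π π' : Equiv.Perm (Fin d)} {s t : List α × List α}

theorem apply_eq (h : Represents π s) (i : Fin d) {k : ℕ}
    (hki : s.2[k]? = s.1[(i : ℕ)]?) : (π i : ℕ) = k := by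
  refine (List.getElem?_inj (by rw [h.length_bot]; exact (π i).isLt) h.nodup_bot).1 ?_
  rw [h.getElem?_eq, hki]

theorem perm (h : Represents π s) : s.1.Perm s.2 := by
  have hT : s.1.Nodup := by
    rw [List.nodup_iff_injective_get]
    intro i j hij
    have hi := h.getElem?_eq ⟨i, h.length_top ▸ i.isLt⟩
    have hj := h.getElem?_eq ⟨j, h.length_top ▸ j.isLt⟩
    have he : s.1[(i : ℕ)]? = s.1[(j : ℕ)]? := by
      simp only [List.get_eq_getElem] at hij
      simp [hij]
    have := h.apply_eq ⟨i, h.length_top ▸ i.isLt⟩ (hj.trans he.symm)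
    have := π.injective (Fin.ext this)
    simpa [Fin.ext_iff] using this
  refine (List.subperm_of_subset hT ?_).perm_of_length_le (by rw [h.length_top, h.length_bot])
  intro x hx
  obtain ⟨i, hi, rfl⟩ := List.getElem_of_mem hx
  have := h.getElem?_eq ⟨i, h.length_top ▸ hi⟩
  simp only [List.getElem?_eq_getElem hi] at this
  exact List.mem_of_getElem? this

theorem exists_of_perm (hl : s.1.length = d) (hn : s.2.Nodup) (hp : s.1.Perm s.2) :
    ∃ π : Equiv.Perm (Fin d), Represents π s := by
  classical
  have hl' : s.2.length = d := hp.length_eq ▸ hl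
  let f : Fin d → Fin d := fun i =>
    ⟨s.2.idxOf (s.1[(i : ℕ)]'(hl ▸ i.isLt)), 
      (List.idxOf_lt_length_iff.2 (hp.subset (List.getElem_mem _))).trans_eq hl'⟩
  have hf : ∀ i : Fin d, s.2[(f i : ℕ)]? = s.1[(i : ℕ)]? := by
    intro i
    rw [List.getElem?_eq_getElem (by rw [hl']; exact (f i).isLt),
      List.getElem?_eq_getElem (by rw [hl]; exact i.isLt)]
    simp [f]
  have hinj : Function.Injective f := by
    intro i j hij
    have : s.1[(i : ℕ)]? = s.1[(j : ℕ)]? := by rw [← hf, ← hf, hij]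
    exact Fin.ext ((List.getElem?_inj (by rw [hl]; exact i.isLt) (hp.nodup_iff.2 hn)).1 this)
  exact ⟨Equiv.ofBijective f (Finite.injective_iff_bijective.1 hinj), hl, hl', hn, hf⟩

variable [NeZero d]

theorem rauzyMoveA {P Q R : List α} {w z : α}
    (h : Represents π (P ++ w :: (Q ++ [z]), R ++ [w]))
    (h' : Represents π' (P ++ w :: z :: Q, R ++ [w])) : RauzyMoveA π π' := by
  have hlT := h.length_top
  have hlB := h.length_bot
  simp only [List.length_append, List.length_cons, List.length_nil] at hlT hlB
  have hk : π.symm (lastIdx d) = ⟨P.length, by omega⟩ := by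
    rw [Equiv.symm_apply_eq, eq_comm]
    apply Fin.ext
    refine h.apply_eq _ ?_
    have : d - 1 = R.length := by omega
    simp [lastIdx, this]
  have key : ∀ i j : Fin d, (P ++ w :: (Q ++ [z]))[(i : ℕ)]? = (P ++ w :: z :: Q)[(j : ℕ)]? →
      π' j = π i := fun i j hij =>
    Fin.ext (h'.apply_eq j ((h.getElem?_eq i).trans hij))
  rw [RauzyMoveA, hk]
  intro j
  have hj := j.isLt
  refine ⟨fun hjP => key _ _ ?_, fun hjP => key _ _ ?_, fun hjP => key _ _ ?_⟩
  · grind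
  · simp only [lastIdx] at *
    grind
  · simp only at *
    grind

theorem rauzyMoveB {P Q R : List α} {w z : α}
    (h : Represents π (R ++ [w], P ++ w :: (Q ++ [z])))
    (h' : Represents π' (R ++ [w], P ++ w :: z :: Q)) : RauzyMoveB π π' := by
  have hlT := h.length_top
  have hlB := h.length_bot
  simp only [List.length_append, List.length_cons, List.length_nil] at hlT hlB
  have hk : (π (lastIdx d) : ℕ) = P.length := by
    refine h.apply_eq _ ?_
    have : d - 1 = R.length := by omega
    simp [lastIdx, this]
  have key : ∀ (j : Fin d) (k : ℕ),
      (P ++ w :: z :: Q)[k]? = (P ++ w :: (Q ++ [z]))[(π j : ℕ)]? → (π' j : ℕ) = k :=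
    fun j k hjk => h'.apply_eq j (hjk.trans (h.getElem?_eq j))
  rw [RauzyMoveB, hk]
  intro j
  have hj := (π j).isLt
  refine ⟨fun hjP => Fin.ext (key _ _ ?_), fun hjP hjd => key _ _ ?_,
    fun hjd => key _ _ ?_⟩
  · grind
  · grind
  · grind

theorem step (h : Represents π s) (hst : RowStep s t) :
    ∃ π' : Equiv.Perm (Fin d), (RauzyMoveA π π' ∨ RauzyMoveB π π') ∧ Represents π' t := by
  have hp := hst.perm
  obtain ⟨π', h'⟩ := exists_of_perm (s := t) (hp.1.length_eq ▸ h.length_top)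
    (hp.2.nodup_iff.1 h.nodup_bot) (hp.1.symm.trans (h.perm.trans hp.2))
  refine ⟨π', ?_, h'⟩
  cases hst with
  | top P Q R w z => exact .inl (rauzyMoveA h h')
  | bot P Q R w z => exact .inr (rauzyMoveB h h')

theorem reach (h : Represents π s) (hst : RowReach s t) :
    ∃ σ : Equiv.Perm (Fin d), InRauzyClass π σ ∧ Represents σ t := by
  induction hst with
  | refl => exact ⟨π, .refl, h⟩
  | tail _ hst ih =>
    obtain ⟨σ, hσ, hr⟩ := ih
    obtain ⟨τ, hτ, hr'⟩ := hr.step hst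
    exact ⟨τ, hσ.tail hτ, hr'⟩

end Represents

/-- The rows of a permutation, labelled by the positions in the top row. -/
def permRows {d : ℕ} (π : Equiv.Perm (Fin d)) : List (Fin d) × List (Fin d) :=
  (List.finRange d, (List.finRange d).map π.symm)

theorem represents_permRows {d : ℕ} (π : Equiv.Perm (Fin d)) : Represents π (permRows π) where
  length_top := by simp [permRows]
  length_bot := by simp [permRows]
  nodup_bot := (List.nodup_finRange d).map π.symm.injective
  getElem?_eq i := by simp [permRows]

theorem rowIrred_permRows {d : ℕ} {π : Equiv.Perm (Fin d)} (h : IsIrreducible π) :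
    RowIrred (permRows π).1 (permRows π).2 := by
  intro T₁ T₂ B₁ B₂ hT hB hp
  by_contra! hcon
  have hl := congrArg List.length hT
  simp only [permRows, List.length_finRange, List.length_append] at hl
  have h₁ := List.length_pos_iff.2 hcon.1
  have h₂ := List.length_pos_iff.2 hcon.2
  have eT : T₁ = (List.finRange d).take T₁.length := by
    rw [show List.finRange d = T₁ ++ T₂ from hT]; simp
  have eB : B₁ = ((List.finRange d).map π.symm).take T₁.length := by
    rw [show (List.finRange d).map π.symm = B₁ ++ B₂ from hB, hp.length_eq]; simp
  have mT : ∀ j : Fin d, j ∈ T₁ ↔ (j : ℕ) < T₁.length := by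
    intro j
    conv_lhs => rw [eT, List.mem_take_iff_getElem]
    constructor
    · rintro ⟨i, hi, rfl⟩
      simp at hi ⊢
      omega
    · intro hj
      exact ⟨j, by simp; omega, by simp⟩
  have mB : ∀ j : Fin d, j ∈ B₁ ↔ (π j : ℕ) < T₁.length := by
    intro j
    conv_lhs => rw [eB, List.mem_take_iff_getElem]
    constructor
    · rintro ⟨i, hi, rfl⟩
      simp at hi ⊢
      omega
    · intro hj
      exact ⟨π j, by simp; omega, by simp⟩
  refine h T₁.length h₁ (by omega) (Set.ext fun j => ?_)
  simp only [Set.mem_image, Set.mem_ofPred_eq]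
  constructor
  · rintro ⟨i, hi, rfl⟩
    rwa [← mB, ← hp.mem_iff, mT]
  · intro hj
    refine ⟨π.symm j, ?_, by simp⟩
    rw [← mT, hp.mem_iff, mB]
    simpa using hj

theorem not_leftDegenerate_permRows {d : ℕ} {π : Equiv.Perm (Fin d)} (h : ¬ IsDegenerate π) :
    ¬ LeftDegenerate (permRows π).1 (permRows π).2 := by
  have adj : ∀ (L : List (Fin d)) (x y : Fin d), Adjacent x y L →
      ∃ k, L[k]? = some x ∧ L[k + 1]? = some y := by
    rintro L x y ⟨U, V, rfl⟩
    exact ⟨U.length, by simp, by simp⟩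
  have gT : ∀ (k : ℕ) (x : Fin d), (List.finRange d)[k]? = some x → (x : ℕ) = k := by
    intro k x hx
    obtain ⟨hk, rfl⟩ := List.getElem?_eq_some_iff.1 hx
    simp
  have gB : ∀ (k : ℕ) (x : Fin d), ((List.finRange d).map π.symm)[k]? = some x →
      (π x : ℕ) = k := by
    intro k x hx
    obtain ⟨hk, rfl⟩ := List.getElem?_eq_some_iff.1 hx
    simp
  rintro ⟨a, f, c, e, h₁, h₂, h₃, h₄, h₅⟩
  obtain ⟨i, hc, hf⟩ := adj _ _ _ h₃
  obtain ⟨k, he, ha⟩ := adj _ _ _ h₄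
  rw [List.head?_eq_getElem?] at h₁ h₂
  rw [List.getLast?_eq_getElem?, List.getLast?_eq_getElem?] at h₅
  simp only [permRows] at *
  replace hc := gT _ _ hc
  replace hf := gT _ _ hf
  replace h₁ := gT _ _ h₁
  replace h₂ := gB _ _ h₂
  replace he := gB _ _ he
  replace ha := gB _ _ ha
  subst hc
  have hlt : (c : ℕ) + 1 < d := hf ▸ f.isLt
  have ef : (⟨(c : ℕ) + 1, hlt⟩ : Fin d) = f := Fin.ext hf.symm
  have ea : (⟨0, by omega⟩ : Fin d) = a := Fin.ext h₁.symm
  refine h ⟨c, hlt, ?_⟩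
  rw [ef, ea]
  rcases h₅ with rfl | ⟨h₅, h₅'⟩
  · exact .inr (.inr (.inl ⟨h₂, by simp only [Fin.eta]; omega⟩))
  · replace h₅ := gB _ _ h₅
    replace h₅' := gT _ _ h₅'
    simp only [List.length_map, List.length_finRange] at h₅ h₅'
    have ee : (⟨d - 1, by omega⟩ : Fin d) = e := Fin.ext h₅'.symm
    refine .inr (.inl ⟨h₅, h₂, ?_⟩)
    rw [ee]; omega

theorem rowInv_permRows {d : ℕ} {π : Equiv.Perm (Fin d)} (hirr : IsIrreducible π)
    (hnd : ¬ IsDegenerate π) : RowInv (permRows π) where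
  nodup := List.nodup_finRange d
  perm := (represents_permRows π).perm
  irred := rowIrred_permRows hirr
  nondeg := not_leftDegenerate_permRows hnd

/-- Every Rauzy class of an irreducible non-degenerate permutation of
`{1,…,d}`, `d > 3`, contains a (4321) proxy (`σ(d-3)=d, σ(d-2)=d-1, σ(d-1)=d-2,
σ(d)=1`) or a (4321) quasi-proxy (`σ(1)=d, σ(d-2)=d-1, σ(d-1)=d-2, σ(d)=1`)
permutation (written 0-indexed on `Fin d`). -/
theorem rauzy_class_contains_proxy {d : ℕ} [NeZero d] (hd : 3 < d)
    (π : Equiv.Perm (Fin d)) (hirr : IsIrreducible π) (hnd : ¬ IsDegenerate π) :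
    ∃ σ : Equiv.Perm (Fin d), InRauzyClass π σ ∧
      ((σ ⟨d - 4, by omega⟩ = lastIdx d ∧ σ ⟨d - 3, by omega⟩ = ⟨d - 2, by omega⟩ ∧
        σ ⟨d - 2, by omega⟩ = ⟨d - 3, by omega⟩ ∧ σ (lastIdx d) = ⟨0, by omega⟩) ∨
       (σ ⟨0, by omega⟩ = lastIdx d ∧ σ ⟨d - 3, by omega⟩ = ⟨d - 2, by omega⟩ ∧
        σ ⟨d - 2, by omega⟩ = ⟨d - 3, by omega⟩ ∧ σ (lastIdx d) = ⟨0, by omega⟩)) := by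
  obtain ⟨⟨T, B⟩, hr, p, q, r, D, U, V, hT, hB⟩ :=
    exists_proxyRows (rowInv_permRows hirr hnd) (by simpa [permRows] using hd)
  obtain ⟨σ, hσ, h⟩ := (represents_permRows π).reach hr
  have hlT := h.length_top
  have hlB := h.length_bot
  dsimp only at hT hB hlT hlB
  refine ⟨σ, hσ, ?_⟩
  have key : ∀ i j : Fin d, B[(j : ℕ)]? = T[(i : ℕ)]? → σ i = j := fun i j hij =>
    Fin.ext (h.apply_eq i hij)
  rcases hT with rfl | rfl
  · left
    subst hB
    simp only [List.length_append, List.length_cons, List.length_nil] at hlT hlB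
    refine ⟨key _ _ ?_, key _ _ ?_, key _ _ ?_, key _ _ ?_⟩ <;> simp only [lastIdx] <;> grind
  · right
    subst hB
    simp only [List.length_append, List.length_cons, List.length_nil] at hlT hlB
    refine ⟨key _ _ ?_, key _ _ ?_, key _ _ ?_, key _ _ ?_⟩ <;> simp only [lastIdx] <;> grind

end IETPaper
end

section
/- Let c_2 and c_3 be positive integers with gcd(c_2, c_3) = 1 and set g = 2·c_2·c_3. If M is a natural number with g ≤ M ≤ 5g·c_2 + 5g·c_3 − g, then there exist natural numbers a, b with 0 ≤ a ≤ 5g and 0 ≤ b ≤ 5g such that M = a·c_2 + b·c_3. -/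
open Finset MeasureTheory

namespace IETPaper

/-- If `c` and `d` are coprime and positive and `c, d ≤ K`, every integer `M` with
`c d ≤ M ≤ K c + K d - c d` is of the form `a c + b d` with `0 ≤ a, b ≤ K`. -/
theorem exists_bounded_combination {c d K M : ℤ} (hc : 0 < c) (hd : 0 < d)
    (hcd : IsCoprime c d) (hcK : c ≤ K) (hdK : d ≤ K) (hM : c * d ≤ M)
    (hM' : M ≤ K * c + K * d - c * d) :
    ∃ a b : ℤ, 0 ≤ a ∧ a ≤ K ∧ 0 ≤ b ∧ b ≤ K ∧ M = a * c + b * d := by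
  obtain ⟨u, v, huv⟩ := hcd
  obtain hle | hle := le_total M (K * d)
  · have hr := Int.emod_nonneg (M * u) hd.ne'
    have hr' := Int.emod_lt_of_pos (M * u) hd
    have hdiv := Int.emod_add_mul_ediv (M * u) d
    set r := M * u % d
    set q := M * u / d
    have heq : M = r * c + (M * v + q * c) * d := by linear_combination -M * huv - c * hdiv
    refine ⟨r, M * v + q * c, hr, by linarith, ?_, ?_, heq⟩
    · refine le_of_mul_le_mul_right ?_ hd
      nlinarith
    · refine le_of_mul_le_mul_right ?_ hd
      nlinarith
  · have hr := Int.emod_nonneg (K - M * v) hc.ne'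
    have hr' := Int.emod_lt_of_pos (K - M * v) hc
    have hdiv := Int.emod_add_mul_ediv (K - M * v) c
    set r := (K - M * v) % c
    set q := (K - M * v) / c
    have heq : M = (M * u - d * q) * c + (K - r) * d := by
      linear_combination -M * huv + d * hdiv
    refine ⟨M * u - d * q, K - r, ?_, ?_, by linarith, by linarith, heq⟩
    · refine le_of_mul_le_mul_right ?_ hc
      nlinarith
    · refine le_of_mul_le_mul_right ?_ hc
      nlinarith

/-- If `gcd(c₂,c₃) = 1`, `c₂, c₃ > 0`, `g = 2 c₂ c₃` and
`g ≤ M ≤ 5 g c₂ + 5 g c₃ - g`, then `M = a c₂ + b c₃` with `0 ≤ a, b ≤ 5 g`. -/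
theorem combination_of_relatively_prime (c₂ c₃ : ℕ) (h2 : 0 < c₂) (h3 : 0 < c₃)
    (hgcd : Nat.gcd c₂ c₃ = 1) (g : ℕ) (hg : g = 2 * c₂ * c₃)
    (M : ℕ) (hM1 : g ≤ M)
    (hM2 : (M : ℤ) ≤ 5 * g * c₂ + 5 * g * c₃ - g) :
    ∃ a b : ℕ, a ≤ 5 * g ∧ b ≤ 5 * g ∧ M = a * c₂ + b * c₃ := by
  have hc : (0 : ℤ) < c₂ := by exact_mod_cast h2
  have hd : (0 : ℤ) < c₃ := by exact_mod_cast h3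
  have hgz : (g : ℤ) = 2 * c₂ * c₃ := by exact_mod_cast hg
  have hMz : (g : ℤ) ≤ M := by exact_mod_cast hM1
  have hpos : (0 : ℤ) < c₂ * c₃ := mul_pos hc hd
  obtain ⟨a, b, ha, haK, hb, hbK, h⟩ :=
    exists_bounded_combination (K := 5 * g) (M := M) hc hd
      (Nat.isCoprime_iff_coprime.mpr hgcd) (by nlinarith) (by nlinarith) (by linarith)
      (by linarith)
  lift a to ℕ using ha
  lift b to ℕ using hb
  exact ⟨a, b, by exact_mod_cast haK, by exact_mod_cast hbK, by exact_mod_cast h⟩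

end IETPaper
end
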